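/- Let f ∈ W¹₁(ℝⁿ), n ≥ 2, with all weak partial derivatives D_j f ∈ H¹(ℝⁿ) (the real Hardy space). Then for any 1 < q < (n−1)/(n−2) (interpreting (n−1)/(n−2) = ∞ when n = 2), with α = 1 − (n−1)/q', one has Σ_{k=1}^n ∫₀^∞ h^{-α} ‖Δ_k(h)f‖_{V_{q,k}} dh/h ≤ c Σ_{k=1}^n ‖D_k f‖_{H¹}, where V_{q,k} is the mixed-norm space obtained by taking first the L¹(ℝ) norm in x_k and then the Lorentz L^{q,1}(ℝ^{n-1}) norm in the remaining variables. -/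

import Mathlib

open MeasureTheory ENNReal Set
noncomputable section

/-- Nonincreasing rearrangement of an ℝ≥0∞-valued function. -/
def rearr {α : Type*} [MeasurableSpace α] (μ : Measure α) (f : α → ℝ≥0∞) (t : ℝ) : ℝ≥0∞ :=
  sInf {y : ℝ≥0∞ | μ {x | y < f x} ≤ ENNReal.ofReal t}

/-- Lorentz L^{q,1} functional. -/
def lorentz {α : Type*} [MeasurableSpace α] (μ : Measure α) (f : α → ℝ≥0∞)
    (q ν : ℝ) : ℝ≥0∞ :=
  (∫⁻ t in Set.Ioi (0:ℝ),
    (ENNReal.ofReal (t ^ (1/q)) * rearr μ f t) ^ ν / ENNReal.ofReal t) ^ (1/ν)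

/-- g is the k-th weak partial derivative of f on ℝᵐ. -/
def IsWeakDeriv {m : ℕ} (k : Fin m) (f g : (Fin m → ℝ) → ℝ) : Prop :=
  ∀ φ : (Fin m → ℝ) → ℝ, ContDiff ℝ (⊤ : ℕ∞) φ → HasCompactSupport φ →
    ∫ x, f x * deriv (fun s => φ (Function.update x k s)) (x k) = - ∫ x, g x * φ x

/-- Difference Δ_k(h)f(x) = f(x + h e_k) − f(x). -/
def Delta {m : ℕ} (k : Fin m) (h : ℝ) (f : (Fin m → ℝ) → ℝ) : (Fin m → ℝ) → ℝ :=
  fun x => f (Function.update x k (x k + h)) - f x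

/-- Euclidean norm on ℝᵐ (as a plain pi type). -/
def eucNorm {m : ℕ} (y : Fin m → ℝ) : ℝ := Real.sqrt (∑ i, y i ^ 2)

/-- g is the j-th Riesz transform of f:
g(x) = lim_{ε→0⁺} c_m ∫_{|y|≥ε} y_j |y|^{-m-1} f(x−y) dy a.e., c_m = Γ((m+1)/2)/π^{(m+1)/2}. -/
def IsRieszTransform {m : ℕ} (j : Fin m) (f g : (Fin m → ℝ) → ℝ) : Prop :=
  ∀ᵐ x : Fin m → ℝ, Filter.Tendsto
    (fun ε : ℝ => ∫ y in {y : Fin m → ℝ | ε ≤ eucNorm y},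
      (Real.Gamma (((m:ℝ)+1)/2) / Real.pi ^ (((m:ℝ)+1)/2)) *
        y j / eucNorm y ^ (m+1) * f (x - y))
    (nhdsWithin 0 (Set.Ioi 0)) (nhds (g x))

/-- Mixed norm ‖g‖_{V_{q,k}}: first L¹(ℝ) in the k-th variable, then Lorentz
L^{q,1}(ℝⁿ) in the remaining variables. -/
def mixedV {n : ℕ} (q : ℝ) (k : Fin (n+1)) (g : (Fin (n+1) → ℝ) → ℝ) : ℝ≥0∞ :=
  lorentz volume
    (fun y : Fin n → ℝ => ∫⁻ s : ℝ, (‖g (k.insertNth s y)‖₊ : ℝ≥0∞)) q 1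

namespace HardySobolev

open Filter Topology

section Kernels

/-! ### Kernels on the half-space -/

/-- Squared Euclidean norm on a plain pi type. -/
def normSq {m : ℕ} (z : Fin m → ℝ) : ℝ := ∑ i, z i ^ 2

/-- The `k`-th coordinate vector. -/
def basisVec {m : ℕ} (k : Fin m) : Fin m → ℝ := Pi.single k 1

/-- Kronecker delta. -/
def delta {m : ℕ} (i j : Fin m) : ℝ := if i = j then 1 else 0

variable {N : ℕ}

/-- The field `z / |z|^d` in dimension `d`; its zeroth component is the unnormalised
Poisson kernel. -/
def kerField {m : ℕ} (i : Fin m) (z : Fin m → ℝ) : ℝ := z i * normSq z ^ (-((m : ℝ) / 2))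

/-- First derivatives of `kerField`. -/
def kerGrad {m : ℕ} (i j : Fin m) (z : Fin m → ℝ) : ℝ :=
  delta i j * normSq z ^ (-((m : ℝ) / 2)) - m * (z i * z j) * normSq z ^ (-((m : ℝ) / 2) - 1)

/-- Second derivatives of `kerField`. -/
def kerHess {m : ℕ} (i j k : Fin m) (z : Fin m → ℝ) : ℝ :=
  m * (m + 2) * (z i * z j * z k) * normSq z ^ (-((m : ℝ) / 2) - 1 - 1)
    - m * (delta i j * z k + delta i k * z j + delta j k * z i) *
      normSq z ^ (-((m : ℝ) / 2) - 1)

lemma delta_comm {m : ℕ} (i j : Fin m) : delta i j = delta j i := by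
  simp [delta, eq_comm]

lemma normSq_nonneg {m : ℕ} (z : Fin m → ℝ) : 0 ≤ normSq z :=
  Finset.sum_nonneg fun _ _ => sq_nonneg _

lemma sq_le_normSq {m : ℕ} (z : Fin m → ℝ) (i : Fin m) : z i ^ 2 ≤ normSq z :=
  Finset.single_le_sum (f := fun i => z i ^ 2) (fun _ _ => sq_nonneg _) (Finset.mem_univ i)

lemma abs_le_sqrt_normSq {m : ℕ} (z : Fin m → ℝ) (i : Fin m) : |z i| ≤ √(normSq z) :=
  Real.abs_le_sqrt (sq_le_normSq z i)

lemma norm_le_sqrt_normSq {m : ℕ} (z : Fin m → ℝ) : ‖z‖ ≤ √(normSq z) :=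
  (pi_norm_le_iff_of_nonneg (Real.sqrt_nonneg _)).2 fun i => abs_le_sqrt_normSq z i

lemma norm_sq_le_normSq {m : ℕ} (z : Fin m → ℝ) : ‖z‖ ^ 2 ≤ normSq z := by
  have := norm_le_sqrt_normSq z
  calc ‖z‖ ^ 2 ≤ √(normSq z) ^ 2 := by gcongr
    _ = normSq z := Real.sq_sqrt (normSq_nonneg z)

lemma normSq_le_norm_sq {m : ℕ} (z : Fin m → ℝ) : normSq z ≤ m * ‖z‖ ^ 2 := by
  have : ∀ i ∈ Finset.univ, z i ^ 2 ≤ ‖z‖ ^ 2 := fun i _ => by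
    rw [← sq_abs]
    gcongr
    exact norm_le_pi_norm z i
  simpa [normSq] using Finset.sum_le_card_nsmul _ _ _ this

lemma normSq_pos_of_coord {m : ℕ} {z : Fin m → ℝ} {i : Fin m} (h : z i ≠ 0) : 0 < normSq z :=
  lt_of_lt_of_le (by positivity) (sq_le_normSq z i)

lemma continuous_normSq {m : ℕ} : Continuous (normSq : (Fin m → ℝ) → ℝ) := by
  unfold normSq; fun_prop

lemma contDiff_normSq {m : ℕ} : ContDiff ℝ (⊤ : ℕ∞) (normSq : (Fin m → ℝ) → ℝ) := by
  unfold normSq; fun_prop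

lemma normSq_line {m : ℕ} (z : Fin m → ℝ) (k : Fin m) (s : ℝ) :
    normSq (z + s • basisVec k) = normSq z + 2 * s * z k + s ^ 2 := by
  have : ∀ i, (z + s • basisVec k) i ^ 2 = z i ^ 2 + if i = k then 2 * s * z k + s ^ 2 else 0 := by
    intro i
    by_cases h : i = k
    · subst h; simp [basisVec]; ring
    · simp [basisVec, h]
  simp only [normSq, this, Finset.sum_add_distrib, Finset.sum_ite_eq', Finset.mem_univ, if_true]
  ring

lemma coord_line {m : ℕ} (z : Fin m → ℝ) (i k : Fin m) (s : ℝ) :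
    (z + s • basisVec k) i = z i + s * delta i k := by
  by_cases h : i = k
  · subst h; simp [basisVec, delta]
  · simp [basisVec, delta, h]

lemma hasLineDerivAt_coord {m : ℕ} (z : Fin m → ℝ) (i k : Fin m) :
    HasLineDerivAt ℝ (fun z : Fin m → ℝ => z i) (delta i k) z (basisVec k) := by
  unfold HasLineDerivAt
  simp only [coord_line]
  simpa using ((hasDerivAt_id (0 : ℝ)).mul_const (delta i k)).const_add (z i)

lemma hasLineDerivAt_normSq_rpow {m : ℕ} {z : Fin m → ℝ} (hz : 0 < normSq z) (k : Fin m) (b : ℝ) :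
    HasLineDerivAt ℝ (fun z : Fin m → ℝ => normSq z ^ b) (2 * b * z k * normSq z ^ (b - 1)) z
      (basisVec k) := by
  unfold HasLineDerivAt
  simp only [normSq_line]
  have h1 : HasDerivAt (fun s : ℝ => normSq z + 2 * s * z k + s ^ 2) (2 * z k) 0 := by
    have := ((((hasDerivAt_id (0 : ℝ)).const_mul 2).mul_const (z k)).const_add (normSq z)).add
      ((hasDerivAt_id (0 : ℝ)).pow 2)
    exact this.congr_deriv (by simp)
  have := h1.rpow_const (p := b) (Or.inl (by simpa using hz.ne'))
  refine this.congr_deriv ?_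
  rw [show normSq z + 2 * 0 * z k + 0 ^ 2 = normSq z by ring]; ring

lemma _root_.HasLineDerivAt.add' {m : ℕ} {f g : (Fin m → ℝ) → ℝ} {f' g' : ℝ} {z v : Fin m → ℝ}
    (hf : HasLineDerivAt ℝ f f' z v) (hg : HasLineDerivAt ℝ g g' z v) :
    HasLineDerivAt ℝ (fun z => f z + g z) (f' + g') z v := HasDerivAt.add hf hg

lemma _root_.HasLineDerivAt.sub' {m : ℕ} {f g : (Fin m → ℝ) → ℝ} {f' g' : ℝ} {z v : Fin m → ℝ}
    (hf : HasLineDerivAt ℝ f f' z v) (hg : HasLineDerivAt ℝ g g' z v) :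
    HasLineDerivAt ℝ (fun z => f z - g z) (f' - g') z v := HasDerivAt.sub hf hg

lemma _root_.HasLineDerivAt.mul' {m : ℕ} {f g : (Fin m → ℝ) → ℝ} {f' g' : ℝ} {z v : Fin m → ℝ}
    (hf : HasLineDerivAt ℝ f f' z v) (hg : HasLineDerivAt ℝ g g' z v) :
    HasLineDerivAt ℝ (fun z => f z * g z) (f' * g z + f z * g') z v := by
  have := HasDerivAt.fun_mul hf hg
  simpa only [HasLineDerivAt, zero_smul, add_zero] using this

lemma _root_.HasLineDerivAt.const_mul' {m : ℕ} {f : (Fin m → ℝ) → ℝ} {f' : ℝ} {z v : Fin m → ℝ}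
    (hf : HasLineDerivAt ℝ f f' z v) (c : ℝ) :
    HasLineDerivAt ℝ (fun z => c * f z) (c * f') z v := HasDerivAt.const_mul c hf

lemma _root_.HasLineDerivAt.rpow_const' {m : ℕ} {f : (Fin m → ℝ) → ℝ} {f' : ℝ} {z v : Fin m → ℝ}
    (hf : HasLineDerivAt ℝ f f' z v) (b : ℝ) (h : f z ≠ 0) :
    HasLineDerivAt ℝ (fun z => f z ^ b) (f' * b * f z ^ (b - 1)) z v := by
  have := HasDerivAt.rpow_const (p := b) hf (Or.inl (by simpa using h))
  simpa [HasLineDerivAt] using this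

lemma _root_.HasLineDerivAt.sum' {m : ℕ} {ι : Type*} {s : Finset ι} {f : ι → (Fin m → ℝ) → ℝ}
    {f' : ι → ℝ} {z v : Fin m → ℝ}
    (hf : ∀ i ∈ s, HasLineDerivAt ℝ (f i) (f' i) z v) :
    HasLineDerivAt ℝ (fun z => ∑ i ∈ s, f i z) (∑ i ∈ s, f' i) z v :=
  HasDerivAt.fun_sum hf

lemma hasLineDerivAt_const' {m : ℕ} (c : ℝ) (z v : Fin m → ℝ) :
    HasLineDerivAt ℝ (fun _ : Fin m → ℝ => c) 0 z v := hasDerivAt_const _ _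

lemma hasLineDerivAt_kerField {m : ℕ} {z : Fin m → ℝ} (hz : 0 < normSq z) (i k : Fin m) :
    HasLineDerivAt ℝ (kerField i) (kerGrad i k z) z (basisVec k) := by
  refine (HasLineDerivAt.mul' (hasLineDerivAt_coord z i k)
    (hasLineDerivAt_normSq_rpow hz k (-((m : ℝ) / 2)))).congr_deriv ?_
  simp only [kerGrad]; ring

lemma hasLineDerivAt_kerGrad {m : ℕ} {z : Fin m → ℝ} (hz : 0 < normSq z) (i j k : Fin m) :
    HasLineDerivAt ℝ (kerGrad i j) (kerHess i j k z) z (basisVec k) := by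
  refine (HasLineDerivAt.sub'
    (HasLineDerivAt.const_mul' (hasLineDerivAt_normSq_rpow hz k (-((m : ℝ) / 2))) (delta i j))
    (HasLineDerivAt.mul' (HasLineDerivAt.const_mul' (HasLineDerivAt.mul'
      (hasLineDerivAt_coord z i k) (hasLineDerivAt_coord z j k)) (m : ℝ))
      (hasLineDerivAt_normSq_rpow hz k (-((m : ℝ) / 2) - 1)))).congr_deriv ?_
  simp only [kerHess]; ring

lemma kerHess_swap {m : ℕ} (i j k : Fin m) (z : Fin m → ℝ) :
    kerHess i j k z = kerHess i k j z := by
  simp only [kerHess, delta_comm j k]; ring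

lemma kerHess_swap_left {m : ℕ} (i j k : Fin m) (z : Fin m → ℝ) :
    kerHess i j k z = kerHess j i k z := by
  simp only [kerHess, delta_comm j i]; ring

lemma sum_kerGrad {m : ℕ} {z : Fin m → ℝ} (hz : 0 < normSq z) : ∑ i, kerGrad i i z = 0 := by
  have h1 : ∑ i : Fin m, z i * z i = normSq z := by simp [normSq, sq]
  simp only [kerGrad, Finset.sum_sub_distrib, ← Finset.sum_mul, ← Finset.mul_sum, h1]
  rw [Real.rpow_sub_one hz.ne' (-((m : ℝ) / 2))]
  simp only [delta, if_true, Finset.sum_const, Finset.card_univ, Fintype.card_fin, nsmul_eq_mul]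
  field_simp
  ring

lemma sum_kerHess {m : ℕ} {z : Fin m → ℝ} (hz : 0 < normSq z) (i : Fin m) :
    ∑ j, kerHess i j j z = 0 := by
  have h1 : ∑ j : Fin m, z i * z j * z j = z i * normSq z := by
    simp [normSq, sq, Finset.mul_sum, mul_assoc]
  have h2 : ∑ j : Fin m, (delta i j * z j + delta i j * z j + delta j j * z i) = (m + 2) * z i := by
    simp [delta, Finset.sum_add_distrib]; ring
  have h3 : normSq z ^ (-((m : ℝ) / 2) - 1) = normSq z * normSq z ^ (-((m : ℝ) / 2) - 1 - 1) := by
    rw [Real.rpow_sub_one hz.ne' (-((m : ℝ) / 2) - 1)]; field_simp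
  simp only [kerHess, Finset.sum_sub_distrib, ← Finset.sum_mul, ← Finset.mul_sum, h1, h2, h3]
  ring

end Kernels

section KernelBounds

/-! ### Kernel bounds -/

lemma abs_coord_le_rpow {m : ℕ} (z : Fin m → ℝ) (i : Fin m) : |z i| ≤ normSq z ^ (1 / 2 : ℝ) := by
  rw [← Real.sqrt_eq_rpow]; exact abs_le_sqrt_normSq z i

lemma abs_delta_le {m : ℕ} (i j : Fin m) : |delta i j| ≤ 1 := by
  unfold delta; split_ifs <;> simp

lemma abs_kerField_le {m : ℕ} {z : Fin m → ℝ} (hz : 0 < normSq z) (i : Fin m) :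
    |kerField i z| ≤ normSq z ^ (-(((m : ℝ) - 1) / 2)) := by
  rw [kerField, abs_mul, abs_of_nonneg (Real.rpow_nonneg hz.le _)]
  calc _ ≤ normSq z ^ (1 / 2 : ℝ) * normSq z ^ (-((m : ℝ) / 2)) := by
        gcongr; exact abs_coord_le_rpow z i
    _ = _ := by rw [← Real.rpow_add hz]; ring_nf

lemma abs_mul_coord_le {m : ℕ} (z : Fin m → ℝ) (i j : Fin m) : |z i * z j| ≤ normSq z := by
  rw [abs_mul]
  calc _ ≤ √(normSq z) * √(normSq z) := by
        gcongr <;> exact abs_le_sqrt_normSq z _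
    _ = _ := Real.mul_self_sqrt (normSq_nonneg z)

lemma abs_kerGrad_le {m : ℕ} {z : Fin m → ℝ} (hz : 0 < normSq z) (i j : Fin m) :
    |kerGrad i j z| ≤ (1 + m) * normSq z ^ (-((m : ℝ) / 2)) := by
  have h0 := Real.rpow_nonneg hz.le (-((m : ℝ) / 2))
  have h1 := Real.rpow_nonneg hz.le (-((m : ℝ) / 2) - 1)
  have h2 : normSq z * normSq z ^ (-((m : ℝ) / 2) - 1) = normSq z ^ (-((m : ℝ) / 2)) := by
    rw [Real.rpow_sub_one hz.ne']; field_simp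
  calc |kerGrad i j z| ≤ |delta i j * normSq z ^ (-((m : ℝ) / 2))| +
        |m * (z i * z j) * normSq z ^ (-((m : ℝ) / 2) - 1)| := abs_sub _ _
    _ ≤ 1 * normSq z ^ (-((m : ℝ) / 2)) + m * normSq z * normSq z ^ (-((m : ℝ) / 2) - 1) := by
        rw [abs_mul, abs_mul _ (normSq z ^ (-((m : ℝ) / 2) - 1)), abs_mul (m : ℝ), abs_of_nonneg h0,
          abs_of_nonneg h1, Nat.abs_cast]
        gcongr
        · exact abs_delta_le i j
        · exact abs_mul_coord_le z i j
    _ = _ := by rw [mul_assoc (m : ℝ), h2]; ring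

lemma abs_kerHess_le {m : ℕ} {z : Fin m → ℝ} (hz : 0 < normSq z) (i j k : Fin m) :
    |kerHess i j k z| ≤ (m * (m + 2) + 3 * m) * normSq z ^ (-(((m : ℝ) + 1) / 2)) := by
  have h0 := Real.rpow_nonneg hz.le (1 / 2 : ℝ)
  have h1 := Real.rpow_nonneg hz.le (-((m : ℝ) / 2) - 1)
  have h2 := Real.rpow_nonneg hz.le (-((m : ℝ) / 2) - 1 - 1)
  have e1 : normSq z * normSq z ^ (-((m : ℝ) / 2) - 1 - 1) = normSq z ^ (-((m : ℝ) / 2) - 1) := by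
    rw [Real.rpow_sub_one hz.ne' (-((m : ℝ) / 2) - 1)]; field_simp
  have e2 : normSq z ^ (1 / 2 : ℝ) * normSq z ^ (-((m : ℝ) / 2) - 1)
      = normSq z ^ (-(((m : ℝ) + 1) / 2)) := by
    rw [← Real.rpow_add hz]; ring_nf
  have d1 : ∀ a b c : Fin m, |delta a b * z c| ≤ normSq z ^ (1 / 2 : ℝ) := fun a b c => by
    rw [abs_mul, ← one_mul (normSq z ^ (1 / 2 : ℝ))]
    exact mul_le_mul (abs_delta_le a b) (abs_coord_le_rpow z c) (abs_nonneg _) zero_le_one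
  have d2 : |delta i j * z k + delta i k * z j + delta j k * z i| ≤ 3 * normSq z ^ (1 / 2 : ℝ) :=
    (abs_add_three _ _ _).trans (by linarith [d1 i j k, d1 i k j, d1 j k i])
  have d3 : |z i * z j * z k| ≤ normSq z * normSq z ^ (1 / 2 : ℝ) := by
    rw [abs_mul]
    exact mul_le_mul (abs_mul_coord_le z i j) (abs_coord_le_rpow z k) (abs_nonneg _)
      (normSq_nonneg z)
  refine (abs_sub _ _).trans ?_
  rw [abs_mul, abs_mul _ (normSq z ^ (-((m : ℝ) / 2) - 1)), abs_mul _ (z i * z j * z k),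
    abs_mul (m : ℝ) (delta i j * z k + delta i k * z j + delta j k * z i),
    abs_of_nonneg h2, abs_of_nonneg h1, abs_of_nonneg (by positivity : (0 : ℝ) ≤ m * (m + 2)),
    Nat.abs_cast]
  calc _ ≤ m * (m + 2) * (normSq z * normSq z ^ (1 / 2 : ℝ)) * normSq z ^ (-((m : ℝ) / 2) - 1 - 1)
        + m * (3 * normSq z ^ (1 / 2 : ℝ)) * normSq z ^ (-((m : ℝ) / 2) - 1) := by gcongr
    _ = m * (m + 2) * (normSq z ^ (1 / 2 : ℝ) * (normSq z * normSq z ^ (-((m : ℝ) / 2) - 1 - 1)))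
        + 3 * m * (normSq z ^ (1 / 2 : ℝ) * normSq z ^ (-((m : ℝ) / 2) - 1)) := by ring
    _ = _ := by rw [e1, e2]; ring

variable {N : ℕ}

/-- A kernel on the upper half-space which is continuous and `O(1/‖z‖)` away from the boundary. -/
structure GoodKer (κ : (Fin (N + 1) → ℝ) → ℝ) : Prop where
  cont : ∀ z, 0 < z 0 → ContinuousAt κ z
  bound : ∀ t > 0, ∃ C ≥ 0, ∀ z, t ≤ z 0 → |κ z| * ‖z‖ ≤ C

lemma bound_of_rpow {κ : (Fin (N + 1) → ℝ) → ℝ} {C a : ℝ} (hC : 0 ≤ C) (ha : 1 / 2 ≤ a)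
    (h : ∀ z, 0 < normSq z → |κ z| ≤ C * normSq z ^ (-a)) (t : ℝ) (ht : 0 < t) :
    ∃ C ≥ 0, ∀ z, t ≤ z 0 → |κ z| * ‖z‖ ≤ C := by
  refine ⟨C * (t ^ 2) ^ (1 / 2 - a), by positivity, fun z hz => ?_⟩
  have h2 : t ^ 2 ≤ normSq z := le_trans (by gcongr) (sq_le_normSq z 0)
  have hp : 0 < normSq z := lt_of_lt_of_le (by positivity) h2
  calc |κ z| * ‖z‖ ≤ C * normSq z ^ (-a) * normSq z ^ (1 / 2 : ℝ) := by
        gcongr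
        · exact h z hp
        · rw [← Real.sqrt_eq_rpow]; exact norm_le_sqrt_normSq z
    _ = C * normSq z ^ (1 / 2 - a) := by
        rw [mul_assoc, ← Real.rpow_add hp]; ring_nf
    _ ≤ C * (t ^ 2) ^ (1 / 2 - a) := by
        gcongr C * ?_
        exact Real.rpow_le_rpow_of_nonpos (by positivity) h2 (by linarith)

lemma continuousAt_normSq_rpow {m : ℕ} {z : Fin m → ℝ} (hz : 0 < normSq z) (b : ℝ) :
    ContinuousAt (fun z : Fin m → ℝ => normSq z ^ b) z :=
  continuous_normSq.continuousAt.rpow_const (Or.inl hz.ne')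

lemma continuousAt_kerField {m : ℕ} {z : Fin m → ℝ} (hz : 0 < normSq z) (i : Fin m) :
    ContinuousAt (kerField i) z :=
  (continuous_apply i).continuousAt.mul (continuousAt_normSq_rpow hz _)

lemma continuousAt_kerGrad {m : ℕ} {z : Fin m → ℝ} (hz : 0 < normSq z) (i j : Fin m) :
    ContinuousAt (kerGrad i j) z := by
  have h1 := continuousAt_normSq_rpow hz (-((m : ℝ) / 2))
  have h2 := continuousAt_normSq_rpow hz (-((m : ℝ) / 2) - 1)
  unfold kerGrad; fun_prop

lemma continuousAt_kerHess {m : ℕ} {z : Fin m → ℝ} (hz : 0 < normSq z) (i j k : Fin m) :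
    ContinuousAt (kerHess i j k) z := by
  have h1 := continuousAt_normSq_rpow hz (-((m : ℝ) / 2) - 1)
  have h2 := continuousAt_normSq_rpow hz (-((m : ℝ) / 2) - 1 - 1)
  unfold kerHess; fun_prop

lemma normSq_pos {z : Fin (N + 1) → ℝ} (hz : 0 < z 0) : 0 < normSq z :=
  normSq_pos_of_coord hz.ne'

lemma goodKer_kerField (hN : 1 ≤ N) (i : Fin (N + 1)) : GoodKer (kerField i) where
  cont z hz := continuousAt_kerField (normSq_pos hz) i
  bound := by
    have : (1 : ℝ) ≤ N := by exact_mod_cast hN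
    exact bound_of_rpow (a := (((N + 1 : ℕ) : ℝ) - 1) / 2) zero_le_one (by push_cast; linarith)
      fun z hz => by simpa only [one_mul] using abs_kerField_le hz i

lemma goodKer_kerGrad (i j : Fin (N + 1)) : GoodKer (kerGrad i j) where
  cont z hz := continuousAt_kerGrad (normSq_pos hz) i j
  bound := bound_of_rpow (by positivity)
    (by push_cast; linarith [(Nat.cast_nonneg N : (0 : ℝ) ≤ N)])
    fun z hz => abs_kerGrad_le hz i j

lemma goodKer_kerHess (i j k : Fin (N + 1)) : GoodKer (kerHess i j k) where
  cont z hz := continuousAt_kerHess (normSq_pos hz) i j k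
  bound := bound_of_rpow (by positivity)
    (by push_cast; linarith [(Nat.cast_nonneg N : (0 : ℝ) ≤ N)])
    fun z hz => abs_kerHess_le hz i j k

lemma GoodKer.abs_le {κ : (Fin (N + 1) → ℝ) → ℝ} (h : GoodKer κ) {t : ℝ} (ht : 0 < t) :
    ∃ C ≥ 0, ∀ z, t ≤ z 0 → |κ z| ≤ C := by
  obtain ⟨C, hC, hb⟩ := h.bound t ht
  refine ⟨C / t, by positivity, fun z hz => ?_⟩
  rw [le_div_iff₀ ht]
  refine le_trans ?_ (hb z hz)
  gcongr
  exact hz.trans ((le_abs_self _).trans (norm_le_pi_norm z 0))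

/-! ### Convolution with kernels on the half-space -/

/-- Embedding of `ℝᴺ` at height `t`. -/
def lift (t : ℝ) (y : Fin N → ℝ) : Fin (N + 1) → ℝ := Fin.cons t y

@[simp] lemma lift_zero (t : ℝ) (y : Fin N → ℝ) : lift t y 0 = t := rfl
@[simp] lemma lift_succ (t : ℝ) (y : Fin N → ℝ) (j : Fin N) : lift t y j.succ = y j := rfl

lemma continuous_lift : Continuous fun p : ℝ × (Fin N → ℝ) => lift p.1 p.2 := by
  refine continuous_pi fun i => ?_
  refine Fin.cases ?_ (fun j => ?_) i
  · exact continuous_fst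
  · exact (continuous_apply j).comp continuous_snd

lemma continuous_lift_right (t : ℝ) : Continuous (lift t : (Fin N → ℝ) → _) :=
  continuous_lift.comp (Continuous.prodMk_right t)

@[fun_prop] lemma _root_.Continuous.hs_lift {X : Type*} [TopologicalSpace X] {a : X → ℝ}
    {b : X → Fin N → ℝ}
    (ha : Continuous a) (hb : Continuous b) : Continuous fun x => lift (a x) (b x) :=
  continuous_lift.comp (ha.prodMk hb)

lemma sub_lift_zero (z : Fin (N + 1) → ℝ) (y : Fin N → ℝ) : (z - lift 0 y) 0 = z 0 := by simp

lemma lift_sub_lift (s t : ℝ) (x y : Fin N → ℝ) : lift s x - lift t y = lift (s - t) (x - y) := by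
  ext i; refine Fin.cases ?_ (fun j => ?_) i <;> simp

lemma eq_lift (z : Fin (N + 1) → ℝ) : z = lift (z 0) (fun j => z j.succ) := by
  ext i; refine Fin.cases ?_ (fun j => ?_) i <;> simp

lemma normSq_lift (t : ℝ) (y : Fin N → ℝ) : normSq (lift t y) = t ^ 2 + normSq y := by
  simp [normSq, Fin.sum_univ_succ]

/-- Convolution over the boundary hyperplane. -/
def conv (κ : (Fin (N + 1) → ℝ) → ℝ) (g : (Fin N → ℝ) → ℝ) (z : Fin (N + 1) → ℝ) : ℝ :=
  ∫ y, κ (z - lift 0 y) * g y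

variable {κ κ' : (Fin (N + 1) → ℝ) → ℝ} {g : (Fin N → ℝ) → ℝ}

lemma GoodKer.continuous_slice (h : GoodKer κ) {z : Fin (N + 1) → ℝ} (hz : 0 < z 0) :
    Continuous fun y => κ (z - lift 0 y) :=
  continuous_iff_continuousAt.2 fun y => by
    have := h.cont (z - lift 0 y) (by simpa using hz)
    exact this.comp (f := fun y => z - lift 0 y) (by fun_prop)

lemma GoodKer.integrable (h : GoodKer κ) (hg : Integrable g) {z : Fin (N + 1) → ℝ}
    (hz : 0 < z 0) : Integrable fun y => κ (z - lift 0 y) * g y := by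
  obtain ⟨C, -, hC⟩ := h.abs_le hz
  exact hg.bdd_mul (h.continuous_slice hz).aestronglyMeasurable
    (Eventually.of_forall fun y => hC _ (by simp))

lemma GoodKer.continuousAt_conv (h : GoodKer κ) (hg : Integrable g) {z : Fin (N + 1) → ℝ}
    (hz : 0 < z 0) : ContinuousAt (conv κ g) z := by
  obtain ⟨C, -, hC⟩ := h.abs_le (half_pos hz)
  have hn : ∀ᶠ w : Fin (N + 1) → ℝ in 𝓝 z, z 0 / 2 < w 0 :=
    (continuous_apply 0).continuousAt.eventually (lt_mem_nhds (half_lt_self hz))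
  refine continuousAt_of_dominated (bound := fun y => C * |g y|) ?_ ?_ (hg.abs.const_mul C) ?_
  · filter_upwards [hn] with w hw
    exact (h.integrable hg (by linarith)).aestronglyMeasurable
  · filter_upwards [hn] with w hw
    refine Eventually.of_forall fun y => ?_
    rw [norm_mul]
    exact mul_le_mul_of_nonneg_right (hC _ (by rw [sub_lift_zero]; exact hw.le)) (norm_nonneg _)
  · refine Eventually.of_forall fun y => ?_
    refine ContinuousAt.mul ?_ continuousAt_const
    exact (h.cont (z - lift 0 y) (by simpa using hz)).comp (f := fun z => z - lift 0 y)
      (by fun_prop)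

lemma GoodKer.hasLineDerivAt_conv (h : GoodKer κ) (h' : GoodKer κ') (k : Fin (N + 1))
    (hd : ∀ z, 0 < z 0 → HasLineDerivAt ℝ κ (κ' z) z (basisVec k)) (hg : Integrable g)
    {z : Fin (N + 1) → ℝ} (hz : 0 < z 0) :
    HasLineDerivAt ℝ (conv κ g) (conv κ' g z) z (basisVec k) := by
  obtain ⟨C, -, hC⟩ := h'.abs_le (half_pos hz)
  have hpos : ∀ s ∈ Metric.ball (0 : ℝ) (z 0 / 2), z 0 / 2 ≤ (z + s • basisVec k) 0 := by
    intro s hs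
    rw [coord_line]
    rw [Metric.mem_ball, dist_zero_right, Real.norm_eq_abs] at hs
    have h1 : |s * delta 0 k| ≤ |s| := by
      rw [abs_mul]; exact mul_le_of_le_one_right (abs_nonneg _) (abs_delta_le _ _)
    linarith [neg_abs_le (s * delta 0 k)]
  have key := hasDerivAt_integral_of_dominated_loc_of_deriv_le (μ := volume)
    (F := fun s y => κ (z + s • basisVec k - lift 0 y) * g y)
    (F' := fun s y => κ' (z + s • basisVec k - lift 0 y) * g y) (x₀ := (0 : ℝ))
    (bound := fun y => C * |g y|)
    (Metric.ball_mem_nhds 0 (half_pos hz)) ?_ ?_ ?_ ?_ (hg.abs.const_mul C) ?_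
  · have := key.2
    simp only [zero_smul, add_zero] at this
    exact this
  · filter_upwards [Metric.ball_mem_nhds (0 : ℝ) (half_pos hz)] with s hs
    exact (h.integrable hg (by linarith [hpos s hs])).aestronglyMeasurable
  · simpa using h.integrable hg hz
  · simpa using (h'.integrable hg hz).aestronglyMeasurable
  · refine Eventually.of_forall fun y s hs => ?_
    rw [norm_mul]
    exact mul_le_mul_of_nonneg_right (hC _ (by rw [sub_lift_zero]; exact hpos s hs)) (norm_nonneg _)
  · refine Eventually.of_forall fun y s hs => ?_
    have h1 := hd (z + s • basisVec k - lift 0 y) (by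
      rw [sub_lift_zero]; linarith [hpos s hs])
    have h2 : HasDerivAt (fun r : ℝ => r - s) 1 s := (hasDerivAt_id s).sub_const s
    have h3 := HasDerivAt.comp_of_eq s (h₂ := fun t => κ (z + s • basisVec k - lift 0 y + t • basisVec k))
      h1 h2 (by simp)
    have h4 := h3.mul_const (g y)
    rw [mul_one] at h4
    refine h4.congr_of_eventuallyEq (Eventually.of_forall fun r => ?_)
    simp only [Function.comp]
    congr 2
    module

lemma GoodKer.conv_decay (h : GoodKer κ) (hg : Integrable g) {t δ : ℝ} (ht : 0 < t)
    (hδ : 0 < δ) : ∃ R, ∀ z, t ≤ z 0 → R ≤ ‖z‖ → |conv κ g z| ≤ δ := by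
  obtain ⟨C, hC0, hC⟩ := h.abs_le ht
  obtain ⟨B, hB0, hB⟩ := h.bound t ht
  set l : Filter (Fin (N + 1) → ℝ) := comap norm atTop ⊓ 𝓟 {z | t ≤ z 0}
  have hl : ∀ᶠ z in l, t ≤ z 0 := mem_inf_of_right (mem_principal_self _)
  have key : Tendsto (conv κ g) l (𝓝 (∫ _ : Fin N → ℝ, (0 : ℝ))) := by
    refine tendsto_integral_filter_of_dominated_convergence (fun y => C * |g y|) ?_ ?_
      (hg.abs.const_mul C) ?_
    · filter_upwards [hl] with w hw
      exact (h.integrable hg (by linarith)).aestronglyMeasurable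
    · filter_upwards [hl] with w hw
      refine Eventually.of_forall fun y => ?_
      rw [norm_mul]
      exact mul_le_mul_of_nonneg_right (hC _ (by rw [sub_lift_zero]; exact hw)) (norm_nonneg _)
    · refine Eventually.of_forall fun y => ?_
      suffices Tendsto (fun z => κ (z - lift 0 y)) l (𝓝 0) by
        simpa using this.mul_const (g y)
      have h1 : Tendsto (fun z : Fin (N + 1) → ℝ => ‖z‖ - ‖lift 0 y‖) l atTop :=
        tendsto_atTop_add_const_right _ _ (tendsto_comap.mono_left inf_le_left)
      have h2 : Tendsto (fun z : Fin (N + 1) → ℝ => B / (‖z‖ - ‖lift 0 y‖)) l (𝓝 0) :=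
        h1.const_div_atTop B
      refine squeeze_zero_norm' ?_ h2
      filter_upwards [hl, h1.eventually (eventually_gt_atTop 0)] with w hw hw'
      rw [le_div_iff₀ hw']
      refine le_trans ?_ (hB (w - lift 0 y) (by simpa using hw))
      rw [Real.norm_eq_abs]
      exact mul_le_mul_of_nonneg_left (norm_sub_norm_le w (lift 0 y)) (abs_nonneg _)
  rw [integral_zero] at key
  have h5 := key.eventually (Metric.ball_mem_nhds 0 hδ)
  rw [eventually_inf_principal, eventually_comap] at h5
  obtain ⟨R, hR⟩ := eventually_atTop.1 h5
  refine ⟨R, fun z hz hz' => ?_⟩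
  have := hR _ hz' z rfl hz
  rw [dist_zero_right] at this
  exact this.le

end KernelBounds

/-! ### Approximate identities -/

section ApproxIdentity

variable {N : ℕ}

lemma continuous_lintegral_translate {g : (Fin N → ℝ) → ℝ} (hg : Integrable g) :
    Continuous fun v : Fin N → ℝ => ∫⁻ x, ‖g (x - v) - g x‖ₑ := by
  have : Fact ((1 : ℝ≥0∞) ≠ ∞) := ⟨by simp⟩
  have hm : MemLp g 1 volume := memLp_one_iff_integrable.2 hg
  have h1 : Continuous fun v : Fin N → ℝ => DomAddAct.mk (-v) +ᵥ hm.toLp g :=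
    (DomAddAct.continuous_mk.comp continuous_neg).vadd continuous_const
  refine (h1.edist (continuous_const (y := hm.toLp g))).congr fun v => ?_
  have h3 := DomAddAct.mk_vadd_toLp (μ := (volume : Measure (Fin N → ℝ))) (-v) hm
  rw [h3, Lp.edist_toLp_toLp, eLpNorm_one_eq_lintegral_enorm]
  refine lintegral_congr fun x => ?_
  simp [sub_eq_neg_add]

lemma tendsto_lintegral_translate {g : (Fin N → ℝ) → ℝ} (hg : Integrable g) :
    Tendsto (fun v : Fin N → ℝ => ∫⁻ x, ‖g (x - v) - g x‖ₑ) (𝓝 0) (𝓝 0) := by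
  simpa using (continuous_lintegral_translate hg).tendsto 0

variable {ψ g : (Fin N → ℝ) → ℝ}

lemma aestronglyMeasurable_dilate (hψ : Integrable ψ) (hg : Integrable g) (ε : ℝ) :
    AEStronglyMeasurable (fun x => ∫ y, ψ y * g (x - ε • y)) volume := by
  rcases eq_or_ne ε 0 with rfl | hε
  · simp only [zero_smul, sub_zero, integral_mul_const]
    exact hg.aestronglyMeasurable.const_mul _
  obtain ⟨g', hg', hgg'⟩ := hg.aestronglyMeasurable
  have : (fun x => ∫ y, ψ y * g (x - ε • y)) = fun x => ∫ y, ψ y * g' (x - ε • y) := by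
    ext x
    refine integral_congr_ae ?_
    have hq : Measure.QuasiMeasurePreserving (fun y : Fin N → ℝ => x - ε • y) volume volume := by
      refine (Measure.measurePreserving_sub_left volume x).quasiMeasurePreserving.comp ?_
      refine ⟨by fun_prop, ?_⟩
      rw [Measure.map_addHaar_smul _ hε]
      exact Measure.smul_absolutelyContinuous
    filter_upwards [hq.ae_eq_comp hgg'] with y hy
    simp only [Function.comp] at hy
    rw [hy]
  rw [this]
  refine AEStronglyMeasurable.integral_prod_right'
    (f := fun p : (Fin N → ℝ) × (Fin N → ℝ) => ψ p.2 * g' (p.1 - ε • p.2)) ?_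
  refine hψ.aestronglyMeasurable.comp_snd.mul ?_
  exact (hg'.comp_measurable (by fun_prop)).aestronglyMeasurable

lemma lintegral_dilate_sub_le (hψ : Integrable ψ) (hg : Integrable g) (ε : ℝ) (hε : ε ≠ 0) :
    ∫⁻ x, ‖(∫ y, ψ y * g (x - ε • y)) - (∫ y, ψ y) * g x‖ₑ ≤
      ∫⁻ y, ‖ψ y‖ₑ * ∫⁻ x, ‖g (x - ε • y) - g x‖ₑ := by
  obtain ⟨g', hg', hgg'⟩ := hg.aestronglyMeasurable
  have hq : ∀ x, Measure.QuasiMeasurePreserving (fun y : Fin N → ℝ => x - ε • y) volume volume := by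
    intro x
    refine (Measure.measurePreserving_sub_left volume x).quasiMeasurePreserving.comp ?_
    refine ⟨by fun_prop, ?_⟩
    rw [Measure.map_addHaar_smul _ hε]
    exact Measure.smul_absolutelyContinuous
  have hg'i : Integrable g' := hg.congr hgg'
  have e1 : ∀ x, ∫ y, ψ y * g (x - ε • y) = ∫ y, ψ y * g' (x - ε • y) := fun x =>
    integral_congr_ae (by
      filter_upwards [(hq x).ae_eq_comp hgg'] with y hy
      simp only [Function.comp] at hy
      rw [hy])
  have e2 : ∀ y, ∫⁻ x, ‖g (x - ε • y) - g x‖ₑ = ∫⁻ x, ‖g' (x - ε • y) - g' x‖ₑ := fun y =>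
    lintegral_congr_ae (by
      filter_upwards [(measurePreserving_sub_right volume (ε • y)).quasiMeasurePreserving.ae_eq_comp
        hgg', hgg'] with x hx hx'
      simp only [Function.comp] at hx
      rw [hx, hx'])
  have hgm : StronglyMeasurable fun p : (Fin N → ℝ) × (Fin N → ℝ) => g' (p.1 - ε • p.2) :=
    hg'.comp_measurable (by fun_prop)
  have hgm2 : StronglyMeasurable fun p : (Fin N → ℝ) × (Fin N → ℝ) => g' p.1 :=
    hg'.comp_measurable (by fun_prop)
  have hintegrable : Integrable (fun p : (Fin N → ℝ) × (Fin N → ℝ) => ψ p.2 * g' (p.1 - ε • p.2))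
      (volume.prod volume) := by
    have hmeas : AEStronglyMeasurable (fun p : (Fin N → ℝ) × (Fin N → ℝ) =>
        ψ p.2 * g' (p.1 - ε • p.2)) (volume.prod volume) :=
      hψ.aestronglyMeasurable.comp_snd.mul hgm.aestronglyMeasurable
    rw [integrable_prod_iff' hmeas]
    constructor
    · exact Eventually.of_forall fun y => (hg'i.comp_sub_right (ε • y)).const_mul (ψ y)
    · simp only [norm_mul, integral_const_mul]
      have : ∀ y, ∫ x, ‖g' (x - ε • y)‖ = ∫ x, ‖g' x‖ := fun y =>
        integral_sub_right_eq_self (fun x => ‖g' x‖) (ε • y)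
      simp only [this]
      exact hψ.norm.mul_const _
  calc ∫⁻ x, ‖(∫ y, ψ y * g (x - ε • y)) - (∫ y, ψ y) * g x‖ₑ
      = ∫⁻ x, ‖∫ y, ψ y * (g' (x - ε • y) - g' x)‖ₑ := by
        refine lintegral_congr_ae ?_
        filter_upwards [hintegrable.prod_right_ae, hgg'] with x hx hx'
        simp only [e1, mul_sub]
        rw [integral_sub hx (hψ.mul_const _), integral_mul_const, hx']
    _ ≤ ∫⁻ x, ∫⁻ y, ‖ψ y * (g' (x - ε • y) - g' x)‖ₑ :=
        lintegral_mono fun x => enorm_integral_le_lintegral_enorm _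
    _ = ∫⁻ y, ∫⁻ x, ‖ψ y * (g' (x - ε • y) - g' x)‖ₑ := by
        refine lintegral_lintegral_swap ?_
        exact (hψ.aestronglyMeasurable.comp_snd.mul
          (hgm.sub hgm2).aestronglyMeasurable).enorm
    _ = _ := by
        refine lintegral_congr fun y => ?_
        simp only [enorm_mul]
        rw [lintegral_const_mul' _ _ enorm_ne_top, e2]

lemma tendsto_dilate (hψ : Integrable ψ) (hg : Integrable g) :
    Tendsto (fun ε : ℝ => ∫⁻ x, ‖(∫ y, ψ y * g (x - ε • y)) - (∫ y, ψ y) * g x‖ₑ)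
      (𝓝[>] 0) (𝓝 0) := by
  have h1 : Tendsto (fun ε : ℝ => ∫⁻ y, ‖ψ y‖ₑ * ∫⁻ x, ‖g (x - ε • y) - g x‖ₑ) (𝓝[>] 0)
      (𝓝 (∫⁻ _ : Fin N → ℝ, 0)) := by
    have hω : ∀ v : Fin N → ℝ, ∫⁻ x, ‖g (x - v) - g x‖ₑ ≤ 2 * ∫⁻ x, ‖g x‖ₑ := by
      intro v
      calc ∫⁻ x, ‖g (x - v) - g x‖ₑ ≤ ∫⁻ x, (‖g (x - v)‖ₑ + ‖g x‖ₑ) :=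
            lintegral_mono fun x => enorm_sub_le
        _ = _ := by
            rw [lintegral_add_right' _ hg.aestronglyMeasurable.enorm,
              lintegral_sub_right_eq_self (fun x => ‖g x‖ₑ) v, two_mul]
    have hcont := continuous_lintegral_translate hg
    refine tendsto_lintegral_filter_of_dominated_convergence'
      (fun y => ‖ψ y‖ₑ * (2 * ∫⁻ x, ‖g x‖ₑ)) ?_ ?_ ?_ ?_
    · refine Eventually.of_forall fun ε => ?_
      exact hψ.aestronglyMeasurable.enorm.mul
        (hcont.comp (continuous_const_smul ε)).measurable.aemeasurable
    · refine Eventually.of_forall fun ε => Eventually.of_forall fun y => ?_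
      gcongr
      exact hω _
    · rw [lintegral_mul_const'' _ hψ.aestronglyMeasurable.enorm]
      exact (ENNReal.mul_lt_top hψ.2 (ENNReal.mul_lt_top (by simp) hg.2)).ne
    · refine Eventually.of_forall fun y => ?_
      have h0 : Tendsto (fun ε : ℝ => ε • y) (𝓝[>] 0) (𝓝 0) := by
        have : Tendsto (fun ε : ℝ => ε • y) (𝓝 0) (𝓝 ((0 : ℝ) • y)) :=
          (continuous_id.smul continuous_const).tendsto 0
        rw [zero_smul] at this
        exact this.mono_left nhdsWithin_le_nhds
      have := ENNReal.Tendsto.const_mul (a := ‖ψ y‖ₑ) ((tendsto_lintegral_translate hg).comp h0)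
        (Or.inr enorm_ne_top)
      simpa using this
  rw [lintegral_zero] at h1
  refine tendsto_of_tendsto_of_tendsto_of_le_of_le' tendsto_const_nhds h1
    (Eventually.of_forall fun _ => zero_le) ?_
  filter_upwards [self_mem_nhdsWithin] with ε hε
  exact lintegral_dilate_sub_le hψ hg ε (ne_of_gt hε)

/-- Along a common sequence of scales, finitely many approximate identities converge almost
everywhere. -/
lemma exists_seq_tendsto_dilate {ι : Type*} [Fintype ι] {ψ g : ι → (Fin N → ℝ) → ℝ}
    (hψ : ∀ i, Integrable (ψ i)) (hg : ∀ i, Integrable (g i)) :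
    ∃ ε : ℕ → ℝ, (∀ k, 0 < ε k) ∧ Tendsto ε atTop (𝓝 0) ∧ ∀ᵐ x : Fin N → ℝ, ∀ i,
      Tendsto (fun k => ∫ y, ψ i y * g i (x - ε k • y)) atTop (𝓝 ((∫ y, ψ i y) * g i x)) := by
  set E : ι → ℝ → (Fin N → ℝ) → ℝ :=
    fun i ε x => (∫ y, ψ i y * g i (x - ε • y)) - (∫ y, ψ i y) * g i x with hE
  have hEm : ∀ i ε, AEStronglyMeasurable (E i ε) volume := fun i ε =>
    (aestronglyMeasurable_dilate (hψ i) (hg i) ε).sub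
      ((hg i).aestronglyMeasurable.const_mul _)
  set G : ℝ → (Fin N → ℝ) → ℝ := fun ε x => ∑ i, ‖E i ε x‖ with hG
  have hGm : ∀ ε, AEStronglyMeasurable (G ε) volume := fun ε =>
    Finset.aestronglyMeasurable_fun_sum _ fun i _ => (hEm i ε).norm
  have hlim : Tendsto (fun ε => eLpNorm (G ε - 0) 1 volume) (𝓝[>] 0) (𝓝 0) := by
    have h1 : Tendsto (fun ε : ℝ => ∑ i, ∫⁻ x, ‖E i ε x‖ₑ) (𝓝[>] 0) (𝓝 (∑ _i : ι, 0)) :=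
      tendsto_finsetSum _ fun i _ => tendsto_dilate (hψ i) (hg i)
    rw [Finset.sum_const_zero] at h1
    refine tendsto_of_tendsto_of_tendsto_of_le_of_le tendsto_const_nhds h1
      (fun _ => zero_le) fun ε => ?_
    simp only [sub_zero, eLpNorm_one_eq_lintegral_enorm]
    rw [← lintegral_finsetSum' _ fun i _ => (hEm i ε).enorm]
    refine lintegral_mono fun x => ?_
    refine (enorm_sum_le _ _).trans (Finset.sum_le_sum fun i _ => ?_)
    simp
  obtain ⟨ns, hns, hae⟩ := (tendstoInMeasure_of_tendsto_eLpNorm one_ne_zero hGm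
    aestronglyMeasurable_zero hlim).exists_seq_tendsto_ae'
  have hpos : ∀ᶠ k in atTop, 0 < ns k := hns.eventually self_mem_nhdsWithin
  obtain ⟨k0, hk0⟩ := eventually_atTop.1 hpos
  refine ⟨fun k => ns (k + k0), fun k => hk0 _ (by omega),
    (hns.mono_right nhdsWithin_le_nhds).comp (tendsto_add_atTop_nat k0), ?_⟩
  filter_upwards [hae] with x hx i
  have h2 : Tendsto (fun k => E i (ns k) x) atTop (𝓝 0) := by
    refine squeeze_zero_norm (fun k => ?_) hx
    exact Finset.single_le_sum (f := fun i => ‖E i (ns k) x‖) (fun _ _ => norm_nonneg _)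
      (Finset.mem_univ i)
  have h3 := (h2.comp (tendsto_add_atTop_nat k0)).add_const ((∫ y, ψ i y) * g i x)
  simpa [hE, Function.comp_def] using h3

end ApproxIdentity

section Poisson

variable {N : ℕ}

/-! ### The Poisson kernel -/

lemma integrable_normSq_rpow {t : ℝ} (ht : 0 < t) :
    Integrable fun y : Fin N → ℝ => normSq (lift t y) ^ (-(((N + 1 : ℕ) : ℝ) / 2)) := by
  have h1 : Integrable (fun y : Fin N → ℝ => (1 + ‖y‖ ^ 2) ^ (-((N + 1 : ℕ) : ℝ) / 2)) :=
    integrable_rpow_neg_one_add_norm_sq (by simp)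
  set b := min 1 (t ^ 2) with hb
  have hb0 : 0 < b := lt_min one_pos (by positivity)
  have hpos : ∀ y : Fin N → ℝ, 0 < normSq (lift t y) := fun y => normSq_pos (by simpa using ht)
  refine (h1.const_mul (b ^ (-(((N + 1 : ℕ) : ℝ) / 2)))).mono' ?_ (Eventually.of_forall fun y => ?_)
  · refine Continuous.aestronglyMeasurable ?_
    exact (continuous_normSq.comp (continuous_lift_right t)).rpow_const
      fun y => Or.inl (hpos y).ne'
  · rw [Real.norm_of_nonneg (Real.rpow_nonneg (hpos y).le _), neg_div,
      ← Real.mul_rpow hb0.le (by positivity)]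
    refine Real.rpow_le_rpow_of_nonpos (by positivity) ?_ (by
      rw [Left.neg_nonpos_iff]; positivity)
    rw [normSq_lift, mul_add, mul_one]
    refine add_le_add (min_le_right _ _) ?_
    exact (mul_le_of_le_one_left (by positivity) (min_le_left _ _)).trans (norm_sq_le_normSq y)

lemma kerField_zero_lift (t : ℝ) (y : Fin N → ℝ) :
    kerField 0 (lift t y) = t * normSq (lift t y) ^ (-(((N + 1 : ℕ) : ℝ) / 2)) := rfl

lemma kerField_zero_nonneg {z : Fin (N + 1) → ℝ} (hz : 0 ≤ z 0) : 0 ≤ kerField 0 z :=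
  mul_nonneg hz (Real.rpow_nonneg (normSq_nonneg z) _)

lemma kerField_zero_pos {z : Fin (N + 1) → ℝ} (hz : 0 < z 0) : 0 < kerField 0 z :=
  mul_pos hz (Real.rpow_pos_of_pos (normSq_pos hz) _)

lemma continuous_kerField_lift (i : Fin (N + 1)) {t : ℝ} (ht : 0 < t) :
    Continuous fun y : Fin N → ℝ => kerField i (lift t y) :=
  continuous_iff_continuousAt.2 fun y =>
    (continuousAt_kerField (normSq_pos (by simpa using ht)) i).comp (f := fun y => lift t y)
      (continuous_lift_right t).continuousAt

lemma integrable_kerField_zero {t : ℝ} (ht : 0 < t) :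
    Integrable fun y : Fin N → ℝ => kerField 0 (lift t y) := by
  simp only [kerField_zero_lift]; exact (integrable_normSq_rpow ht).const_mul t

lemma abs_kerGrad_lift_le (i j : Fin (N + 1)) {t : ℝ} (ht : 0 < t) (y : Fin N → ℝ) :
    |kerGrad i j (lift t y)| ≤ (1 + (N + 1 : ℕ)) / t * kerField 0 (lift t y) := by
  refine (abs_kerGrad_le (normSq_pos (by simpa using ht)) i j).trans_eq ?_
  rw [kerField_zero_lift]; field_simp

lemma continuous_kerGrad_lift (i j : Fin (N + 1)) {t : ℝ} (ht : 0 < t) :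
    Continuous fun y : Fin N → ℝ => kerGrad i j (lift t y) :=
  continuous_iff_continuousAt.2 fun y =>
    (continuousAt_kerGrad (normSq_pos (by simpa using ht)) i j).comp (f := fun y => lift t y)
      (continuous_lift_right t).continuousAt

lemma integrable_kerGrad (i j : Fin (N + 1)) {t : ℝ} (ht : 0 < t) :
    Integrable fun y : Fin N → ℝ => kerGrad i j (lift t y) :=
  ((integrable_kerField_zero ht).const_mul _).mono'
    (continuous_kerGrad_lift i j ht).aestronglyMeasurable
    (Eventually.of_forall fun y => abs_kerGrad_lift_le i j ht y)

lemma conv_lift (κ : (Fin (N + 1) → ℝ) → ℝ) (g : (Fin N → ℝ) → ℝ) (t : ℝ) (x : Fin N → ℝ) :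
    conv κ g (lift t x) = ∫ y, κ (lift t (x - y)) * g y := by
  simp [conv, lift_sub_lift]

lemma integrable_conv {κ : (Fin (N + 1) → ℝ) → ℝ} {g : (Fin N → ℝ) → ℝ} {t : ℝ}
    (hκ : Integrable fun y : Fin N → ℝ => κ (lift t y)) (hg : Integrable g) :
    Integrable fun x => conv κ g (lift t x) := by
  have := hg.integrable_convolution (ContinuousLinearMap.mul ℝ ℝ) hκ
  refine this.congr (Eventually.of_forall fun x => ?_)
  simp only [convolution, ContinuousLinearMap.mul_apply', conv_lift, mul_comm]

lemma normSq_smul {m : ℕ} (s : ℝ) (z : Fin m → ℝ) : normSq (s • z) = s ^ 2 * normSq z := by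
  simp [normSq, Finset.mul_sum, mul_pow]

lemma kerField_smul {s : ℝ} (hs : 0 < s) (i : Fin (N + 1)) (z : Fin (N + 1) → ℝ) :
    kerField i (s • z) = (s ^ N)⁻¹ * kerField i z := by
  have h1 : (s ^ 2) ^ (-(((N + 1 : ℕ) : ℝ) / 2)) = (s ^ (N + 1))⁻¹ := by
    rw [← Real.rpow_natCast s 2, ← Real.rpow_mul hs.le, ← Real.rpow_natCast s (N + 1),
      ← Real.rpow_neg hs.le]
    congr 1; push_cast; ring
  rw [kerField, kerField, normSq_smul, Real.mul_rpow (by positivity) (normSq_nonneg z), h1]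
  simp only [Pi.smul_apply, smul_eq_mul]
  field_simp
  ring

lemma smul_lift (s t : ℝ) (y : Fin N → ℝ) : s • lift t y = lift (s * t) (s • y) := by
  ext i; refine Fin.cases ?_ (fun j => ?_) i <;> simp

lemma integral_kerField_scale (i : Fin (N + 1)) {t : ℝ} (ht : 0 < t) (φ : (Fin N → ℝ) → ℝ)
    (x : Fin N → ℝ) :
    conv (kerField i) φ (lift t x) = ∫ y, kerField i (lift 1 y) * φ (x - t • y) := by
  rw [conv_lift, ← integral_sub_left_eq_self _ volume x]
  have h := Measure.integral_comp_smul (volume : Measure (Fin N → ℝ))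
    (fun y => kerField i (lift t y) * φ (x - y)) t
  simp only [Module.finrank_fintype_fun_eq_card, Fintype.card_fin] at h
  have h2 : ∀ y : Fin N → ℝ, kerField i (lift t (t • y)) = (t ^ N)⁻¹ * kerField i (lift 1 y) :=
    fun y => by rw [← kerField_smul ht, smul_lift, mul_one]
  simp only [h2, mul_assoc, integral_const_mul, abs_of_pos (inv_pos.2 (pow_pos ht N)),
    smul_eq_mul] at h
  have h3 := mul_left_cancel₀ (inv_pos.2 (pow_pos ht N)).ne' h
  rw [h3]
  simp

/-- The total mass of the unnormalised Poisson kernel. -/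
def poisA (N : ℕ) : ℝ := ∫ y : Fin N → ℝ, kerField 0 (lift 1 y)

lemma poisA_pos : 0 < poisA N := by
  refine (integral_pos_iff_support_of_nonneg (fun y => kerField_zero_nonneg (by simp))
    (integrable_kerField_zero one_pos)).2 ?_
  have : (Function.support fun y : Fin N → ℝ => kerField 0 (lift 1 y)) = univ := by
    ext y; simpa using (kerField_zero_pos (z := lift 1 y) (by simp)).ne'
  rw [this]; simp [Measure.measure_univ_pos, NeZero.ne]

lemma integral_kerField_zero {z : Fin (N + 1) → ℝ} (hz : 0 < z 0) :
    ∫ y, kerField 0 (z - lift 0 y) = poisA N := by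
  have := integral_kerField_scale 0 hz (fun _ : Fin N → ℝ => 1) (fun j => z j.succ)
  rw [← eq_lift] at this
  simpa [conv, poisA] using this

lemma integrable_kerField_zero_sub {z : Fin (N + 1) → ℝ} (hz : 0 < z 0) :
    Integrable fun y => kerField 0 (z - lift 0 y) := by
  have := (integrable_kerField_zero (N := N) hz).comp_sub_left fun j => z j.succ
  refine this.congr (Eventually.of_forall fun y => ?_)
  simp only []
  conv_rhs => rw [eq_lift z, lift_sub_lift, sub_zero]

/-- The Poisson extension (up to the factor `poisA`), defined on the closed half-space. -/
def pext (φ : (Fin N → ℝ) → ℝ) (z : Fin (N + 1) → ℝ) : ℝ :=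
  ∫ y, kerField 0 (lift 1 y) * φ ((fun j => z j.succ) - z 0 • y)

lemma pext_eq_conv (φ : (Fin N → ℝ) → ℝ) {z : Fin (N + 1) → ℝ} (hz : 0 < z 0) :
    pext φ z = conv (kerField 0) φ z := by
  rw [pext, ← integral_kerField_scale 0 hz, ← eq_lift]

lemma pext_boundary (φ : (Fin N → ℝ) → ℝ) {z : Fin (N + 1) → ℝ} (hz : z 0 = 0) :
    pext φ z = poisA N * φ (fun j => z j.succ) := by
  simp [pext, hz, poisA, integral_mul_const]

lemma pext_nonneg {φ : (Fin N → ℝ) → ℝ} (hφ : ∀ y, 0 ≤ φ y) (z : Fin (N + 1) → ℝ) :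
    0 ≤ pext φ z :=
  integral_nonneg fun y => mul_nonneg (kerField_zero_nonneg (by simp)) (hφ _)

lemma continuous_pext {φ : (Fin N → ℝ) → ℝ} (hφ : Continuous φ) {C : ℝ} (hC : ∀ y, |φ y| ≤ C) :
    Continuous (pext φ) := by
  refine continuous_of_dominated (bound := fun y => kerField 0 (lift 1 y) * C) ?_ ?_
    ((integrable_kerField_zero one_pos).mul_const C) ?_
  · intro z
    exact ((continuous_kerField_lift 0 one_pos).mul (by fun_prop)).aestronglyMeasurable
  · refine fun z => Eventually.of_forall fun y => ?_
    have := kerField_zero_nonneg (z := lift 1 y) (by simp)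
    rw [norm_mul, Real.norm_of_nonneg this]
    exact mul_le_mul_of_nonneg_left (hC _) this
  · refine Eventually.of_forall fun y => ?_
    fun_prop

lemma pext_decay (hN : 1 ≤ N) {φ : (Fin N → ℝ) → ℝ} (hφ : Continuous φ)
    (hs : HasCompactSupport φ) {δ : ℝ} (hδ : 0 < δ) :
    ∃ R, ∀ z, 0 ≤ z 0 → R ≤ ‖z‖ → |pext φ z| ≤ δ := by
  obtain ⟨ρ, hρ⟩ := hs.isCompact.isBounded.subset_closedBall 0
  have hφi : Integrable φ := hφ.integrable_of_hasCompactSupport hs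
  have hφ0 : ∀ y, ρ < ‖y‖ → φ y = 0 := fun y hy => by
    by_contra h
    have := hρ (subset_tsupport _ h)
    rw [mem_closedBall_zero_iff] at this
    linarith
  set I := ∫ y, |φ y|
  have hI : 0 ≤ I := integral_nonneg fun _ => abs_nonneg _
  refine ⟨max ρ 0 + 1 + I / δ, fun z hz hR => ?_⟩
  have hId : 0 ≤ I / δ := by positivity
  have hρz : ρ < ‖z‖ := by linarith [le_max_left ρ 0]
  rcases hz.eq_or_lt with h0 | h0
  · have : φ (fun j => z j.succ) = 0 := by
      refine hφ0 _ (lt_of_lt_of_le hρz ?_)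
      refine (pi_norm_le_iff_of_nonneg (norm_nonneg _)).2 fun i => ?_
      refine Fin.cases ?_ (fun j => ?_) i
      · simp [← h0]
      · exact norm_le_pi_norm (fun j : Fin N => z j.succ) j
    rw [pext_boundary φ h0.symm, this]; simpa using hδ.le
  · rw [pext_eq_conv φ h0, conv]
    have hb : ∀ y, ‖kerField 0 (z - lift 0 y) * φ y‖ ≤ (1 + I / δ)⁻¹ * |φ y| := by
      intro y
      by_cases hy : ρ < ‖y‖
      · simp [hφ0 y hy]
      rw [norm_mul]
      refine mul_le_mul_of_nonneg_right ?_ (norm_nonneg _)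
      have hly : ‖lift 0 y‖ ≤ max ρ 0 := by
        refine (pi_norm_le_iff_of_nonneg (le_max_right _ _)).2 fun i => ?_
        refine Fin.cases ?_ (fun j => ?_) i
        · simp
        · exact (norm_le_pi_norm y j).trans ((not_lt.1 hy).trans (le_max_left _ _))
      have hw : 1 + I / δ ≤ ‖z - lift 0 y‖ := by
        have := norm_sub_norm_le z (lift 0 y)
        linarith
      have hw0 : (0 : ℝ) < 1 + I / δ := by positivity
      have hns : (1 + I / δ) ^ 2 ≤ normSq (z - lift 0 y) :=
        le_trans (by gcongr) (norm_sq_le_normSq _)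
      refine (abs_kerField_le (normSq_pos (by simpa using h0)) 0).trans ?_
      calc normSq (z - lift 0 y) ^ (-((((N + 1 : ℕ) : ℝ) - 1) / 2))
          ≤ ((1 + I / δ) ^ 2) ^ (-((((N + 1 : ℕ) : ℝ) - 1) / 2)) :=
            Real.rpow_le_rpow_of_nonpos (by positivity) hns (by
              rw [Left.neg_nonpos_iff]; push_cast; rw [add_sub_cancel_right]; positivity)
        _ = (1 + I / δ) ^ (-(N : ℝ)) := by
            rw [← Real.rpow_natCast, ← Real.rpow_mul hw0.le]
            congr 1; push_cast; ring
        _ ≤ (1 + I / δ) ^ (-1 : ℝ) := by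
            refine Real.rpow_le_rpow_of_exponent_le (by linarith) ?_
            have : (1 : ℝ) ≤ N := by exact_mod_cast hN
            linarith
        _ = _ := Real.rpow_neg_one _
    have h3 := norm_integral_le_of_norm_le (hφi.abs.const_mul _) (Eventually.of_forall hb)
    rw [integral_const_mul] at h3
    refine h3.trans ?_
    have : (0 : ℝ) < 1 + I / δ := by positivity
    rw [inv_mul_le_iff₀ this, add_mul, div_mul_cancel₀ _ hδ.ne']
    linarith

end Poisson

section Riesz

variable {N : ℕ}

/-! ### Riesz transforms and conjugate Poisson kernels -/

lemma eucNorm_eq (y : Fin N → ℝ) : eucNorm y = √(normSq y) := rfl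

/-- The Riesz kernel truncated to `1 ≤ |y|`. -/
def truncKer (j : Fin N) (y : Fin N → ℝ) : ℝ :=
  if 1 ≤ eucNorm y then y j / eucNorm y ^ (N + 1) else 0

lemma continuous_eucNorm : Continuous (eucNorm : (Fin N → ℝ) → ℝ) :=
  Real.continuous_sqrt.comp continuous_normSq

lemma measurable_truncKer (j : Fin N) : Measurable (truncKer j) := by
  have := (continuous_eucNorm (N := N)).measurable
  exact Measurable.ite (measurableSet_le measurable_const this)
    ((measurable_pi_apply j).div (this.pow_const _)) measurable_const

lemma abs_truncKer_le (j : Fin N) (y : Fin N → ℝ) : |truncKer j y| ≤ 1 := by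
  unfold truncKer
  split_ifs with h
  · rw [abs_div, abs_pow, abs_of_nonneg (zero_le_one.trans h), div_le_one (by positivity)]
    calc |y j| ≤ eucNorm y := abs_le_sqrt_normSq y j
      _ ≤ eucNorm y ^ (N + 1) := le_self_pow₀ h (by omega)
  · simp

lemma truncKer_neg (j : Fin N) (y : Fin N → ℝ) : truncKer j (-y) = -truncKer j y := by
  have : eucNorm (-y) = eucNorm y := by simp [eucNorm]
  simp only [truncKer, this]
  split_ifs <;> simp [neg_div]

/-- Difference between the conjugate Poisson kernel and the truncated Riesz kernel. -/
def diffKer (j : Fin N) (y : Fin N → ℝ) : ℝ := kerField j.succ (lift 1 y) - truncKer j y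

lemma rpow_neg_sub_le {u a : ℝ} (hu : 0 < u) (ha : 0 ≤ a) :
    u ^ (-a) - (1 + u) ^ (-a) ≤ a * u ^ (-a - 1) := by
  have h1 : (1 + u) ^ (-a) = u ^ (-a) * (1 + u⁻¹) ^ (-a) := by
    rw [← Real.mul_rpow hu.le (by positivity)]
    congr 1; field_simp; ring
  have h2 : 1 - a * u⁻¹ ≤ (1 + u⁻¹) ^ (-a) := by
    rw [Real.rpow_def_of_pos (by positivity)]
    have h3 := Real.log_le_sub_one_of_pos (show 0 < 1 + u⁻¹ by positivity)
    have h4 := Real.add_one_le_exp (Real.log (1 + u⁻¹) * -a)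
    nlinarith
  have h5 : u ^ (-a - 1) = u ^ (-a) * u⁻¹ := by rw [Real.rpow_sub_one hu.ne']; rfl
  have h6 := Real.rpow_nonneg hu.le (-a)
  rw [h1, h5]
  nlinarith [mul_le_mul_of_nonneg_left h2 h6]

lemma abs_diffKer_le (j : Fin N) (y : Fin N → ℝ) :
    |diffKer j y| ≤ (1 + ((N + 1 : ℕ) : ℝ) / 2 * 2 ^ (((N + 1 : ℕ) : ℝ) / 2)) *
      kerField 0 (lift 1 y) := by
  set a := ((N + 1 : ℕ) : ℝ) / 2 with ha
  have ha0 : 0 ≤ a := by positivity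
  set u := normSq y with hu
  have hu0 : 0 ≤ u := normSq_nonneg y
  have hl : normSq (lift 1 y) = 1 + u := by rw [normSq_lift, one_pow]
  have hk : kerField 0 (lift 1 y) = (1 + u) ^ (-a) := by
    rw [kerField_zero_lift, hl, one_mul]
  have hk' : kerField j.succ (lift 1 y) = y j * (1 + u) ^ (-a) := by
    rw [kerField, hl]; rfl
  have hpos : 0 ≤ (1 + u) ^ (-a) := by positivity
  rw [hk, diffKer, hk', truncKer]
  split_ifs with h
  · have hu1 : 1 ≤ u := by
      rw [eucNorm_eq, Real.one_le_sqrt] at h; exact h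
    have hup : 0 < u := by linarith
    have e1 : eucNorm y ^ (N + 1) = u ^ a := by
      rw [eucNorm_eq, Real.sqrt_eq_rpow, ← Real.rpow_natCast, ← Real.rpow_mul hu0, ha]
      congr 1; ring
    have e2 : y j * (1 + u) ^ (-a) - y j / eucNorm y ^ (N + 1)
        = -(y j * (u ^ (-a) - (1 + u) ^ (-a))) := by
      rw [e1, Real.rpow_neg hu0, div_eq_mul_inv]; ring
    have h1 : 0 ≤ u ^ (-a) - (1 + u) ^ (-a) := sub_nonneg.2
      (Real.rpow_le_rpow_of_nonpos hup (by linarith) (by linarith))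
    have h2 : |y j| ≤ u := by
      refine (abs_le_sqrt_normSq y j).trans ?_
      rw [Real.sqrt_le_left hu0]
      nlinarith
    rw [e2, abs_neg, abs_mul, abs_of_nonneg h1]
    calc |y j| * (u ^ (-a) - (1 + u) ^ (-a)) ≤ u * (a * u ^ (-a - 1)) :=
          mul_le_mul h2 (rpow_neg_sub_le hup ha0) h1 hu0
      _ = a * u ^ (-a) := by rw [Real.rpow_sub_one hup.ne']; field_simp
      _ ≤ a * ((1 + u) / 2) ^ (-a) := by
          gcongr a * ?_
          exact Real.rpow_le_rpow_of_nonpos (by linarith) (by linarith) (by linarith)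
      _ = a * 2 ^ a * (1 + u) ^ (-a) := by
          rw [Real.div_rpow (by linarith) (by norm_num), Real.rpow_neg (by norm_num : (0:ℝ) ≤ 2)]
          field_simp
      _ ≤ _ := by
          gcongr; linarith
  · have hu1 : u ≤ 1 := by
      rw [eucNorm_eq, Real.one_le_sqrt, not_le] at h; exact h.le
    have h2 : |y j| ≤ 1 := by
      refine (abs_le_sqrt_normSq y j).trans ?_
      exact Real.sqrt_le_one.2 hu1
    rw [sub_zero, abs_mul, abs_of_nonneg hpos]
    gcongr
    have : 0 ≤ a * 2 ^ a := by positivity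
    linarith

lemma integrable_diffKer (j : Fin N) : Integrable (diffKer j) :=
  ((integrable_kerField_zero one_pos).const_mul _).mono'
    ((continuous_kerField_lift j.succ one_pos).aestronglyMeasurable.sub
      (measurable_truncKer j).aestronglyMeasurable)
    (Eventually.of_forall (abs_diffKer_le j))

lemma diffKer_neg (j : Fin N) (y : Fin N → ℝ) : diffKer j (-y) = -diffKer j y := by
  have h : normSq (lift 1 (-y)) = normSq (lift 1 y) := by
    rw [normSq_lift, normSq_lift]; simp [normSq]
  simp only [diffKer, truncKer_neg, kerField, h, lift_succ, Pi.neg_apply]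
  ring

lemma integral_diffKer (j : Fin N) : ∫ y, diffKer j y = 0 := by
  have h := integral_neg_eq_self (diffKer j) volume
  simp only [diffKer_neg, integral_neg] at h
  linarith

lemma integral_truncKer_scale (j : Fin N) (g : (Fin N → ℝ) → ℝ) {ε : ℝ} (hε : 0 < ε) (c : ℝ)
    (x : Fin N → ℝ) :
    ∫ y in {y : Fin N → ℝ | ε ≤ eucNorm y}, c * y j / eucNorm y ^ (N + 1) * g (x - y)
      = c * ∫ y, truncKer j y * g (x - ε • y) := by
  have hm : MeasurableSet {y : Fin N → ℝ | ε ≤ eucNorm y} :=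
    measurableSet_le measurable_const continuous_eucNorm.measurable
  rw [← integral_indicator hm]
  set F := ({y : Fin N → ℝ | ε ≤ eucNorm y}).indicator
    fun y => c * y j / eucNorm y ^ (N + 1) * g (x - y) with hF
  have h := Measure.integral_comp_smul (volume : Measure (Fin N → ℝ)) F ε
  simp only [Module.finrank_fintype_fun_eq_card, Fintype.card_fin,
    abs_of_pos (inv_pos.2 (pow_pos hε N)), smul_eq_mul] at h
  have h2 : ∀ y, F (ε • y) = (ε ^ N)⁻¹ * (c * (truncKer j y * g (x - ε • y))) := by
    intro y
    have e1 : eucNorm (ε • y) = ε * eucNorm y := by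
      rw [eucNorm_eq, normSq_smul, Real.sqrt_mul (by positivity), Real.sqrt_sq hε.le]; rfl
    have e2 : ε • y ∈ {y : Fin N → ℝ | ε ≤ eucNorm y} ↔ 1 ≤ eucNorm y := by
      rw [mem_ofPred_eq, e1, le_mul_iff_one_le_right hε]
    by_cases hy : 1 ≤ eucNorm y
    · rw [hF, indicator_of_mem (e2.2 hy), e1, truncKer, if_pos hy]
      simp only [Pi.smul_apply, smul_eq_mul]
      have : eucNorm y ≠ 0 := by positivity
      rw [mul_pow]
      field_simp
      ring
    · rw [hF, indicator_of_notMem (fun h => hy (e2.1 h)), truncKer, if_neg hy]; simp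
  simp only [h2, integral_const_mul] at h
  exact (mul_left_cancel₀ (inv_pos.2 (pow_pos hε N)).ne' h).symm

lemma integral_diffKer_dilate (hN : 1 ≤ N) (j : Fin N) {g : (Fin N → ℝ) → ℝ} (hg : Integrable g)
    {ε : ℝ} (hε : 0 < ε) (x : Fin N → ℝ) :
    ∫ y, diffKer j y * g (x - ε • y) =
      conv (kerField j.succ) g (lift ε x) - ∫ y, truncKer j y * g (x - ε • y) := by
  have h1 : Integrable fun y => g (x - ε • y) :=
    (hg.comp_sub_left x).comp_smul hε.ne'
  obtain ⟨C, -, hC⟩ := (goodKer_kerField hN j.succ).abs_le one_pos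
  have h2 : Integrable fun y : Fin N → ℝ => kerField j.succ (lift 1 y) * g (x - ε • y) :=
    h1.bdd_mul (continuous_kerField_lift j.succ one_pos).aestronglyMeasurable
      (Eventually.of_forall fun y => hC _ (by simp))
  have h3 : Integrable fun y : Fin N → ℝ => truncKer j y * g (x - ε • y) :=
    h1.bdd_mul (measurable_truncKer j).aestronglyMeasurable
      (Eventually.of_forall fun y => abs_truncKer_le j y)
  rw [integral_kerField_scale j.succ hε, ← integral_sub h2 h3]
  simp only [diffKer, sub_mul]

/-- Normalising constant of the Riesz transforms. -/
def rieszC (N : ℕ) : ℝ := Real.Gamma (((N : ℝ) + 1) / 2) / Real.pi ^ (((N : ℝ) + 1) / 2)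

lemma rieszC_pos : 0 < rieszC N :=
  div_pos (Real.Gamma_pos_of_pos (by positivity)) (by positivity)

lemma tendsto_conv_of_riesz (hN : 1 ≤ N) (j : Fin N) {g r : (Fin N → ℝ) → ℝ} (hg : Integrable g)
    {ε : ℕ → ℝ} (hε : ∀ k, 0 < ε k) (hε0 : Tendsto ε atTop (𝓝 0)) {x : Fin N → ℝ}
    (hd : Tendsto (fun k => ∫ y, diffKer j y * g (x - ε k • y)) atTop
      (𝓝 ((∫ y, diffKer j y) * g x)))
    (hr : Tendsto (fun ε : ℝ => ∫ y in {y : Fin N → ℝ | ε ≤ eucNorm y},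
      (Real.Gamma (((N:ℝ)+1)/2) / Real.pi ^ (((N:ℝ)+1)/2)) *
        y j / eucNorm y ^ (N+1) * g (x - y)) (𝓝[>] 0) (𝓝 (r x))) :
    Tendsto (fun k => conv (kerField j.succ) g (lift (ε k) x)) atTop (𝓝 ((rieszC N)⁻¹ * r x)) := by
  have h1 : Tendsto ε atTop (𝓝[>] 0) :=
    tendsto_nhdsWithin_iff.2 ⟨hε0, Eventually.of_forall hε⟩
  have h2 := (hr.comp h1).const_mul (rieszC N)⁻¹
  have h3 := h2.add hd
  rw [integral_diffKer, zero_mul, add_zero] at h3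
  refine h3.congr fun k => ?_
  simp only [Function.comp]
  rw [integral_truncKer_scale j g (hε k), integral_diffKer_dilate hN j hg (hε k)]
  have := (rieszC_pos (N := N)).ne'
  change (rieszC N)⁻¹ * (rieszC N * _) + _ = _
  field_simp
  ring

/-! ### Weak derivatives tested against bounded functions -/

lemma isWeakDeriv_bounded {j : Fin N} {f g : (Fin N → ℝ) → ℝ} (hf : Integrable f)
    (hg : Integrable g) (hw : IsWeakDeriv j f g) {φ φ' : (Fin N → ℝ) → ℝ}
    (hφ : ContDiff ℝ (⊤ : ℕ∞) φ) (hφ' : ∀ x, HasLineDerivAt ℝ φ (φ' x) x (basisVec j))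
    (hφ'c : Continuous φ') {C : ℝ} (hC : ∀ x, |φ x| ≤ C) (hC' : ∀ x, |φ' x| ≤ C) :
    ∫ x, f x * φ' x = -∫ x, g x * φ x := by
  let b : ContDiffBump (0 : Fin N → ℝ) := ⟨1, 2, one_pos, one_lt_two⟩
  have hb : ContDiff ℝ (⊤ : ℕ∞) b := b.contDiff
  set b' : (Fin N → ℝ) → ℝ := fun x => fderiv ℝ b x (basisVec j) with hb'
  have hb'c : Continuous b' :=
    (hb.continuous_fderiv (by simp)).clm_apply continuous_const
  have hb'd : ∀ x, HasFDerivAt b (fderiv ℝ b x) x := fun x =>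
    ((hb.differentiable (by simp)) x).hasFDerivAt
  obtain ⟨B, hB⟩ : ∃ B, ∀ x, ‖b' x‖ ≤ B := by
    refine hb'c.bounded_above_of_compact_support ?_
    exact b.hasCompactSupport.fderiv_apply ℝ (basisVec j)
  have hB0 : 0 ≤ B := (norm_nonneg _).trans (hB 0)
  have hC0 : 0 ≤ C := (abs_nonneg _).trans (hC 0)
  have hφc : Continuous φ := hφ.continuous
  set r : ℕ → ℝ := fun k => ((k : ℝ) + 1)⁻¹ with hr
  have hr0 : ∀ k, 0 < r k := fun k => by positivity
  have hr1 : ∀ k, r k ≤ 1 := fun k => inv_le_one_of_one_le₀ (by simp)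
  have hrl : Tendsto r atTop (𝓝 0) := by
    simpa [hr] using tendsto_one_div_add_atTop_nhds_zero_nat (𝕜 := ℝ)
  have hbl : ∀ x, |b x| ≤ 1 := fun x => by
    rw [abs_of_nonneg b.nonneg]; exact b.le_one
  have hbr : ∀ x, Tendsto (fun k => b (r k • x)) atTop (𝓝 1) := by
    intro x
    have h0 : Tendsto (fun k => r k • x) atTop (𝓝 0) := by
      simpa using hrl.smul_const x
    have := hb.continuous.continuousAt.tendsto.comp h0
    rw [b.one_of_mem_closedBall (Metric.mem_closedBall_self b.rIn_pos.le)] at this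
    exact this
  have key : ∀ k, ∫ x, f x * (b (r k • x) * φ' x + r k * b' (r k • x) * φ x) =
      -∫ x, g x * (b (r k • x) * φ x) := by
    intro k
    have h1 := hw (fun x => b (r k • x) * φ x)
      ((hb.comp (contDiff_const_smul (r k))).mul hφ) ?_
    · rw [← h1]
      congr 1
      ext x
      congr 1
      symm
      refine HasDerivAt.deriv ?_
      have hu := hasDerivAt_update x j (x j)
      have d1 : HasDerivAt (fun s => b (r k • Function.update x j s)) (r k * b' (r k • x)) (x j) := by
        have := (hb'd (r k • Function.update x j (x j))).comp_hasDerivAt (x j) (hu.const_smul (r k))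
        rw [Function.update_eq_self, map_smul] at this
        exact this
      have d2 : HasDerivAt (fun s => φ (Function.update x j s)) (φ' x) (x j) := by
        have h2 : HasDerivAt (fun s : ℝ => s - x j) 1 (x j) := (hasDerivAt_id _).sub_const _
        have := HasDerivAt.comp_of_eq (x j) (h₂ := fun t => φ (x + t • basisVec j)) (hφ' x) h2
          (by simp)
        rw [mul_one] at this
        refine this.congr_of_eventuallyEq (Eventually.of_forall fun s => ?_)
        simp only [Function.comp]
        congr 1
        ext i
        by_cases h : i = j
        · subst h; simp [basisVec]
        · simp [basisVec, h]
      have d3 := d1.mul d2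
      simp only [Function.update_eq_self] at d3
      refine d3.congr_deriv ?_
      ring
    · exact HasCompactSupport.mul_right
        (b.hasCompactSupport.comp_homeomorph (Homeomorph.smulOfNeZero (r k) (hr0 k).ne'))
  have l1 : Tendsto (fun k => ∫ x, f x * (b (r k • x) * φ' x + r k * b' (r k • x) * φ x)) atTop
      (𝓝 (∫ x, f x * φ' x)) := by
    refine tendsto_integral_of_dominated_convergence (fun x => |f x| * (C + B * C)) ?_
      (hf.abs.mul_const _) ?_ ?_
    · intro k
      refine hf.aestronglyMeasurable.mul (Continuous.aestronglyMeasurable ?_)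
      have := hb.continuous
      fun_prop
    · refine fun k => Eventually.of_forall fun x => ?_
      rw [norm_mul, Real.norm_eq_abs, Real.norm_eq_abs]
      refine mul_le_mul_of_nonneg_left ?_ (abs_nonneg _)
      refine (abs_add_le _ _).trans (add_le_add ?_ ?_)
      · rw [abs_mul]
        calc _ ≤ 1 * C := mul_le_mul (hbl _) (hC' x) (abs_nonneg _) zero_le_one
          _ = C := one_mul C
      · rw [abs_mul, abs_mul, abs_of_pos (hr0 k)]
        refine mul_le_mul ?_ (hC x) (abs_nonneg _) hB0
        calc _ ≤ 1 * B := mul_le_mul (hr1 k) (hB _) (abs_nonneg _) zero_le_one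
          _ = B := one_mul B
    · refine Eventually.of_forall fun x => ?_
      have h0 : Tendsto (fun k => r k * b' (r k • x) * φ x) atTop (𝓝 0) := by
        have h1 : Tendsto (fun k => r k * (B * C)) atTop (𝓝 0) := by
          simpa using hrl.mul_const (B * C)
        refine squeeze_zero_norm (fun k => ?_) h1
        rw [norm_mul, norm_mul, Real.norm_of_nonneg (hr0 k).le, mul_assoc]
        have := hr0 k
        gcongr
        · exact hB _
        · exact hC x
      have := (((hbr x).mul_const (φ' x)).add h0).const_mul (f x)
      simpa using this
  have l2 : Tendsto (fun k => -∫ x, g x * (b (r k • x) * φ x)) atTop (𝓝 (-∫ x, g x * φ x)) := by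
    refine Tendsto.neg ?_
    refine tendsto_integral_of_dominated_convergence (fun x => |g x| * C) ?_
      (hg.abs.mul_const _) ?_ ?_
    · intro k
      refine hg.aestronglyMeasurable.mul (Continuous.aestronglyMeasurable ?_)
      have := hb.continuous
      fun_prop
    · refine fun k => Eventually.of_forall fun x => ?_
      rw [norm_mul, Real.norm_eq_abs, Real.norm_eq_abs]
      refine mul_le_mul_of_nonneg_left ?_ (abs_nonneg _)
      rw [abs_mul]
      calc _ ≤ 1 * C := mul_le_mul (hbl _) (hC x) (abs_nonneg _) zero_le_one
        _ = C := one_mul C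
    · refine Eventually.of_forall fun x => ?_
      simpa using (((hbr x).mul_const (φ x)).const_mul (g x))
  exact tendsto_nhds_unique (l1.congr key) l2

lemma conv_weakDeriv_eq {j : Fin N} {f g : (Fin N → ℝ) → ℝ} (hf : Integrable f)
    (hg : Integrable g) (hw : IsWeakDeriv j f g) {κ κ' : (Fin (N + 1) → ℝ) → ℝ}
    (h : GoodKer κ) (h' : GoodKer κ')
    (hd : ∀ z, 0 < z 0 → HasLineDerivAt ℝ κ (κ' z) z (basisVec j.succ))
    (hs : ∀ z, 0 < z 0 → ContDiffAt ℝ (⊤ : ℕ∞) κ z) {z : Fin (N + 1) → ℝ}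
    (hz : 0 < z 0) : conv κ' f z = conv κ g z := by
  obtain ⟨C1, hC10, hC1⟩ := h.abs_le hz
  obtain ⟨C2, hC20, hC2⟩ := h'.abs_le hz
  have hlift : ContDiff ℝ (⊤ : ℕ∞) fun y : Fin N → ℝ => z - lift 0 y := by
    refine contDiff_const.sub (contDiff_pi.2 fun i => ?_)
    refine Fin.cases ?_ (fun j => ?_) i
    · exact contDiff_const
    · exact contDiff_apply ℝ ℝ j
  have key := isWeakDeriv_bounded hf hg hw (φ := fun y => κ (z - lift 0 y))
    (φ' := fun y => -κ' (z - lift 0 y)) (C := max C1 C2) ?_ ?_ ?_ ?_ ?_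
  · simp only [mul_neg, integral_neg, neg_inj] at key
    simpa only [conv, mul_comm] using key
  · refine contDiff_iff_contDiffAt.2 fun y => ?_
    exact (hs (z - lift 0 y) (by simpa using hz)).comp (f := fun y => z - lift 0 y) y
      hlift.contDiffAt
  · intro y
    have h1 := hd (z - lift 0 y) (by simpa using hz)
    have h2 : HasDerivAt (fun r : ℝ => -r) (-1) 0 := (hasDerivAt_id 0).neg
    have h3 := HasDerivAt.comp_of_eq (0 : ℝ)
      (h₂ := fun t => κ (z - lift 0 y + t • basisVec j.succ)) h1 h2 (by simp)
    rw [mul_neg_one] at h3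
    refine h3.congr_of_eventuallyEq (Eventually.of_forall fun s => ?_)
    simp only [Function.comp]
    congr 1
    ext l
    refine Fin.cases ?_ (fun l => ?_) l
    · simp [basisVec, Fin.succ_ne_zero, eq_comm]
    · by_cases h : l = j
      · subst h; simp [basisVec]; ring
      · simp [basisVec, h]
  · exact (h'.continuous_slice hz).neg
  · exact fun y => (hC1 _ (by simp)).trans (le_max_left _ _)
  · exact fun y => by rw [abs_neg]; exact (hC2 _ (by simp)).trans (le_max_right _ _)

lemma contDiffAt_kerField {m : ℕ} {z : Fin m → ℝ} (hz : 0 < normSq z) (i : Fin m) :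
    ContDiffAt ℝ (⊤ : ℕ∞) (kerField i) z :=
  (contDiff_apply ℝ ℝ i).contDiffAt.mul (contDiff_normSq.contDiffAt.rpow_const_of_ne hz.ne')

lemma contDiffAt_kerGrad {m : ℕ} {z : Fin m → ℝ} (hz : 0 < normSq z) (i j : Fin m) :
    ContDiffAt ℝ (⊤ : ℕ∞) (kerGrad i j) z := by
  have hi : ∀ i, ContDiffAt ℝ (⊤ : ℕ∞) (fun z : Fin m → ℝ => z i) z := fun i =>
    (contDiff_apply ℝ ℝ i).contDiffAt
  exact (contDiffAt_const.mul (contDiff_normSq.contDiffAt.rpow_const_of_ne hz.ne')).sub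
    ((contDiffAt_const.mul ((hi i).mul (hi j))).mul
      (contDiff_normSq.contDiffAt.rpow_const_of_ne hz.ne'))

lemma conv_kerGrad_eq (hN : 1 ≤ N) {j : Fin N} {f g : (Fin N → ℝ) → ℝ} (hf : Integrable f)
    (hg : Integrable g) (hw : IsWeakDeriv j f g) (i : Fin (N + 1)) {z : Fin (N + 1) → ℝ}
    (hz : 0 < z 0) : conv (kerGrad i j.succ) f z = conv (kerField i) g z :=
  conv_weakDeriv_eq hf hg hw (goodKer_kerField hN i) (goodKer_kerGrad i j.succ)
    (fun _ hz => hasLineDerivAt_kerField (normSq_pos hz) i j.succ)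
    (fun _ hz => contDiffAt_kerField (normSq_pos hz) i) hz

lemma conv_kerHess_eq {j : Fin N} {f g : (Fin N → ℝ) → ℝ} (hf : Integrable f)
    (hg : Integrable g) (hw : IsWeakDeriv j f g) (i k : Fin (N + 1)) {z : Fin (N + 1) → ℝ}
    (hz : 0 < z 0) : conv (kerHess i k j.succ) f z = conv (kerGrad i k) g z :=
  conv_weakDeriv_eq hf hg hw (goodKer_kerGrad i k) (goodKer_kerHess i k j.succ)
    (fun _ hz => hasLineDerivAt_kerGrad (normSq_pos hz) i k j.succ)
    (fun _ hz => contDiffAt_kerGrad (normSq_pos hz) i k) hz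

end Riesz

section Laplacian

variable {N : ℕ}

/-! ### Functions with pure second derivatives on the half-space -/

/-- `w` has first and pure second partial derivatives `w1 k`, `w2 k` on the open half-space. -/
structure HasLap (w : (Fin (N + 1) → ℝ) → ℝ) (w1 w2 : Fin (N + 1) → (Fin (N + 1) → ℝ) → ℝ) :
    Prop where
  fst : ∀ k z, 0 < z 0 → HasLineDerivAt ℝ w (w1 k z) z (basisVec k)
  snd : ∀ k z, 0 < z 0 → HasLineDerivAt ℝ (w1 k) (w2 k z) z (basisVec k)

variable {u v : (Fin (N + 1) → ℝ) → ℝ} {u1 u2 v1 v2 : Fin (N + 1) → (Fin (N + 1) → ℝ) → ℝ}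

lemma HasLap.add (hu : HasLap u u1 u2) (hv : HasLap v v1 v2) :
    HasLap (fun z => u z + v z) (fun k z => u1 k z + v1 k z) (fun k z => u2 k z + v2 k z) where
  fst k z hz := HasLineDerivAt.add' (hu.fst k z hz) (hv.fst k z hz)
  snd k z hz := HasLineDerivAt.add' (hu.snd k z hz) (hv.snd k z hz)

lemma HasLap.sub (hu : HasLap u u1 u2) (hv : HasLap v v1 v2) :
    HasLap (fun z => u z - v z) (fun k z => u1 k z - v1 k z) (fun k z => u2 k z - v2 k z) where
  fst k z hz := HasLineDerivAt.sub' (hu.fst k z hz) (hv.fst k z hz)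
  snd k z hz := HasLineDerivAt.sub' (hu.snd k z hz) (hv.snd k z hz)

lemma HasLap.const_mul (hu : HasLap u u1 u2) (c : ℝ) :
    HasLap (fun z => c * u z) (fun k z => c * u1 k z) (fun k z => c * u2 k z) where
  fst k z hz := HasLineDerivAt.const_mul' (hu.fst k z hz) c
  snd k z hz := HasLineDerivAt.const_mul' (hu.snd k z hz) c

lemma hasLap_const (c : ℝ) : HasLap (N := N) (fun _ => c) (fun _ _ => 0) (fun _ _ => 0) where
  fst _ z _ := hasLineDerivAt_const' c z _
  snd _ z _ := hasLineDerivAt_const' 0 z _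

lemma HasLap.sum {ι : Type*} {s : Finset ι} {u : ι → (Fin (N + 1) → ℝ) → ℝ}
    {u1 u2 : ι → Fin (N + 1) → (Fin (N + 1) → ℝ) → ℝ} (hu : ∀ i ∈ s, HasLap (u i) (u1 i) (u2 i)) :
    HasLap (fun z => ∑ i ∈ s, u i z) (fun k z => ∑ i ∈ s, u1 i k z)
      (fun k z => ∑ i ∈ s, u2 i k z) where
  fst k z hz := HasLineDerivAt.sum' fun i hi => (hu i hi).fst k z hz
  snd k z hz := HasLineDerivAt.sum' fun i hi => (hu i hi).snd k z hz

lemma HasLap.sq (hu : HasLap u u1 u2) :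
    HasLap (fun z => u z ^ 2) (fun k z => 2 * (u z * u1 k z))
      (fun k z => 2 * (u1 k z ^ 2 + u z * u2 k z)) where
  fst k z hz := by
    have := HasLineDerivAt.mul' (hu.fst k z hz) (hu.fst k z hz)
    simp only [← pow_two] at this
    exact this.congr_deriv (by ring)
  snd k z hz := by
    have := HasLineDerivAt.const_mul' (HasLineDerivAt.mul' (hu.fst k z hz) (hu.snd k z hz)) 2
    exact this.congr_deriv (by ring)

lemma HasLap.rpow (hu : HasLap u u1 u2) (a : ℝ) (hpos : ∀ z, 0 < z 0 → 0 < u z) :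
    HasLap (fun z => u z ^ a) (fun k z => a * (u z ^ (a - 1) * u1 k z))
      (fun k z => a * ((a - 1) * u z ^ (a - 1 - 1) * u1 k z ^ 2 + u z ^ (a - 1) * u2 k z)) where
  fst k z hz :=
    (HasLineDerivAt.rpow_const' (hu.fst k z hz) a (hpos z hz).ne').congr_deriv (by ring)
  snd k z hz := by
    have := HasLineDerivAt.const_mul' (HasLineDerivAt.mul'
      (HasLineDerivAt.rpow_const' (hu.fst k z hz) (a - 1) (hpos z hz).ne') (hu.snd k z hz)) a
    exact this.congr_deriv (by ring)

lemma hasDerivAt_line {u : (Fin (N + 1) → ℝ) → ℝ} {u' s : ℝ} {z e : Fin (N + 1) → ℝ}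
    (h : HasLineDerivAt ℝ u u' (z + s • e) e) : HasDerivAt (fun r : ℝ => u (z + r • e)) u' s := by
  have h2 : HasDerivAt (fun r : ℝ => r - s) 1 s := (hasDerivAt_id s).sub_const s
  have h3 := HasDerivAt.comp_of_eq s (h₂ := fun t => u (z + s • e + t • e)) h h2 (by simp)
  rw [mul_one] at h3
  refine h3.congr_of_eventuallyEq (Eventually.of_forall fun r => ?_)
  simp only [Function.comp]
  congr 1
  module

lemma eventually_line_pos {z : Fin (N + 1) → ℝ} (hz : 0 < z 0) (e : Fin (N + 1) → ℝ) :
    ∀ᶠ s : ℝ in 𝓝 0, 0 < (z + s • e) 0 := by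
  have : Continuous fun s : ℝ => (z + s • e) 0 := by fun_prop
  exact this.continuousAt.eventually (lt_mem_nhds (by simpa using hz))

lemma HasLap.congr (hu : HasLap u u1 u2) (h : ∀ z, 0 < z 0 → v z = u z)
    (h1 : ∀ k z, 0 < z 0 → v1 k z = u1 k z) (h2 : ∀ k z, 0 < z 0 → v2 k z = u2 k z) :
    HasLap v v1 v2 where
  fst k z hz := by
    have := hu.fst k z hz
    rw [← h1 k z hz] at this
    refine HasDerivAt.congr_of_eventuallyEq this ?_
    filter_upwards [eventually_line_pos hz (basisVec k)] with s hs using h _ hs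
  snd k z hz := by
    have := hu.snd k z hz
    rw [← h2 k z hz] at this
    refine HasDerivAt.congr_of_eventuallyEq this ?_
    filter_upwards [eventually_line_pos hz (basisVec k)] with s hs using h1 k _ hs

lemma HasLap.shift (hu : HasLap u u1 u2) {e : Fin (N + 1) → ℝ} (he : 0 ≤ e 0) :
    HasLap (fun z => u (z + e)) (fun k z => u1 k (z + e)) (fun k z => u2 k (z + e)) where
  fst k z hz := by
    have := hu.fst k (z + e) (by simp; linarith)
    simpa only [HasLineDerivAt, add_right_comm] using this
  snd k z hz := by
    have := hu.snd k (z + e) (by simp; linarith)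
    simpa only [HasLineDerivAt, add_right_comm] using this

lemma hasLap_conv (hN : 1 ≤ N) {g : (Fin N → ℝ) → ℝ} (hg : Integrable g) (i : Fin (N + 1)) :
    HasLap (conv (kerField i) g) (fun k => conv (kerGrad i k) g)
      (fun k => conv (kerHess i k k) g) where
  fst k _ hz := (goodKer_kerField hN i).hasLineDerivAt_conv (goodKer_kerGrad i k) k
    (fun _ hz => hasLineDerivAt_kerField (normSq_pos hz) i k) hg hz
  snd k _ hz := (goodKer_kerGrad i k).hasLineDerivAt_conv (goodKer_kerHess i k k) k
    (fun _ hz => hasLineDerivAt_kerGrad (normSq_pos hz) i k k) hg hz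

lemma sum_conv_kerHess {g : (Fin N → ℝ) → ℝ} (hg : Integrable g) (i : Fin (N + 1))
    {z : Fin (N + 1) → ℝ} (hz : 0 < z 0) : ∑ k, conv (kerHess i k k) g z = 0 := by
  simp only [conv]
  rw [← integral_finsetSum _ fun k _ => (goodKer_kerHess i k k).integrable hg hz]
  have h0 : ∀ y, ∑ k, kerHess i k k (z - lift 0 y) = 0 :=
    fun y => sum_kerHess (normSq_pos (by simpa using hz)) i
  simp only [← Finset.sum_mul, h0, zero_mul, integral_zero]

/-! ### Maximum principle -/

lemma second_deriv_nonpos_of_isLocalMax {φ φ1 : ℝ → ℝ} {c x : ℝ} (hm : IsLocalMax φ x)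
    (h1 : ∀ᶠ s in 𝓝 x, HasDerivAt φ (φ1 s) s) (h2 : HasDerivAt φ1 c x) : c ≤ 0 := by
  by_contra! hc
  have e1 : deriv φ =ᶠ[𝓝 x] φ1 := h1.mono fun s hs => hs.deriv
  have e2 : deriv (deriv φ) x = c := by rw [e1.deriv_eq, h2.deriv]
  have hmin : IsLocalMin φ x := isLocalMin_of_deriv_deriv_pos (by rw [e2]; exact hc)
    hm.deriv_eq_zero h1.self_of_nhds.continuousAt
  have hconst : φ =ᶠ[𝓝 x] fun _ => φ x := by
    filter_upwards [hm, hmin] with s hs hs' using le_antisymm hs hs'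
  have e3 : deriv φ =ᶠ[𝓝 x] deriv fun _ => φ x := hconst.deriv
  rw [e3.deriv_eq] at e2
  simp at e2
  exact hc.ne e2

theorem max_principle {w : (Fin (N + 1) → ℝ) → ℝ} {w1 w2 : Fin (N + 1) → (Fin (N + 1) → ℝ) → ℝ}
    (hw : ContinuousOn w {z | 0 ≤ z 0}) (hb : ∀ z, z 0 = 0 → w z ≤ 0)
    (hd : ∀ δ > 0, ∃ R, ∀ z, 0 ≤ z 0 → R ≤ ‖z‖ → w z ≤ δ) (hl : HasLap w w1 w2)
    (hs : ∀ z, 0 < z 0 → 0 ≤ ∑ k, w2 k z) {z : Fin (N + 1) → ℝ} (hz : 0 ≤ z 0) : w z ≤ 0 := by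
  by_contra! hpos
  set δ := w z / 2 with hδ
  have hδ0 : 0 < δ := by positivity
  obtain ⟨R, hR⟩ := hd δ hδ0
  have hzR : ‖z‖ < R := by
    by_contra! h
    have := hR z hz h
    linarith
  have hR0 : 0 < R := (norm_nonneg z).trans_lt hzR
  set c := δ / (2 * ((N + 1 : ℕ) * R ^ 2)) with hc
  have hc0 : 0 < c := by positivity
  have hcb : ∀ y : Fin (N + 1) → ℝ, ‖y‖ ≤ R → c * normSq y ≤ δ / 2 := by
    intro y hy
    calc c * normSq y ≤ c * ((N + 1 : ℕ) * R ^ 2) := by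
          gcongr
          exact (normSq_le_norm_sq y).trans (by gcongr)
      _ = δ / 2 := by rw [hc]; field_simp
  set K : Set (Fin (N + 1) → ℝ) := Metric.closedBall 0 R ∩ {z | 0 ≤ z 0} with hK
  have hKc : IsCompact K := (isCompact_closedBall 0 R).inter_right
    (isClosed_le continuous_const (continuous_apply 0))
  obtain ⟨y, hyK, hy⟩ := hKc.exists_isMaxOn (f := fun y => w y + c * normSq y)
    ⟨z, by simpa using hzR.le, hz⟩
    ((hw.mono inter_subset_right).add (continuous_normSq.continuousOn.const_mul c |>.mono (subset_univ _)))
  have hyz : 2 * δ ≤ w y + c * normSq y := by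
    have h1 := hy (show z ∈ K from ⟨by simpa using hzR.le, hz⟩)
    have h2 : 0 ≤ c * normSq z := mul_nonneg hc0.le (normSq_nonneg z)
    have h3 : w z + c * normSq z ≤ w y + c * normSq y := h1
    linarith
  have hyR : ‖y‖ ≤ R := by simpa using hyK.1
  have hcy := hcb y hyR
  have hy0 : 0 < y 0 := by
    refine lt_of_le_of_ne hyK.2 fun h => ?_
    have := hb y h.symm
    linarith
  have hyR' : ‖y‖ < R := by
    by_contra! h
    have := hR y hyK.2 h
    linarith
  have hnorm : HasLap (N := N) (fun z => normSq z) (fun k z => 2 * z k) (fun _ _ => 2) :=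
    { fst := fun k z hz => by
        have := hasLineDerivAt_normSq_rpow (normSq_pos hz) k 1
        simpa using this
      snd := fun k z hz => by
        have := HasLineDerivAt.const_mul' (hasLineDerivAt_coord z k k) 2
        simpa [delta] using this }
  have hv := hl.add (hnorm.const_mul c)
  have hK' : ∀ᶠ z in 𝓝 y, z ∈ K := by
    have h1 : ∀ᶠ z : Fin (N + 1) → ℝ in 𝓝 y, ‖z‖ < R :=
      continuous_norm.continuousAt.eventually (gt_mem_nhds hyR')
    have h2 : ∀ᶠ z : Fin (N + 1) → ℝ in 𝓝 y, 0 < z 0 :=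
      (continuous_apply 0).continuousAt.eventually (lt_mem_nhds hy0)
    filter_upwards [h1, h2] with z h1 h2
    exact ⟨by simpa using h1.le, h2.le⟩
  have h2 : ∀ k, w2 k y + c * 2 ≤ 0 := by
    intro k
    have hcont : ContinuousAt (fun s : ℝ => y + s • basisVec k) 0 := by fun_prop
    refine second_deriv_nonpos_of_isLocalMax (x := 0)
      (φ := fun s => w (y + s • basisVec k) + c * normSq (y + s • basisVec k))
      (φ1 := fun s => w1 k (y + s • basisVec k) + c * (2 * (y + s • basisVec k) k)) ?_ ?_
      (hv.snd k y hy0)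
    · have h3 : ∀ᶠ s : ℝ in 𝓝 0, y + s • basisVec k ∈ K := by
        refine hcont.eventually ?_
        simpa using hK'
      filter_upwards [h3] with s hs
      have := hy hs
      simpa using this
    · filter_upwards [eventually_line_pos hy0 (basisVec k)] with s hs
      exact hasDerivAt_line (hv.fst k _ hs)
  have h3 : ∑ k, (w2 k y + c * 2) ≤ 0 := Finset.sum_nonpos fun k _ => h2 k
  rw [Finset.sum_add_distrib] at h3
  have h4 := hs y hy0
  have h5 : 0 < ∑ _k : Fin (N + 1), c * 2 := Finset.sum_pos (fun _ _ => by positivity) (by simp)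
  linarith

/-! ### Comparison with Poisson integrals -/

lemma hasLap_pext (hN : 1 ≤ N) {φ : (Fin N → ℝ) → ℝ} (hφ : Integrable φ) :
    HasLap (pext φ) (fun k => conv (kerGrad 0 k) φ) (fun k => conv (kerHess 0 k k) φ) :=
  (hasLap_conv hN hφ 0).congr (fun _ hz => pext_eq_conv φ hz) (fun _ _ _ => rfl) (fun _ _ _ => rfl)

lemma eq_lift_of_zero {z : Fin (N + 1) → ℝ} (hz : z 0 = 0) : lift 0 (fun j => z j.succ) = z := by
  conv_rhs => rw [eq_lift z, hz]

theorem le_conv_of_subharmonic (hN : 1 ≤ N) {S : (Fin (N + 1) → ℝ) → ℝ}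
    {S1 S2 : Fin (N + 1) → (Fin (N + 1) → ℝ) → ℝ}
    (hS : ContinuousOn S {z | 0 ≤ z 0}) (h0 : ∀ z, 0 ≤ z 0 → 0 ≤ S z) {C : ℝ}
    (hC : ∀ z, 0 ≤ z 0 → S z ≤ C)
    (hd : ∀ δ > 0, ∃ R, ∀ z, 0 ≤ z 0 → R ≤ ‖z‖ → S z ≤ δ) (hl : HasLap S S1 S2)
    (hi : Integrable fun y => S (lift 0 y))
    (hs : ∀ z, 0 < z 0 → 0 ≤ ∑ k, S2 k z) {z : Fin (N + 1) → ℝ} (hz : 0 < z 0) :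
    poisA N * S z ≤ conv (kerField 0) (fun y => S (lift 0 y)) z := by
  have hA := poisA_pos (N := N)
  have hφ : Continuous fun y => S (lift 0 y) :=
    hS.comp_continuous (continuous_lift_right 0) fun y => by simp
  have hφ0 : ∀ y, 0 ≤ S (lift 0 y) := fun y => h0 _ (by simp)
  have hφb : ∀ y, |S (lift 0 y)| ≤ C := fun y => by
    rw [abs_of_nonneg (hφ0 y)]; exact hC _ (by simp)
  have key := max_principle (w := fun z => poisA N * S z - pext (fun y => S (lift 0 y)) z)
    ((hS.const_mul _ |>.mono (Subset.refl _)).sub (continuous_pext hφ hφb).continuousOn) ?_ ?_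
    ((hl.const_mul _).sub (hasLap_pext hN hi)) ?_ hz.le
  · rw [pext_eq_conv _ hz] at key
    linarith
  · intro z hz
    rw [pext_boundary _ hz, eq_lift_of_zero hz, sub_self]
  · intro δ hδ
    obtain ⟨R, hR⟩ := hd (δ / poisA N) (by positivity)
    refine ⟨R, fun z hz hzR => ?_⟩
    have h1 := hR z hz hzR
    rw [le_div_iff₀ hA] at h1
    have h2 := pext_nonneg hφ0 z
    linarith
  · intro z hz
    rw [Finset.sum_sub_distrib, ← Finset.mul_sum, sum_conv_kerHess hi 0 hz, sub_zero]
    exact mul_nonneg hA.le (hs z hz)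

lemma conv_cutoff_le_of_superharmonic (hN : 1 ≤ N) {Φ : (Fin (N + 1) → ℝ) → ℝ}
    {Φ1 Φ2 : Fin (N + 1) → (Fin (N + 1) → ℝ) → ℝ}
    (hΦ : ContinuousOn Φ {z | 0 ≤ z 0}) (h0 : ∀ z, 0 ≤ z 0 → 0 ≤ Φ z) (hl : HasLap Φ Φ1 Φ2)
    (hs : ∀ z, 0 < z 0 → ∑ k, Φ2 k z ≤ 0) {χ : (Fin N → ℝ) → ℝ} (hχ : Continuous χ)
    (hχs : HasCompactSupport χ) (hχ1 : ∀ y, χ y ≤ 1)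
    {z : Fin (N + 1) → ℝ} (hz : 0 < z 0) :
    conv (kerField 0) (fun y => χ y * Φ (lift 0 y)) z ≤ poisA N * Φ z := by
  have hA := poisA_pos (N := N)
  have hφ : Continuous fun y => χ y * Φ (lift 0 y) :=
    hχ.mul (hΦ.comp_continuous (continuous_lift_right 0) fun y => by simp)
  have hφs : HasCompactSupport fun y => χ y * Φ (lift 0 y) := hχs.mul_right
  have hi := hφ.integrable_of_hasCompactSupport (μ := volume) hφs
  obtain ⟨C, hC⟩ := hφ.bounded_above_of_compact_support hφs
  have key := max_principle (w := fun z => pext (fun y => χ y * Φ (lift 0 y)) z - poisA N * Φ z)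
    ((continuous_pext hφ hC).continuousOn.sub (hΦ.const_mul _ |>.mono (Subset.refl _))) ?_ ?_
    ((hasLap_pext hN hi).sub (hl.const_mul _)) ?_ hz.le
  · rw [pext_eq_conv _ hz] at key
    linarith
  · intro z hz
    rw [pext_boundary _ hz, eq_lift_of_zero hz, sub_nonpos]
    exact mul_le_mul_of_nonneg_left (mul_le_of_le_one_left (h0 z hz.ge) (hχ1 _)) hA.le
  · intro δ hδ
    obtain ⟨R, hR⟩ := pext_decay hN hφ hφs hδ
    refine ⟨R, fun z hz hzR => ?_⟩
    have h1 := hR z hz hzR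
    have h2 := mul_nonneg hA.le (h0 z hz)
    linarith [le_abs_self (pext (fun y => χ y * Φ (lift 0 y)) z)]
  · intro z hz
    rw [Finset.sum_sub_distrib, ← Finset.mul_sum, sum_conv_kerHess hi 0 hz, zero_sub]
    exact neg_nonneg.2 (mul_nonpos_of_nonneg_of_nonpos hA.le (hs z hz))

theorem lintegral_le_of_superharmonic (hN : 1 ≤ N) {Φ : (Fin (N + 1) → ℝ) → ℝ}
    {Φ1 Φ2 : Fin (N + 1) → (Fin (N + 1) → ℝ) → ℝ}
    (hΦ : ContinuousOn Φ {z | 0 ≤ z 0}) (h0 : ∀ z, 0 ≤ z 0 → 0 ≤ Φ z) (hl : HasLap Φ Φ1 Φ2)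
    (hs : ∀ z, 0 < z 0 → ∑ k, Φ2 k z ≤ 0) {z : Fin (N + 1) → ℝ} (hz : 0 < z 0) :
    ∫⁻ y, ENNReal.ofReal (kerField 0 (z - lift 0 y) * Φ (lift 0 y)) ≤
      ENNReal.ofReal (poisA N * Φ z) := by
  let b : ContDiffBump (0 : Fin N → ℝ) := ⟨1, 2, one_pos, one_lt_two⟩
  set r : ℕ → ℝ := fun k => ((k : ℝ) + 1)⁻¹ with hr
  have hr0 : ∀ k, 0 < r k := fun k => by positivity
  have hrl : Tendsto r atTop (𝓝 0) := by
    simpa [hr] using tendsto_one_div_add_atTop_nhds_zero_nat (𝕜 := ℝ)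
  have hbr : ∀ x, Tendsto (fun k => b (r k • x)) atTop (𝓝 1) := by
    intro x
    have h0 : Tendsto (fun k => r k • x) atTop (𝓝 0) := by
      simpa using hrl.smul_const x
    have := b.continuous.continuousAt.tendsto.comp h0
    rw [b.one_of_mem_closedBall (Metric.mem_closedBall_self b.rIn_pos.le)] at this
    exact this
  have hker : ∀ y, 0 ≤ kerField 0 (z - lift 0 y) :=
    fun y => kerField_zero_nonneg (by simpa using hz.le)
  have hcΦ : Continuous fun y => Φ (lift 0 y) :=
    hΦ.comp_continuous (continuous_lift_right 0) fun y => by simp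
  set G : ℕ → (Fin N → ℝ) → ℝ≥0∞ := fun k y =>
    ENNReal.ofReal (kerField 0 (z - lift 0 y) * (b (r k • y) * Φ (lift 0 y))) with hG
  have hcont : ∀ k, Continuous fun y => b (r k • y) * Φ (lift 0 y) := fun k =>
    (b.continuous.comp (continuous_const_smul (r k))).mul hcΦ
  have hcs : ∀ k, HasCompactSupport fun y => b (r k • y) := fun k =>
    b.hasCompactSupport.comp_homeomorph (Homeomorph.smulOfNeZero (r k) (hr0 k).ne')
  have hGm : ∀ k, Measurable (G k) := fun k =>
    (((goodKer_kerField hN 0).continuous_slice hz).mul (hcont k)).measurable.ennreal_ofReal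
  have hGle : ∀ k, ∫⁻ y, G k y ≤ ENNReal.ofReal (poisA N * Φ z) := by
    intro k
    have h1 := conv_cutoff_le_of_superharmonic hN hΦ h0 hl hs
      (b.continuous.comp (continuous_const_smul (r k))) (hcs k) (fun _ => b.le_one) hz
    refine le_trans (le_of_eq ?_) (ENNReal.ofReal_le_ofReal h1)
    rw [conv, ofReal_integral_eq_lintegral_ofReal]
    · rfl
    · exact (goodKer_kerField hN 0).integrable
        ((hcont k).integrable_of_hasCompactSupport (hcs k).mul_right) hz
    · exact Eventually.of_forall fun y => mul_nonneg (hker y)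
        (mul_nonneg b.nonneg (h0 _ (by simp)))
  calc _ = ∫⁻ y, liminf (fun k => G k y) atTop := by
        refine lintegral_congr fun y => ?_
        have h1 : Tendsto (fun k => G k y) atTop
            (𝓝 (ENNReal.ofReal (kerField 0 (z - lift 0 y) * (1 * Φ (lift 0 y))))) :=
          (ENNReal.continuous_ofReal.tendsto _).comp
            (((hbr y).mul_const _).const_mul _)
        rw [h1.liminf_eq, one_mul]
    _ ≤ liminf (fun k => ∫⁻ y, G k y) atTop := lintegral_liminf_le hGm
    _ ≤ _ := liminf_le_of_le (by isBoundedDefault) fun c hc => by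
        obtain ⟨k, hk⟩ := hc.exists
        exact hk.trans (hGle k)

end Laplacian

section Gradient

variable {N : ℕ}

/-! ### The gradient field of the harmonic extension -/

/-- `f` is integrable with integrable weak partial derivatives `D j`. -/
structure IsSobolev (f : (Fin N → ℝ) → ℝ) (D : Fin N → (Fin N → ℝ) → ℝ) : Prop where
  int : Integrable f
  intD : ∀ j, Integrable (D j)
  weak : ∀ j, IsWeakDeriv j f (D j)

/-- The `i`-th partial derivative of the (unnormalised) harmonic extension of `f`. -/
def fld (f : (Fin N → ℝ) → ℝ) (i : Fin (N + 1)) : (Fin (N + 1) → ℝ) → ℝ := conv (kerGrad 0 i) f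

/-- The second partial derivatives of the (unnormalised) harmonic extension of `f`. -/
def fldD (f : (Fin N → ℝ) → ℝ) (i k : Fin (N + 1)) : (Fin (N + 1) → ℝ) → ℝ :=
  conv (kerHess 0 i k) f

variable {f : (Fin N → ℝ) → ℝ} {D : Fin N → (Fin N → ℝ) → ℝ} {z : Fin (N + 1) → ℝ}

lemma IsSobolev.fld_succ (hN : 1 ≤ N) (h : IsSobolev f D) (l : Fin N) (hz : 0 < z 0) :
    fld f l.succ z = conv (kerField 0) (D l) z :=
  conv_kerGrad_eq hN h.int (h.intD l) (h.weak l) 0 hz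

lemma IsSobolev.fld_zero (hN : 1 ≤ N) (h : IsSobolev f D) (hz : 0 < z 0) :
    fld f 0 z = -∑ j, conv (kerField j.succ) (D j) z := by
  have h1 : ∑ i, conv (kerGrad i i) f z = 0 := by
    simp only [conv]
    rw [← integral_finsetSum _ fun k _ => (goodKer_kerGrad k k).integrable h.int hz]
    have h0 : ∀ y, ∑ k, kerGrad k k (z - lift 0 y) = 0 :=
      fun y => sum_kerGrad (normSq_pos (by simpa using hz))
    simp only [← Finset.sum_mul, h0, zero_mul, integral_zero]
  rw [Fin.sum_univ_succ] at h1
  have h2 : ∀ j : Fin N, conv (kerGrad j.succ j.succ) f z = conv (kerField j.succ) (D j) z :=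
    fun j => conv_kerGrad_eq hN h.int (h.intD j) (h.weak j) _ hz
  simp only [h2] at h1
  exact eq_neg_of_add_eq_zero_left h1

lemma fldD_comm (i k : Fin (N + 1)) : fldD f i k z = fldD f k i z := by
  simp only [fldD, conv, kerHess_swap 0 i k]

lemma IsSobolev.sum_fldD (h : IsSobolev f D) (hz : 0 < z 0) : ∑ k, fldD f k k z = 0 :=
  sum_conv_kerHess h.int 0 hz

lemma IsSobolev.fldD_succ (h : IsSobolev f D) (l : Fin N) (k : Fin (N + 1)) (hz : 0 < z 0) :
    fldD f l.succ k z = conv (kerGrad 0 k) (D l) z := by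
  rw [fldD_comm]
  exact conv_kerHess_eq h.int (h.intD l) (h.weak l) 0 k hz

lemma IsSobolev.fldD_zero (h : IsSobolev f D) (k : Fin (N + 1)) (hz : 0 < z 0) :
    fldD f 0 k z = -∑ j, conv (kerGrad j.succ k) (D j) z := by
  have h1 := sum_conv_kerHess h.int k hz
  rw [Fin.sum_univ_succ] at h1
  have h0 : conv (kerHess k 0 0) f z = fldD f 0 k z := by
    simp only [fldD, conv, kerHess_swap_left k 0 0, kerHess_swap 0 k 0]
  have h2 : ∀ j : Fin N, conv (kerHess k j.succ j.succ) f z = conv (kerGrad j.succ k) (D j) z := by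
    intro j
    rw [← conv_kerHess_eq h.int (h.intD j) (h.weak j) _ _ hz]
    simp only [conv, kerHess_swap_left k j.succ j.succ]
  simp only [h2, h0] at h1
  exact eq_neg_of_add_eq_zero_left h1

lemma IsSobolev.hasLap_fld (hN : 1 ≤ N) (h : IsSobolev f D) (i : Fin (N + 1)) :
    ∃ w2, HasLap (fld f i) (fldD f i) w2 ∧ ∀ z, 0 < z 0 → ∑ k, w2 k z = 0 := by
  refine Fin.cases ?_ (fun l => ?_) i
  · refine ⟨_, ((HasLap.sum (s := Finset.univ) fun j _ =>
      hasLap_conv hN (h.intD j) j.succ).const_mul (-1)).congr ?_ ?_ (fun _ _ _ => rfl), ?_⟩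
    · intro z hz
      rw [h.fld_zero hN hz, neg_one_mul]
    · intro k z hz
      rw [h.fldD_zero k hz, neg_one_mul]
    · intro z hz
      rw [← Finset.mul_sum, Finset.sum_comm, Finset.sum_eq_zero, mul_zero]
      exact fun j _ => sum_conv_kerHess (h.intD j) _ hz
  · exact ⟨_, (hasLap_conv hN (h.intD l) 0).congr (fun z hz => h.fld_succ hN l hz)
      (fun k z hz => h.fldD_succ l k hz) (fun _ _ _ => rfl),
      fun z hz => sum_conv_kerHess (h.intD l) 0 hz⟩

/-- The squared length of the gradient field. -/
def fldSq (f : (Fin N → ℝ) → ℝ) (z : Fin (N + 1) → ℝ) : ℝ := ∑ i, fld f i z ^ 2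

lemma fldSq_nonneg (z : Fin (N + 1) → ℝ) : 0 ≤ fldSq f z := Finset.sum_nonneg fun _ _ => sq_nonneg _

lemma continuousAt_fld (hf : Integrable f) (i : Fin (N + 1)) (hz : 0 < z 0) :
    ContinuousAt (fld f i) z := (goodKer_kerGrad 0 i).continuousAt_conv hf hz

lemma continuousAt_fldSq (hf : Integrable f) (hz : 0 < z 0) : ContinuousAt (fldSq f) z := by
  unfold fldSq
  exact tendsto_finsetSum _ fun i _ => (continuousAt_fld hf i hz).pow 2

/-- The refined Kato inequality behind subharmonicity of small powers of a harmonic gradient. -/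
lemma sum_sq_mulVec_le {d : ℕ} {P : Fin d → Fin d → ℝ} (hs : ∀ i k, P i k = P k i)
    (ht : ∑ k, P k k = 0) (F : Fin d → ℝ) :
    (d + 2) * ∑ k, (∑ i, F i * P i k) ^ 2 ≤ (d + 1) * ((∑ i, F i ^ 2) * ∑ i, ∑ k, P i k ^ 2) := by
  set a : Fin d → ℝ := fun k => ∑ i, F i * P i k with ha
  set s := ∑ i, F i ^ 2 with hsdef
  set Q := ∑ i, ∑ k, P i k ^ 2 with hQ
  set α := ∑ k, a k * F k with hα
  set A := ∑ k, a k ^ 2 with hA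
  have hs0 : 0 ≤ s := Finset.sum_nonneg fun i _ => sq_nonneg _
  rcases hs0.eq_or_lt with h0 | hpos
  · have hF : ∀ i, F i = 0 := fun i => by
      have := (Finset.sum_eq_zero_iff_of_nonneg fun i _ => sq_nonneg (F i)).1 h0.symm i
        (Finset.mem_univ i)
      simpa using this
    have : A = 0 := by simp [hA, ha, hF]
    rw [this, ← h0]
    simp
  set X := ∑ i, ∑ k, (s * P i k - F i * a k) ^ 2 with hX
  have e1 : X = s ^ 2 * Q - s * A := by
    have : ∀ i k, (s * P i k - F i * a k) ^ 2 =
        s ^ 2 * P i k ^ 2 - 2 * s * (a k * (F i * P i k)) + F i ^ 2 * a k ^ 2 := by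
      intro i k; ring
    simp only [hX, this, Finset.sum_add_distrib, Finset.sum_sub_distrib, ← Finset.mul_sum]
    rw [← hQ, ← hA, ← Finset.sum_mul, ← hsdef, Finset.sum_comm (f := fun i k => a k * (F i * P i k))]
    simp only [← Finset.mul_sum]
    have : ∑ k, a k * ∑ i, F i * P i k = A := by
      simp only [hA, pow_two, ha]
    rw [this]; ring
  have e2 : α ^ 2 ≤ d * X := by
    have h1 : ∑ k, (s * P k k - F k * a k) = -α := by
      rw [Finset.sum_sub_distrib, ← Finset.mul_sum, ht, mul_zero, zero_sub, hα]
      simp only [mul_comm]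
    have h2 := sq_sum_le_card_mul_sum_sq (s := Finset.univ) (f := fun k => s * P k k - F k * a k)
    rw [h1, neg_sq, Finset.card_univ, Fintype.card_fin] at h2
    refine h2.trans (mul_le_mul_of_nonneg_left ?_ (Nat.cast_nonneg _))
    exact Finset.sum_le_sum fun i _ => Finset.single_le_sum
      (f := fun k => (s * P i k - F i * a k) ^ 2) (fun k _ => sq_nonneg _) (Finset.mem_univ i)
  have e3 : s * A - α ^ 2 ≤ X := by
    have h1 : ∀ i, ∑ k, (s * P i k - F i * a k) * F k = s * a i - F i * α := by
      intro i
      simp only [sub_mul, Finset.sum_sub_distrib, mul_assoc, ← Finset.mul_sum]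
      rw [← hα]
      simp only [ha, hs i, mul_comm]
    have h2 : ∑ i, (s * a i - F i * α) ^ 2 = s * (s * A - α ^ 2) := by
      have : ∀ i, (s * a i - F i * α) ^ 2 =
        s ^ 2 * a i ^ 2 - 2 * s * α * (a i * F i) + α ^ 2 * F i ^ 2 := by intro i; ring
      simp only [this, Finset.sum_add_distrib, Finset.sum_sub_distrib, ← Finset.mul_sum]
      rw [← hA, ← hα, ← hsdef]; ring
    have h3 : ∑ i, (s * a i - F i * α) ^ 2 ≤ s * X := by
      rw [hX, Finset.mul_sum]
      refine Finset.sum_le_sum fun i _ => ?_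
      rw [← h1, mul_comm s]
      exact Finset.sum_mul_sq_le_sq_mul_sq _ _ _
    rw [h2] at h3
    exact le_of_mul_le_mul_left h3 hpos
  have h4 : s * ((d + 2) * A) ≤ s * ((d + 1) * (s * Q)) := by
    nlinarith
  exact le_of_mul_le_mul_left h4 hpos

end Gradient

section Subharmonic

variable {N : ℕ} {f : (Fin N → ℝ) → ℝ} {D : Fin N → (Fin N → ℝ) → ℝ} {z : Fin (N + 1) → ℝ}

lemma lift_zero_add (ε : ℝ) (y : Fin N → ℝ) : lift 0 y + lift ε 0 = lift ε y := by
  ext i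
  refine Fin.cases ?_ (fun j => ?_) i <;> simp

/-! ### Subharmonicity of a power of the gradient -/

/-- The exponent `p = d / (d + 1)`, `d = N + 1`, for which `|∇u|^p` is subharmonic. -/
def expP (N : ℕ) : ℝ := (N + 1) / (N + 2)

lemma expP_pos : 0 < expP N := by unfold expP; positivity

lemma expP_lt_one : expP N < 1 := by
  unfold expP
  rw [div_lt_one (by positivity)]
  linarith

lemma IsSobolev.exists_fldSq_bound (h : IsSobolev f D) {ε : ℝ} (hε : 0 < ε) :
    ∃ C ≥ 0, ∀ z : Fin (N + 1) → ℝ, ε ≤ z 0 → fldSq f z ≤ C := by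
  have h1 : ∀ i : Fin (N + 1), ∃ C ≥ 0, ∀ z : Fin (N + 1) → ℝ, ε ≤ z 0 → |fld f i z| ≤ C := by
    intro i
    obtain ⟨C, hC0, hC⟩ := (goodKer_kerGrad (N := N) 0 i).abs_le hε
    refine ⟨C * ∫ y, |f y|, mul_nonneg hC0 (integral_nonneg fun _ => abs_nonneg _),
      fun z hz => ?_⟩
    rw [← integral_const_mul]
    refine (abs_integral_le_integral_abs).trans (integral_mono ?_ (h.int.abs.const_mul C) ?_)
    · exact ((goodKer_kerGrad 0 i).integrable h.int (hε.trans_le hz)).abs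
    · intro y
      simp only [abs_mul]
      exact mul_le_mul_of_nonneg_right (hC _ (by simpa using hz)) (abs_nonneg _)
  choose C hC0 hC using h1
  refine ⟨∑ i, C i ^ 2, Finset.sum_nonneg fun _ _ => sq_nonneg _, fun z hz =>
    Finset.sum_le_sum fun i _ => ?_⟩
  rw [← sq_abs]
  exact pow_le_pow_left₀ (abs_nonneg _) (hC i z hz) 2

lemma IsSobolev.fldSq_decay (h : IsSobolev f D) {ε δ : ℝ} (hε : 0 < ε) (hδ : 0 < δ) :
    ∃ R, ∀ z : Fin (N + 1) → ℝ, ε ≤ z 0 → R ≤ ‖z‖ → fldSq f z ≤ δ := by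
  have h1 : ∀ i : Fin (N + 1), ∃ R, ∀ z, ε ≤ z 0 → R ≤ ‖z‖ →
      |fld f i z| ≤ Real.sqrt (δ / (N + 1)) := fun i =>
    (goodKer_kerGrad (N := N) 0 i).conv_decay h.int hε (by positivity)
  choose R hR using h1
  refine ⟨∑ i, |R i|, fun z hz hzR => ?_⟩
  have h2 : ∀ i, fld f i z ^ 2 ≤ δ / (N + 1) := fun i => by
    have h3 := hR i z hz (((le_abs_self _).trans (Finset.single_le_sum (f := fun i => |R i|)
      (fun i _ => abs_nonneg _) (Finset.mem_univ i))).trans hzR)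
    rw [← sq_abs, ← Real.sq_sqrt (show 0 ≤ δ / ((N : ℝ) + 1) by positivity)]
    exact pow_le_pow_left₀ (abs_nonneg _) h3 2
  refine (Finset.sum_le_sum fun i _ => h2 i).trans ?_
  rw [Finset.sum_const, Finset.card_univ, Fintype.card_fin, nsmul_eq_mul]
  push_cast
  rw [mul_div_cancel₀]
  positivity

lemma IsSobolev.integrable_fld (h : IsSobolev f D) {ε : ℝ} (hε : 0 < ε) (i : Fin (N + 1)) :
    Integrable fun y => fld f i (lift ε y) := integrable_conv (integrable_kerGrad 0 i hε) h.int

lemma IsSobolev.continuous_fldSq (h : IsSobolev f D) {ε : ℝ} (hε : 0 < ε) :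
    Continuous fun y => fldSq f (lift ε y) :=
  continuous_iff_continuousAt.2 fun y => (continuousAt_fldSq h.int (z := lift ε y)
    (by simpa using hε)).comp (f := fun y => lift ε y) (continuous_lift_right ε).continuousAt

lemma IsSobolev.integrable_fldSq (h : IsSobolev f D) {ε : ℝ} (hε : 0 < ε) :
    Integrable fun y => fldSq f (lift ε y) := by
  obtain ⟨C, hC0, hC⟩ := h.exists_fldSq_bound hε
  refine integrable_finsetSum _ fun i _ => ?_
  simp only [sq]
  refine (h.integrable_fld hε i).bdd_mul (c := Real.sqrt C)
    (h.integrable_fld hε i).aestronglyMeasurable (Eventually.of_forall fun y => ?_)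
  rw [Real.norm_eq_abs]
  refine Real.abs_le_sqrt ((Finset.single_le_sum (f := fun i => fld f i (lift ε y) ^ 2)
    (fun i _ => sq_nonneg _) (Finset.mem_univ i)).trans (hC (lift ε y) (by simp)))

lemma rpow_add_sub_le {G δ a : ℝ} (hG : 0 ≤ G) (hδ : 0 < δ) (ha1 : a ≤ 1) :
    (G + δ) ^ a - δ ^ a ≤ δ ^ (a - 1) * G := by
  have h1 : G + δ = δ * (1 + G / δ) := by field_simp; ring
  rw [h1, Real.mul_rpow hδ.le (by positivity), Real.rpow_sub_one hδ.ne']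
  have h2 : (1 + G / δ) ^ a ≤ 1 + G / δ := by
    calc (1 + G / δ) ^ a ≤ (1 + G / δ) ^ (1 : ℝ) :=
          Real.rpow_le_rpow_of_exponent_le (by linarith [div_nonneg hG hδ.le]) ha1
      _ = _ := Real.rpow_one _
  have h3 := mul_le_mul_of_nonneg_left h2 (Real.rpow_nonneg hδ.le a)
  have h4 : δ ^ a / δ * G = δ ^ a * (G / δ) := by ring
  rw [h4]
  linarith

lemma sum_lap_rpow {d : ℕ} {ρ a : ℝ} (hρ : 0 < ρ) (x1 x2 : Fin d → ℝ) :
    ∑ k, a * ((a - 1) * ρ ^ (a - 1 - 1) * x1 k ^ 2 + ρ ^ (a - 1) * x2 k) =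
      a * ρ ^ (a - 1 - 1) * (ρ * ∑ k, x2 k - (1 - a) * ∑ k, x1 k ^ 2) := by
  have h1 : ρ ^ (a - 1) = ρ ^ (a - 1 - 1) * ρ := by
    rw [Real.rpow_sub_one hρ.ne' (a - 1)]; field_simp
  rw [h1, ← Finset.mul_sum, Finset.sum_add_distrib, ← Finset.mul_sum, ← Finset.mul_sum]
  ring

lemma ofReal_integral_le_lintegral {α : Type*} [MeasurableSpace α] {μ : Measure α} {g : α → ℝ}
    (hg : Integrable g μ) (h0 : ∀ x, 0 ≤ g x) :
    ENNReal.ofReal (∫ x, g x ∂μ) = ∫⁻ x, ENNReal.ofReal (g x) ∂μ :=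
  ofReal_integral_eq_lintegral_ofReal hg (Eventually.of_forall h0)

theorem IsSobolev.fldSq_rpow_le (hN : 1 ≤ N) (h : IsSobolev f D) {ε : ℝ} (hε : 0 < ε)
    (hz : 0 < z 0) :
    ENNReal.ofReal (poisA N * fldSq f (z + lift ε 0) ^ (expP N / 2)) ≤
      ∫⁻ y, ENNReal.ofReal (kerField 0 (z - lift 0 y) * fldSq f (lift ε y) ^ (expP N / 2)) := by
  set a := expP N / 2 with ha
  have ha0 : 0 < a := half_pos expP_pos
  have ha1 : a ≤ 1 := by have := expP_lt_one (N := N); linarith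
  choose w2 hw hw0 using h.hasLap_fld hN
  have hpos : ∀ z : Fin (N + 1) → ℝ, 0 ≤ z 0 → ε ≤ (z + lift ε 0 : Fin (N + 1) → ℝ) 0 :=
    fun z hz => by simpa using hz
  have key : ∀ δ > 0, ENNReal.ofReal
      (poisA N * ((fldSq f (z + lift ε 0) + δ) ^ a - δ ^ a)) ≤
      ∫⁻ y, ENNReal.ofReal (kerField 0 (z - lift 0 y) * fldSq f (lift ε y) ^ a) := by
    intro δ hδ
    have hS0 : ∀ z : Fin (N + 1) → ℝ, 0 ≤ (fldSq f (z + lift ε 0) + δ) ^ a - δ ^ a := fun z =>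
      sub_nonneg.2 (Real.rpow_le_rpow hδ.le (by linarith [fldSq_nonneg (f := f) (z + lift ε 0)])
        ha0.le)
    have hSle : ∀ z : Fin (N + 1) → ℝ, (fldSq f (z + lift ε 0) + δ) ^ a - δ ^ a ≤
        δ ^ (a - 1) * fldSq f (z + lift ε 0) := fun z => rpow_add_sub_le (fldSq_nonneg _) hδ ha1
    have hδ1 : 0 < δ ^ (a - 1) := Real.rpow_pos_of_pos hδ _
    obtain ⟨C, hC0, hC⟩ := h.exists_fldSq_bound hε
    have hcont : ContinuousOn (fun z => (fldSq f (z + lift ε 0) + δ) ^ a - δ ^ a)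
        {z : Fin (N + 1) → ℝ | 0 ≤ z 0} := by
      intro z hz
      have h1 : ContinuousAt (fun z => fldSq f (z + lift ε 0)) z :=
        (continuousAt_fldSq h.int (z := z + lift ε 0) (hε.trans_le (hpos z hz))).comp
          (f := fun z => z + lift ε 0) (by fun_prop)
      exact ContinuousAt.continuousWithinAt
        (((h1.add_const δ).rpow_const (Or.inr ha0.le)).sub continuousAt_const)
    have hintegrable : Integrable fun y => (fldSq f (lift 0 y + lift ε 0) + δ) ^ a - δ ^ a := by
      refine Integrable.mono' ((h.integrable_fldSq hε).const_mul (δ ^ (a - 1))) ?_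
        (Eventually.of_forall fun y => ?_)
      · refine (hcont.comp_continuous (continuous_lift_right 0) fun y => ?_).aestronglyMeasurable
        simp
      · rw [Real.norm_eq_abs, abs_of_nonneg (hS0 _), ← lift_zero_add ε y]
        exact hSle _
    have main := le_conv_of_subharmonic hN (z := z) hcont (fun z _ => hS0 z)
      (C := δ ^ (a - 1) * C)
      (fun z hz => (hSle z).trans (mul_le_mul_of_nonneg_left (hC _ (hpos z hz)) hδ1.le)) ?_
      (((((HasLap.sum (s := Finset.univ) fun i _ => (hw i).sq).shift
        (e := lift ε 0) (by simpa using hε.le)).add (hasLap_const δ)).rpow a ?_).sub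
        (hasLap_const (δ ^ a))) hintegrable ?_ hz
    · refine (ENNReal.ofReal_le_ofReal main).trans ?_
      unfold conv
      rw [ofReal_integral_le_lintegral ((goodKer_kerField hN 0).integrable hintegrable hz)
        fun y => mul_nonneg (kerField_zero_nonneg (by simpa using hz.le)) (hS0 _)]
      refine lintegral_mono fun y => ENNReal.ofReal_le_ofReal (mul_le_mul_of_nonneg_left ?_
        (kerField_zero_nonneg (by simpa using hz.le)))
      rw [lift_zero_add, sub_le_iff_le_add]
      exact Real.rpow_add_le_add_rpow (fldSq_nonneg _) hδ.le ha0.le ha1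
    · intro δ' hδ'
      obtain ⟨R, hR⟩ := h.fldSq_decay hε (show 0 < δ' / δ ^ (a - 1) by positivity)
      refine ⟨R + ‖(lift ε 0 : Fin (N + 1) → ℝ)‖, fun z hz hzR => (hSle z).trans ?_⟩
      have h1 : R ≤ ‖z + lift ε 0‖ := by
        have := norm_sub_norm_le z (-lift ε 0)
        rw [norm_neg, sub_neg_eq_add] at this
        linarith
      have h2 := hR _ (hpos z hz) h1
      rwa [le_div_iff₀' hδ1] at h2
    · intro z hz
      have := fldSq_nonneg (f := f) (z + lift ε 0)
      unfold fldSq at this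
      positivity
    · intro z hz
      have hz' : 0 < (z + lift ε 0 : Fin (N + 1) → ℝ) 0 := hε.trans_le (hpos z hz.le)
      have hG := fldSq_nonneg (f := f) (z + lift ε 0)
      simp only [sub_zero, add_zero]
      change 0 ≤ ∑ k, a * ((a - 1) * (fldSq f (z + lift ε 0) + δ) ^ (a - 1 - 1) * _ ^ 2 +
        (fldSq f (z + lift ε 0) + δ) ^ (a - 1) * _)
      rw [sum_lap_rpow (by positivity)]
      refine mul_nonneg (by positivity) ?_
      have kato := sum_sq_mulVec_le (P := fun i k => fldD f i k (z + lift ε 0))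
        (fun i k => fldD_comm i k) (h.sum_fldD hz') (fun i => fld f i (z + lift ε 0))
      change _ ≤ _ * (fldSq f (z + lift ε 0) * _) at kato
      set Q := ∑ i, ∑ k, fldD f i k (z + lift ε 0) ^ 2 with hQ
      set T := ∑ k, (∑ i, fld f i (z + lift ε 0) * fldD f i k (z + lift ε 0)) ^ 2 with hT
      have e1 : ∑ k, ∑ i, 2 * (fldD f i k (z + lift ε 0) ^ 2 +
          fld f i (z + lift ε 0) * w2 i k (z + lift ε 0)) = 2 * Q := by
        rw [Finset.sum_comm]
        simp only [← Finset.mul_sum, Finset.sum_add_distrib, hw0 _ _ hz', mul_zero,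
          add_zero, hQ]
      have e2 : ∑ k, (∑ i, 2 * (fld f i (z + lift ε 0) * fldD f i k (z + lift ε 0))) ^ 2 =
          4 * T := by
        simp only [← Finset.mul_sum, mul_pow, hT]
        norm_num
      rw [e1, e2]
      have hQ0 : 0 ≤ Q := Finset.sum_nonneg fun _ _ => Finset.sum_nonneg fun _ _ => sq_nonneg _
      have e3 : (N + 2) * (1 - a) * 2 = (N : ℝ) + 3 := by
        rw [ha, expP]; field_simp; ring
      push_cast at kato
      have h1 : (N + 2 : ℝ) * ((1 - a) * 2 * T) ≤ (N + 2) * (fldSq f (z + lift ε 0) * Q) := by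
        calc _ = ((N + 2) * (1 - a) * 2) * T := by ring
          _ ≤ _ := by rw [e3]; linarith
      have h2 := le_of_mul_le_mul_left h1 (by positivity)
      nlinarith [mul_nonneg hδ.le hQ0]
  have hlim : Tendsto (fun δ : ℝ => ENNReal.ofReal
      (poisA N * ((fldSq f (z + lift ε 0) + δ) ^ a - δ ^ a))) (𝓝[>] 0)
      (𝓝 (ENNReal.ofReal (poisA N * ((fldSq f (z + lift ε 0) + 0) ^ a - 0 ^ a)))) := by
    refine tendsto_nhdsWithin_of_tendsto_nhds (Continuous.tendsto ?_ 0)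
    refine ENNReal.continuous_ofReal.comp (continuous_const.mul (Continuous.sub ?_ ?_))
    · exact (continuous_const.add continuous_id).rpow_const fun _ => Or.inr ha0.le
    · exact continuous_id.rpow_const fun _ => Or.inr ha0.le
  rw [add_zero, Real.zero_rpow ha0.ne', sub_zero] at hlim
  exact le_of_tendsto hlim (eventually_nhdsWithin_of_forall fun δ hδ => key δ hδ)

end Subharmonic

section Majorant

variable {N : ℕ} {f : (Fin N → ℝ) → ℝ} {D : Fin N → (Fin N → ℝ) → ℝ} {z : Fin (N + 1) → ℝ}

/-! ### A harmonic majorant for powers of the gradient below one -/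

/-- Kolmogorov's superharmonic function built from a harmonic function `v` whose gradient is
controlled by the gradients of the harmonic functions `H i ≥ 1`. -/
def kolm {ι : Type*} [Fintype ι] (r C : ℝ) (v : (Fin (N + 1) → ℝ) → ℝ)
    (H : ι → (Fin (N + 1) → ℝ) → ℝ) (z : Fin (N + 1) → ℝ) : ℝ :=
  (v z ^ 2 + ∑ i, H i z ^ 2) ^ (r / 2) + C * ∑ i, H i z ^ r

lemma exists_hasLap_kolm {ι : Type*} [Fintype ι] [Nonempty ι] {r K : ℝ} (hr0 : 0 < r) (hr1 : r < 1)
    (hK : 0 ≤ K) {v : (Fin (N + 1) → ℝ) → ℝ} {v1 v2 : Fin (N + 1) → (Fin (N + 1) → ℝ) → ℝ}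
    {H : ι → (Fin (N + 1) → ℝ) → ℝ} {H1 H2 : ι → Fin (N + 1) → (Fin (N + 1) → ℝ) → ℝ}
    (hv : HasLap v v1 v2) (hH : ∀ i, HasLap (H i) (H1 i) (H2 i))
    (hv0 : ∀ z, 0 < z 0 → ∑ k, v2 k z = 0) (hH0 : ∀ i z, 0 < z 0 → ∑ k, H2 i k z = 0)
    (hpos : ∀ i z, 0 < z 0 → 1 ≤ H i z)
    (hgrad : ∀ z, 0 < z 0 → ∑ k, v1 k z ^ 2 ≤ K * ∑ i, ∑ k, H1 i k z ^ 2) :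
    ∃ Φ1 Φ2, HasLap (kolm r ((K + 1) / (1 - r)) v H) Φ1 Φ2 ∧
      ∀ z, 0 < z 0 → ∑ k, Φ2 k z ≤ 0 := by
  set C := (K + 1) / (1 - r) with hC
  have hρ : ∀ z, 0 < z 0 → 0 < v z ^ 2 + ∑ i, H i z ^ 2 := by
    intro z hz
    have : 0 < ∑ i, H i z ^ 2 := Finset.sum_pos (fun i _ => by
      have := hpos i z hz; positivity) Finset.univ_nonempty
    positivity
  refine ⟨_, _, ((hv.sq.add (HasLap.sum (s := Finset.univ) fun i _ => (hH i).sq)).rpow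
    (r / 2) hρ).add ((HasLap.sum (s := Finset.univ) fun i _ => (hH i).rpow r
      fun z hz => zero_lt_one.trans_le (hpos i z hz)).const_mul C), fun z hz => ?_⟩
  rw [Finset.sum_add_distrib, sum_lap_rpow (hρ z hz), ← Finset.mul_sum, Finset.sum_comm]
  have hsum : ∀ i, ∑ k, r * ((r - 1) * H i z ^ (r - 1 - 1) * H1 i k z ^ 2 +
      H i z ^ (r - 1) * H2 i k z) = -(r * (1 - r) * (H i z ^ (r - 1 - 1) * ∑ k, H1 i k z ^ 2)) := by
    intro i
    have hHi := zero_lt_one.trans_le (hpos i z hz)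
    rw [sum_lap_rpow hHi, hH0 i z hz]
    ring
  simp only [hsum]
  set ρ := v z ^ 2 + ∑ i, H i z ^ 2 with hρd
  have hρ0 : 0 < ρ := hρ z hz
  set M := ∑ i, ∑ k, H1 i k z ^ 2 with hM
  have e1 : ∑ k, (2 * (v1 k z ^ 2 + v z * v2 k z) +
      ∑ i, 2 * (H1 i k z ^ 2 + H i z * H2 i k z)) = 2 * (∑ k, v1 k z ^ 2 + M) := by
    rw [Finset.sum_add_distrib, Finset.sum_comm]
    simp only [← Finset.mul_sum, Finset.sum_add_distrib, hv0 z hz, hH0 _ z hz, mul_zero,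
      add_zero]
    rw [← hM]; ring
  rw [e1]
  have hle : ∀ i, ρ ^ (r / 2 - 1) * ∑ k, H1 i k z ^ 2 ≤
      H i z ^ (r - 1 - 1) * ∑ k, H1 i k z ^ 2 := by
    intro i
    refine mul_le_mul_of_nonneg_right ?_ (Finset.sum_nonneg fun _ _ => sq_nonneg _)
    have hHi := zero_lt_one.trans_le (hpos i z hz)
    have h1 : H i z ^ (r - 1 - 1) = (H i z ^ 2) ^ (r / 2 - 1) := by
      rw [← Real.rpow_natCast, ← Real.rpow_mul hHi.le]
      congr 1
      push_cast
      ring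
    rw [h1]
    refine Real.rpow_le_rpow_of_nonpos (by positivity) ?_ (by linarith)
    have := Finset.single_le_sum (f := fun i => H i z ^ 2) (fun i _ => sq_nonneg _)
      (Finset.mem_univ i)
    linarith [sq_nonneg (v z)]
  have hle2 : ρ ^ (r / 2 - 1) * M ≤ ∑ i, H i z ^ (r - 1 - 1) * ∑ k, H1 i k z ^ 2 := by
    rw [hM, Finset.mul_sum]
    exact Finset.sum_le_sum fun i _ => hle i
  have hC0 : C * (1 - r) = K + 1 := by
    rw [hC, div_mul_cancel₀]
    linarith
  have h2 : C * ∑ i, -(r * (1 - r) * (H i z ^ (r - 1 - 1) * ∑ k, H1 i k z ^ 2)) ≤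
      -(r * (K + 1)) * (ρ ^ (r / 2 - 1) * M) := by
    rw [Finset.sum_neg_distrib, ← Finset.mul_sum]
    have : C * -(r * (1 - r) * ∑ i, H i z ^ (r - 1 - 1) * ∑ k, H1 i k z ^ 2) =
      -(r * (K + 1)) * ∑ i, H i z ^ (r - 1 - 1) * ∑ k, H1 i k z ^ 2 := by rw [← hC0]; ring
    rw [this]
    refine mul_le_mul_of_nonpos_left hle2 ?_
    have : 0 ≤ r * (K + 1) := by positivity
    linarith
  have h3 : r / 2 * ρ ^ (r / 2 - 1 - 1) * (ρ * (2 * (∑ k, v1 k z ^ 2 + M)) -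
      (1 - r / 2) * ∑ k, (2 * (v z * v1 k z) + ∑ i, 2 * (H i z * H1 i k z)) ^ 2) ≤
      (r * (K + 1)) * (ρ ^ (r / 2 - 1) * M) := by
    have e3 : ρ ^ (r / 2 - 1) = ρ ^ (r / 2 - 1 - 1) * ρ := by
      rw [Real.rpow_sub_one hρ0.ne' (r / 2 - 1)]; field_simp
    have hg := hgrad z hz
    have hq : 0 ≤ (1 - r / 2) * ∑ k, (2 * (v z * v1 k z) + ∑ i, 2 * (H i z * H1 i k z)) ^ 2 :=
      mul_nonneg (by linarith) (Finset.sum_nonneg fun _ _ => sq_nonneg _)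
    calc _ ≤ r / 2 * ρ ^ (r / 2 - 1 - 1) * (ρ * (2 * ((K + 1) * M))) := by
          refine mul_le_mul_of_nonneg_left ?_ (by positivity)
          have : ρ * (2 * (∑ k, v1 k z ^ 2 + M)) ≤ ρ * (2 * ((K + 1) * M)) :=
            mul_le_mul_of_nonneg_left (by linarith) hρ0.le
          linarith
      _ = _ := by rw [e3]; ring
  linarith

/-- `1` plus the Poisson integral of the positive or negative part of `g`. -/
def partExt (g : (Fin N → ℝ) → ℝ) (b : Bool) (z : Fin (N + 1) → ℝ) : ℝ :=
  1 + conv (kerField 0) (fun y => max (bif b then g y else -g y) 0) z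

lemma integrable_part {g : (Fin N → ℝ) → ℝ} (hg : Integrable g) (b : Bool) :
    Integrable fun y => max (bif b then g y else -g y) 0 := by
  cases b
  · exact hg.neg.pos_part
  · exact hg.pos_part

lemma conv_part_sub {κ : (Fin (N + 1) → ℝ) → ℝ} (hκ : GoodKer κ) {g : (Fin N → ℝ) → ℝ}
    (hg : Integrable g) (hz : 0 < z 0) :
    conv κ (fun y => max (bif true then g y else -g y) 0) z -
      conv κ (fun y => max (bif false then g y else -g y) 0) z = conv κ g z := by
  unfold conv
  rw [← integral_sub (hκ.integrable (integrable_part hg true) hz)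
    (hκ.integrable (integrable_part hg false) hz)]
  congr 1 with y
  rw [← mul_sub]
  simp [max_zero_sub_max_neg_zero_eq_self]

lemma one_le_partExt (g : (Fin N → ℝ) → ℝ) (b : Bool) (hz : 0 < z 0) : 1 ≤ partExt g b z := by
  have : 0 ≤ conv (kerField 0) (fun y => max (bif b then g y else -g y) 0) z :=
    integral_nonneg fun y =>
      mul_nonneg (kerField_zero_nonneg (by simpa using hz.le)) (le_max_right _ _)
  unfold partExt
  linarith

lemma IsSobolev.sum_fldD_zero_sq_le (hN : 1 ≤ N) (h : IsSobolev f D) (hz : 0 < z 0) :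
    ∑ k, fldD f 0 k z ^ 2 ≤ N * ∑ l : Fin N, ∑ k, fldD f l.succ k z ^ 2 := by
  have h1 := h.sum_fldD hz
  rw [Fin.sum_univ_succ] at h1
  have h2 : fldD f 0 0 z ^ 2 ≤ N * ∑ l : Fin N, fldD f l.succ l.succ z ^ 2 := by
    rw [eq_neg_of_add_eq_zero_left h1, neg_sq]
    have := sq_sum_le_card_mul_sum_sq (s := Finset.univ) (f := fun l : Fin N => fldD f l.succ l.succ z)
    simpa using this
  have h3 : ∑ l : Fin N, fldD f 0 l.succ z ^ 2 ≤ N * ∑ l : Fin N, fldD f l.succ 0 z ^ 2 := by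
    simp only [fldD_comm (f := f) 0 _]
    refine le_mul_of_one_le_left (Finset.sum_nonneg fun _ _ => sq_nonneg _) ?_
    exact_mod_cast hN
  rw [Fin.sum_univ_succ]
  refine (add_le_add h2 h3).trans ?_
  rw [← mul_add, ← Finset.sum_add_distrib]
  refine mul_le_mul_of_nonneg_left (Finset.sum_le_sum fun l _ => ?_) (Nat.cast_nonneg _)
  rw [Fin.sum_univ_succ, add_comm]
  gcongr
  exact Finset.single_le_sum (f := fun k : Fin N => fldD f l.succ k.succ z ^ 2)
    (fun _ _ => sq_nonneg _) (Finset.mem_univ l)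

/-- For exponents `r < 1`, the Poisson integrals of `|∇u|^r` over hyperplanes are bounded by a
function independent of the hyperplane. -/
theorem IsSobolev.exists_majorant (hN : 1 ≤ N) (h : IsSobolev f D) {r : ℝ} (hr0 : 0 < r)
    (hr1 : r < 1) : ∃ Φ : (Fin (N + 1) → ℝ) → ℝ, (∀ z, 0 < z 0 → ContinuousAt Φ z) ∧
      ∀ ε > 0, ∀ z : Fin (N + 1) → ℝ, 0 < z 0 →
        ∫⁻ y, ENNReal.ofReal (kerField 0 (z - lift 0 y) * fldSq f (lift ε y) ^ (r / 2)) ≤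
          ENNReal.ofReal (poisA N * Φ (z + lift ε 0)) := by
  have : Nonempty (Fin N) := ⟨⟨0, hN⟩⟩
  set H : Fin N × Bool → (Fin (N + 1) → ℝ) → ℝ := fun i => partExt (D i.1) i.2 with hHd
  obtain ⟨w2, hw, hw0⟩ := h.hasLap_fld hN 0
  have hHl : ∀ i, HasLap (H i)
      (fun k => conv (kerGrad 0 k) (fun y => max (bif i.2 then D i.1 y else -D i.1 y) 0))
      (fun k => conv (kerHess 0 k k) (fun y => max (bif i.2 then D i.1 y else -D i.1 y) 0)) := by
    intro i
    refine ((hasLap_const 1).add (hasLap_conv hN (integrable_part (h.intD i.1) i.2) 0)).congr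
      (fun _ _ => rfl) ?_ ?_ <;> intros <;> simp
  have hdiff : ∀ l z, 0 < z 0 → fld f l.succ z = H (l, true) z - H (l, false) z := by
    intro l z hz
    rw [h.fld_succ hN l hz, ← conv_part_sub (goodKer_kerField hN 0) (h.intD l) hz]
    simp only [hHd, partExt]
    ring
  have hHone : ∀ i z, 0 < z 0 → 1 ≤ H i z := fun i z hz => one_le_partExt _ _ hz
  set C := (2 * (N : ℝ) + 1) / (1 - r) with hC
  have hC0 : 0 ≤ C := div_nonneg (by positivity) (by linarith)
  have hgrad : ∀ z, 0 < z 0 → ∑ k, fldD f 0 k z ^ 2 ≤ 2 * N * ∑ i : Fin N × Bool, ∑ k,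
      conv (kerGrad 0 k) (fun y => max (bif i.2 then D i.1 y else -D i.1 y) 0) z ^ 2 := by
    intro z hz
    refine (h.sum_fldD_zero_sq_le hN hz).trans ?_
    rw [mul_comm 2 (N : ℝ), mul_assoc]
    refine mul_le_mul_of_nonneg_left ?_ (Nat.cast_nonneg _)
    rw [Fintype.sum_prod_type, Finset.mul_sum]
    refine Finset.sum_le_sum fun l _ => ?_
    rw [Fintype.sum_bool, ← Finset.sum_add_distrib, Finset.mul_sum]
    refine Finset.sum_le_sum fun k _ => ?_
    rw [h.fldD_succ l k hz, ← conv_part_sub (goodKer_kerGrad 0 k) (h.intD l) hz]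
    generalize conv (kerGrad 0 k) _ z = a
    generalize conv (kerGrad 0 k) _ z = b
    nlinarith [sq_nonneg (a + b)]
  obtain ⟨Φ1, Φ2, hΦ, hΦ0⟩ := exists_hasLap_kolm hr0 hr1 (K := 2 * N) (by positivity) hw hHl hw0
    (fun i z hz => sum_conv_kerHess (integrable_part (h.intD i.1) i.2) 0 hz) hHone hgrad
  have hcont : ∀ z, 0 < z 0 → ContinuousAt (kolm r C (fld f 0) H) z := by
    intro z hz
    have hc : ∀ i, ContinuousAt (H i) z := fun i => continuousAt_const.add
      ((goodKer_kerField hN 0).continuousAt_conv (integrable_part (h.intD i.1) i.2) hz)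
    refine ContinuousAt.add (ContinuousAt.rpow_const (ContinuousAt.add
      ((continuousAt_fld h.int 0 hz).pow 2) ?_) (Or.inr (by positivity))) ?_
    · exact tendsto_finsetSum _ fun i _ => (hc i).pow 2
    · exact continuousAt_const.mul
        (tendsto_finsetSum _ fun i _ => (hc i).rpow_const (Or.inr hr0.le))
  have hnn : ∀ z, 0 < z 0 → fldSq f z ^ (r / 2) ≤ kolm r C (fld f 0) H z := by
    intro z hz
    have h1 : 0 ≤ C * ∑ i, H i z ^ r := mul_nonneg hC0 (Finset.sum_nonneg fun i _ =>
      Real.rpow_nonneg (zero_le_one.trans (hHone i z hz)) _)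
    refine le_trans ?_ (le_add_of_nonneg_right h1)
    refine Real.rpow_le_rpow (fldSq_nonneg _) ?_ (by positivity)
    rw [fldSq, Fin.sum_univ_succ, Fintype.sum_prod_type]
    gcongr with l
    rw [Fintype.sum_bool, hdiff l z hz]
    nlinarith [hHone (l, true) z hz, hHone (l, false) z hz]
  refine ⟨_, hcont, fun ε hε z hz => ?_⟩
  have hpos : ∀ z : Fin (N + 1) → ℝ, 0 ≤ z 0 → 0 < (z + lift ε 0 : Fin (N + 1) → ℝ) 0 :=
    fun z hz => by simp; linarith
  have main := lintegral_le_of_superharmonic hN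
    (Φ := fun z => kolm r C (fld f 0) H (z + lift ε 0)) (z := z)
    (fun z hz => ((hcont _ (hpos z hz)).comp (f := fun z => z + lift ε 0)
      (by fun_prop)).continuousWithinAt)
    (fun z hz => (Real.rpow_nonneg (fldSq_nonneg _) _).trans (hnn _ (hpos z hz)))
    (hΦ.shift (by simpa using hε.le)) (fun z hz => hΦ0 _ (hpos z hz.le)) hz
  refine le_trans (lintegral_mono fun y => ENNReal.ofReal_le_ofReal
    (mul_le_mul_of_nonneg_left ?_ (kerField_zero_nonneg (by simpa using hz.le)))) main
  rw [lift_zero_add]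
  exact hnn _ (by simpa using hε)

end Majorant

section Boundary

variable {N : ℕ} {f : (Fin N → ℝ) → ℝ} {D R : Fin N → (Fin N → ℝ) → ℝ} {z : Fin (N + 1) → ℝ}

/-! ### Boundary values -/

/-- The squared length of the boundary value of the gradient field. -/
def bdrySq (D R : Fin N → (Fin N → ℝ) → ℝ) (x : Fin N → ℝ) : ℝ :=
  ((rieszC N)⁻¹ * ∑ j, R j x) ^ 2 + ∑ j, (poisA N * D j x) ^ 2

lemma bdrySq_nonneg (x : Fin N → ℝ) : 0 ≤ bdrySq D R x :=
  add_nonneg (sq_nonneg _) (Finset.sum_nonneg fun _ _ => sq_nonneg _)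

lemma IsSobolev.exists_seq (hN : 1 ≤ N) (h : IsSobolev f D)
    (hr : ∀ j, IsRieszTransform j (D j) (R j)) :
    ∃ ε : ℕ → ℝ, (∀ k, 0 < ε k) ∧ Tendsto ε atTop (𝓝 0) ∧ ∀ᵐ x : Fin N → ℝ,
      Tendsto (fun k => conv (kerField 0) f (lift (ε k) x)) atTop (𝓝 (poisA N * f x)) ∧
      Tendsto (fun k => fldSq f (lift (ε k) x)) atTop (𝓝 (bdrySq D R x)) := by
  have hq := integrable_kerField_zero (N := N) one_pos
  obtain ⟨ε, hε, hε0, hlim⟩ := exists_seq_tendsto_dilate (ι := Unit ⊕ (Fin N ⊕ Fin N))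
    (ψ := Sum.elim (fun _ y => kerField 0 (lift 1 y))
      (Sum.elim (fun _ y => kerField 0 (lift 1 y)) fun j => diffKer j))
    (g := Sum.elim (fun _ => f) (Sum.elim D D))
    (by rintro (i | i | i); exacts [hq, hq, integrable_diffKer i])
    (by rintro (i | i | i); exacts [h.int, h.intD i, h.intD i])
  refine ⟨ε, hε, hε0, ?_⟩
  filter_upwards [hlim, ae_all_iff.2 hr] with x hx hrx
  have e1 := hx (Sum.inl ())
  have e2 := fun j => hx (Sum.inr (Sum.inl j))
  have e3 := fun j => hx (Sum.inr (Sum.inr j))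
  simp only [Sum.elim_inl, Sum.elim_inr] at e1 e2 e3
  refine ⟨?_, ?_⟩
  · simp only [integral_kerField_scale 0 (hε _)]
    exact e1
  · have h0 : Tendsto (fun k => fld f 0 (lift (ε k) x)) atTop
        (𝓝 (-∑ j, (rieszC N)⁻¹ * R j x)) := by
      have : ∀ k, fld f 0 (lift (ε k) x) = -∑ j, conv (kerField j.succ) (D j) (lift (ε k) x) :=
        fun k => h.fld_zero hN (by simpa using hε k)
      simp only [this]
      exact (tendsto_finsetSum _ fun j _ =>
        tendsto_conv_of_riesz hN j (h.intD j) hε hε0 (e3 j) (hrx j)).neg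
    have hs : ∀ j : Fin N, Tendsto (fun k => fld f j.succ (lift (ε k) x)) atTop
        (𝓝 (poisA N * D j x)) := by
      intro j
      have : ∀ k, fld f j.succ (lift (ε k) x) = conv (kerField 0) (D j) (lift (ε k) x) :=
        fun k => h.fld_succ hN j (by simpa using hε k)
      simp only [this, integral_kerField_scale 0 (hε _)]
      exact e2 j
    simp only [fldSq, Fin.sum_univ_succ, bdrySq]
    refine Tendsto.add ?_ (tendsto_finsetSum _ fun j _ => (hs j).pow 2)
    rw [← neg_sq, Finset.mul_sum]
    exact h0.pow 2

lemma rpow_le_min_add {G s t l : ℝ} (hG : 0 ≤ G) (hl : 0 < l) (hs : 0 < s) (hst : s < t) :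
    G ^ s ≤ min (G ^ s) l + l ^ (1 - t / s) * G ^ t := by
  rcases le_or_gt (G ^ s) l with h | h
  · rw [min_eq_left h]
    have := mul_nonneg (Real.rpow_nonneg hl.le (1 - t / s)) (Real.rpow_nonneg hG t)
    linarith
  · have hG0 : 0 < G := by
      refine hG.lt_of_ne fun h0 => ?_
      rw [← h0, Real.zero_rpow hs.ne'] at h
      linarith
    have h1 : (G ^ s) ^ (1 - t / s) ≤ l ^ (1 - t / s) :=
      Real.rpow_le_rpow_of_nonpos hl h.le (sub_nonpos.2 ((one_le_div hs).2 hst.le))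
    have h2 : G ^ s = (G ^ s) ^ (1 - t / s) * G ^ t := by
      rw [← Real.rpow_mul hG, ← Real.rpow_add hG0]
      congr 1
      field_simp
      ring
    have h3 := mul_le_mul_of_nonneg_right h1 (Real.rpow_nonneg hG t)
    have h4 : 0 ≤ min (G ^ s) l := le_min (Real.rpow_nonneg hG s) hl.le
    linarith

theorem IsSobolev.fldSq_rpow_le_bdry (hN : 1 ≤ N) (h : IsSobolev f D)
    (hr : ∀ j, IsRieszTransform j (D j) (R j)) (hz : 0 < z 0) :
    ENNReal.ofReal (poisA N * fldSq f z ^ (expP N / 2)) ≤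
      ∫⁻ y, ENNReal.ofReal (kerField 0 (z - lift 0 y) * bdrySq D R y ^ (expP N / 2)) := by
  obtain ⟨ε, hε, hε0, hlim⟩ := h.exists_seq hN hr
  have hp0 := expP_pos (N := N)
  have hp1 := expP_lt_one (N := N)
  set r := (expP N + 1) / 2 with hrd
  set s := expP N / 2 with hs
  have hs0 : 0 < s := half_pos hp0
  have hsr : s < r / 2 := by rw [hs, hrd]; linarith
  obtain ⟨Φ, hΦc, hΦ⟩ := h.exists_majorant hN (r := r) (by linarith) (by linarith)
  have hq0 : ∀ y, 0 ≤ kerField 0 (z - lift 0 y) :=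
    fun y => kerField_zero_nonneg (by simpa using hz.le)
  have hsh : Tendsto (fun k => z + lift (ε k) 0) atTop (𝓝 z) := by
    have : Continuous fun t : ℝ => z + lift t 0 := by fun_prop
    have h1 := (this.tendsto 0).comp hε0
    have h2 : z + lift 0 0 = z := by
      ext i
      refine Fin.cases ?_ (fun j => ?_) i <;> simp
    rwa [h2] at h1
  obtain ⟨K, hK⟩ : ∃ K : ℝ, ∀ᶠ k in atTop, poisA N * Φ (z + lift (ε k) 0) ≤ K := by
    have h1 := ((hΦc z hz).tendsto.comp hsh).const_mul (poisA N)
    exact ⟨poisA N * Φ z + 1, (h1.eventually (gt_mem_nhds (lt_add_one _))).mono fun k hk => hk.le⟩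
  have hcont : ∀ k, Continuous fun y => fldSq f (lift (ε k) y) := fun k => h.continuous_fldSq (hε k)
  have hqc : Continuous fun y => kerField 0 (z - lift 0 y) :=
    (goodKer_kerField hN 0).continuous_slice hz
  have hL : ∀ l > 0, ENNReal.ofReal (poisA N * fldSq f z ^ s) ≤
      (∫⁻ y, ENNReal.ofReal (kerField 0 (z - lift 0 y) * bdrySq D R y ^ s)) +
        ENNReal.ofReal (l ^ (1 - r / 2 / s) * K) := by
    intro l hl
    have t1 : Tendsto (fun k => ENNReal.ofReal (poisA N * fldSq f (z + lift (ε k) 0) ^ s)) atTop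
        (𝓝 (ENNReal.ofReal (poisA N * fldSq f z ^ s))) := by
      have := ((continuousAt_fldSq h.int hz).tendsto.comp hsh).rpow_const (p := s) (Or.inr hs0.le)
      exact ENNReal.tendsto_ofReal (this.const_mul _)
    have t2 : Tendsto (fun k => ∫⁻ y, ENNReal.ofReal (kerField 0 (z - lift 0 y) *
        min (fldSq f (lift (ε k) y) ^ s) l)) atTop
        (𝓝 (∫⁻ y, ENNReal.ofReal (kerField 0 (z - lift 0 y) * min (bdrySq D R y ^ s) l))) := by
      refine tendsto_lintegral_of_dominated_convergence
        (fun y => ENNReal.ofReal (kerField 0 (z - lift 0 y) * l)) ?_ ?_ ?_ ?_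
      · intro k
        refine (Continuous.measurable ?_).ennreal_ofReal
        exact hqc.mul (((hcont k).rpow_const fun _ => Or.inr hs0.le).min continuous_const)
      · intro k
        exact Eventually.of_forall fun y => ENNReal.ofReal_le_ofReal
          (mul_le_mul_of_nonneg_left (min_le_right _ _) (hq0 y))
      · rw [← ofReal_integral_le_lintegral ((integrable_kerField_zero_sub hz).mul_const l)
          fun y => mul_nonneg (hq0 y) hl.le]
        exact ENNReal.ofReal_ne_top
      · filter_upwards [hlim] with y hy
        exact ENNReal.tendsto_ofReal
          (((hy.2.rpow_const (Or.inr hs0.le)).min tendsto_const_nhds).const_mul _)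
    have t3 : ∀ᶠ k in atTop, ENNReal.ofReal (poisA N * fldSq f (z + lift (ε k) 0) ^ s) ≤
        (∫⁻ y, ENNReal.ofReal (kerField 0 (z - lift 0 y) * min (fldSq f (lift (ε k) y) ^ s) l)) +
          ENNReal.ofReal (l ^ (1 - r / 2 / s) * K) := by
      filter_upwards [hK] with k hk
      refine (h.fldSq_rpow_le hN (hε k) hz).trans ?_
      calc _ ≤ ∫⁻ y, (ENNReal.ofReal (kerField 0 (z - lift 0 y) *
              min (fldSq f (lift (ε k) y) ^ s) l) + ENNReal.ofReal (l ^ (1 - r / 2 / s)) *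
              ENNReal.ofReal (kerField 0 (z - lift 0 y) * fldSq f (lift (ε k) y) ^ (r / 2))) := by
            refine lintegral_mono fun y => ?_
            have hl' := Real.rpow_nonneg hl.le (1 - r / 2 / s)
            have hG := fldSq_nonneg (f := f) (lift (ε k) y)
            rw [← ENNReal.ofReal_mul hl', ← ENNReal.ofReal_add
              (mul_nonneg (hq0 y) (le_min (Real.rpow_nonneg hG s) hl.le))
              (mul_nonneg hl' (mul_nonneg (hq0 y) (Real.rpow_nonneg hG _)))]
            refine ENNReal.ofReal_le_ofReal ?_
            have := mul_le_mul_of_nonneg_left (rpow_le_min_add hG hl hs0 hsr) (hq0 y)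
            refine this.trans (le_of_eq ?_)
            ring
        _ ≤ _ := by
            rw [lintegral_add_left, lintegral_const_mul']
            · refine add_le_add_right ?_ _
              rw [ENNReal.ofReal_mul (Real.rpow_nonneg hl.le _)]
              exact mul_le_mul_right ((hΦ _ (hε k) z hz).trans (ENNReal.ofReal_le_ofReal hk)) _
            · exact ENNReal.ofReal_ne_top
            · refine (Continuous.measurable ?_).ennreal_ofReal
              exact hqc.mul (((hcont k).rpow_const fun _ => Or.inr hs0.le).min continuous_const)
    refine (le_of_tendsto_of_tendsto t1 (t2.add_const _) t3).trans ?_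
    refine add_le_add_left (lintegral_mono fun y => ENNReal.ofReal_le_ofReal
      (mul_le_mul_of_nonneg_left (min_le_left _ _) (hq0 y))) _
  have hlim2 : Tendsto (fun l : ℝ => (∫⁻ y, ENNReal.ofReal (kerField 0 (z - lift 0 y) *
      bdrySq D R y ^ s)) + ENNReal.ofReal (l ^ (1 - r / 2 / s) * K)) atTop
      (𝓝 ((∫⁻ y, ENNReal.ofReal (kerField 0 (z - lift 0 y) * bdrySq D R y ^ s)) +
        ENNReal.ofReal (0 * K))) := by
    refine Tendsto.const_add _ (ENNReal.tendsto_ofReal (Tendsto.mul_const _ ?_))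
    have : 0 < r / 2 / s - 1 := sub_pos.2 ((one_lt_div hs0).2 hsr)
    simpa using tendsto_rpow_neg_atTop this
  rw [zero_mul, ENNReal.ofReal_zero, add_zero] at hlim2
  exact ge_of_tendsto hlim2 ((eventually_gt_atTop 0).mono hL)

end Boundary

section Lorentz

/-! ### Lorentz functionals -/

lemma lintegral_Ioi_comp_mul {c : ℝ} (hc : 0 < c) (F : ℝ → ℝ≥0∞) :
    ∫⁻ s in Ioi (0 : ℝ), F (c * s) = ENNReal.ofReal c⁻¹ * ∫⁻ s in Ioi (0 : ℝ), F s := by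
  have h1 : ∫⁻ s, (Ioi (0 : ℝ)).indicator F (c * s) =
      ENNReal.ofReal c⁻¹ * ∫⁻ s, (Ioi (0 : ℝ)).indicator F s := by
    rw [← (measurableEmbedding_mulLeft₀ hc.ne').lintegral_map, Real.map_volume_mul_left hc.ne',
      lintegral_smul_measure, abs_of_pos (inv_pos.2 hc), smul_eq_mul]
  rw [lintegral_indicator measurableSet_Ioi] at h1
  rw [← h1, ← lintegral_indicator measurableSet_Ioi]
  congr 1 with s
  by_cases hs : 0 < s
  · simp [indicator, hs, mul_pos hc hs]
  · have : ¬ 0 < c * s := fun h => hs (pos_of_mul_pos_right h hc.le)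
    simp only [indicator, mem_Ioi, hs, this, if_false]

lemma lintegral_rpow_lt_le {c : ℝ} (hc : 0 < c) (M : ℝ≥0∞) :
    ∫⁻ t in Ioi (0 : ℝ), (if ENNReal.ofReal t < M then ENNReal.ofReal (t ^ (c - 1)) else 0) ≤
      ENNReal.ofReal (1 / c) * M ^ c := by
  rcases eq_or_ne M ⊤ with rfl | hM
  · rw [ENNReal.top_rpow_of_pos hc, ENNReal.mul_top (by simpa using hc)]
    exact le_top
  set m := M.toReal with hm
  have hm0 : 0 ≤ m := ENNReal.toReal_nonneg
  calc _ ≤ ∫⁻ t in Ioc (0 : ℝ) m, ENNReal.ofReal (t ^ (c - 1)) := by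
        rw [← lintegral_indicator measurableSet_Ioi, ← lintegral_indicator measurableSet_Ioc]
        refine lintegral_mono fun t => ?_
        by_cases ht : 0 < t
        · by_cases hlt : ENNReal.ofReal t < M
          · have : t ≤ m := ((ENNReal.ofReal_lt_iff_lt_toReal ht.le hM).1 hlt).le
            simp [indicator, ht, hlt, this]
          · simp [indicator, hlt]
        · simp [indicator, ht]
    _ = ENNReal.ofReal (∫ t in Ioc (0 : ℝ) m, t ^ (c - 1)) := by
        rw [ofReal_integral_eq_lintegral_ofReal]
        · rw [← IntegrableOn, ← intervalIntegrable_iff_integrableOn_Ioc_of_le hm0]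
          exact intervalIntegral.intervalIntegrable_rpow' (by linarith)
        · filter_upwards [ae_restrict_mem measurableSet_Ioc] with t ht using
            Real.rpow_nonneg ht.1.le _
    _ = _ := by
        rw [← intervalIntegral.integral_of_le hm0, integral_rpow (Or.inl (by linarith)),
          sub_add_cancel, Real.zero_rpow hc.ne', sub_zero, div_eq_inv_mul, one_div,
          ENNReal.ofReal_mul (inv_nonneg.2 hc.le), ← ENNReal.ofReal_rpow_of_nonneg hm0 hc.le,
          ENNReal.ofReal_toReal hM]

variable {α : Type*} [MeasurableSpace α] {μ : Measure α}

/-- The distribution-function form of the Lorentz `L^{1/θ,1}` functional. -/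
def lam (μ : Measure α) (θ : ℝ) (g : α → ℝ≥0∞) : ℝ≥0∞ :=
  ∫⁻ s in Ioi (0 : ℝ), μ {x | ENNReal.ofReal s < g x} ^ θ

lemma measurable_distr (μ : Measure α) (g : α → ℝ≥0∞) :
    Measurable fun s : ℝ => μ {x | ENNReal.ofReal s < g x} :=
  Antitone.measurable fun _ _ hst => measure_mono fun _ hx =>
    (ENNReal.ofReal_le_ofReal hst).trans_lt hx

lemma lintegral_ofReal_lt (a : ℝ≥0∞) :
    ∫⁻ s in Ioi (0 : ℝ), (if ENNReal.ofReal s < a then 1 else 0) = a := by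
  have h1 : ∀ s : ℝ, (if ENNReal.ofReal s < a then (1 : ℝ≥0∞) else 0) =
      {s : ℝ | ENNReal.ofReal s < a}.indicator 1 s := fun s => by simp [indicator]
  have hm : MeasurableSet {s : ℝ | ENNReal.ofReal s < a} :=
    measurableSet_lt ENNReal.measurable_ofReal measurable_const
  simp only [h1]
  rw [lintegral_indicator_one hm, Measure.restrict_apply hm]
  rcases eq_or_ne a ⊤ with rfl | ha
  · simp
  · have : {s : ℝ | ENNReal.ofReal s < a} ∩ Ioi 0 = Ioo 0 a.toReal := by
      ext s
      simp only [mem_inter_iff, mem_ofPred_eq, mem_Ioi, mem_Ioo]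
      constructor
      · rintro ⟨h, hs⟩
        exact ⟨hs, (ENNReal.ofReal_lt_iff_lt_toReal hs.le ha).1 h⟩
      · rintro ⟨hs, h⟩
        exact ⟨(ENNReal.ofReal_lt_iff_lt_toReal hs.le ha).2 h, hs⟩
    rw [this, Real.volume_Ioo, sub_zero, ENNReal.ofReal_toReal ha]

lemma rearr_le (μ : Measure α) (g : α → ℝ≥0∞) (t : ℝ) :
    rearr μ g t ≤ ∫⁻ s in Ioi (0 : ℝ),
      (if ENNReal.ofReal t < μ {x | ENNReal.ofReal s < g x} then 1 else 0) := by
  rw [← lintegral_ofReal_lt (rearr μ g t)]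
  refine lintegral_mono fun s => ?_
  by_cases hs : ENNReal.ofReal s < rearr μ g t
  · have : ENNReal.ofReal t < μ {x | ENNReal.ofReal s < g x} := by
      by_contra! hle
      exact absurd (sInf_le (a := ENNReal.ofReal s) hle) (not_le.2 hs)
    simp [hs, this]
  · simp [hs]

lemma lorentz_le_lam (μ : Measure α) (g : α → ℝ≥0∞) {q : ℝ} (hq : 0 < q) :
    lorentz μ g q 1 ≤ ENNReal.ofReal q * lam μ (1 / q) g := by
  have hmeas : Measurable fun x : ℝ × ℝ => if ENNReal.ofReal x.1 <
      μ {y | ENNReal.ofReal x.2 < g y} then ENNReal.ofReal (x.1 ^ (1 / q - 1)) else 0 := by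
    refine Measurable.ite ?_ (by fun_prop) measurable_const
    exact measurableSet_lt (by fun_prop) ((measurable_distr μ g).comp measurable_snd)
  unfold lorentz
  rw [one_div_one, ENNReal.rpow_one]
  simp only [ENNReal.rpow_one]
  calc _ ≤ ∫⁻ t in Ioi (0 : ℝ), ∫⁻ s in Ioi (0 : ℝ), if ENNReal.ofReal t <
        μ {y | ENNReal.ofReal s < g y} then ENNReal.ofReal (t ^ (1 / q - 1)) else 0 := by
        refine setLIntegral_mono_ae (Measurable.aemeasurable ?_)
          (Eventually.of_forall fun t ht => ?_)
        · exact hmeas.lintegral_prod_right' (ν := volume.restrict (Ioi 0))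
        · have ht : 0 < t := ht
          have e1 : ENNReal.ofReal (t ^ (1 / q)) * rearr μ g t / ENNReal.ofReal t =
              ENNReal.ofReal (t ^ (1 / q - 1)) * rearr μ g t := by
            rw [Real.rpow_sub_one ht.ne', ENNReal.ofReal_div_of_pos ht,
              ENNReal.mul_div_right_comm]
          rw [e1]
          refine (mul_le_mul_right (rearr_le μ g t) _).trans (le_of_eq ?_)
          rw [← lintegral_const_mul' _ _ ENNReal.ofReal_ne_top]
          simp
    _ = ∫⁻ s in Ioi (0 : ℝ), ∫⁻ t in Ioi (0 : ℝ), if ENNReal.ofReal t <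
        μ {y | ENNReal.ofReal s < g y} then ENNReal.ofReal (t ^ (1 / q - 1)) else 0 :=
        lintegral_lintegral_swap hmeas.aemeasurable
    _ ≤ ∫⁻ s in Ioi (0 : ℝ), ENNReal.ofReal q * μ {y | ENNReal.ofReal s < g y} ^ (1 / q) := by
        refine lintegral_mono fun s => ?_
        have := lintegral_rpow_lt_le (c := 1 / q) (by positivity) (μ {y | ENNReal.ofReal s < g y})
        rwa [one_div_one_div] at this
    _ = _ := by rw [lintegral_const_mul' _ _ ENNReal.ofReal_ne_top, lam]

lemma lam_mono_ae {θ : ℝ} (hθ : 0 ≤ θ) {g g' : α → ℝ≥0∞} (h : g ≤ᵐ[μ] g') :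
    lam μ θ g ≤ lam μ θ g' := by
  refine lintegral_mono fun s => ENNReal.rpow_le_rpow (measure_mono_ae ?_) hθ
  filter_upwards [h] with x hx (hs : _ < _) using hs.trans_le hx

lemma tsum_rpow_le {θ : ℝ} (h0 : 0 < θ) (h1 : θ ≤ 1) (a : ℕ → ℝ≥0∞) :
    (∑' j, a j) ^ θ ≤ ∑' j, a j ^ θ := by
  have hfin : ∀ s : Finset ℕ, (∑ j ∈ s, a j) ^ θ ≤ ∑ j ∈ s, a j ^ θ := by
    intro s
    induction s using Finset.induction_on with
    | empty => simp [h0]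
    | insert j s hj ih =>
      rw [Finset.sum_insert hj, Finset.sum_insert hj]
      exact (ENNReal.rpow_add_le_add_rpow _ _ h0.le h1).trans (add_le_add_right ih _)
  have ht := (ENNReal.continuous_rpow_const (y := θ)).tendsto (∑' j, a j) |>.comp
    (ENNReal.summable (f := a)).hasSum
  exact le_of_tendsto ht (Eventually.of_forall fun s => (hfin s).trans (ENNReal.sum_le_tsum s))

lemma lam_iSup_le {θ : ℝ} (h0 : 0 < θ) (h1 : θ ≤ 1) (g : ℕ → α → ℝ≥0∞) :
    lam μ θ (fun x => ⨆ j, g j x) ≤ ∑' j, lam μ θ (g j) := by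
  unfold lam
  rw [← lintegral_tsum fun j => ((measurable_distr μ (g j)).pow_const θ).aemeasurable]
  refine lintegral_mono fun s => le_trans (ENNReal.rpow_le_rpow ?_ h0.le) (tsum_rpow_le h0 h1 _)
  have : {x | ENNReal.ofReal s < ⨆ j, g j x} = ⋃ j, {x | ENNReal.ofReal s < g j x} := by
    ext x
    simp [lt_iSup_iff]
  rw [this]
  exact measure_iUnion_le _

lemma lam_const_mul {θ c : ℝ} (hc : 0 < c) (g : α → ℝ≥0∞) :
    lam μ θ (fun x => ENNReal.ofReal c * g x) = ENNReal.ofReal c * lam μ θ g := by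
  have h := lintegral_Ioi_comp_mul (inv_pos.2 hc) fun s => μ {x | ENNReal.ofReal s < g x} ^ θ
  rw [inv_inv] at h
  rw [lam, lam, ← h]
  refine lintegral_congr fun s => ?_
  congr 2
  ext x
  rw [mem_ofPred_eq, mem_ofPred_eq, ENNReal.ofReal_mul (inv_nonneg.2 hc.le),
    ENNReal.ofReal_inv_of_pos hc, ← ENNReal.div_eq_inv_mul,
    ENNReal.div_lt_iff (by simp [hc]) (by simp), mul_comm]

end Lorentz

section LorentzConvolution

variable {n : ℕ}

/-! ### Lorentz bounds for approximate identities -/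

/-- Convolution of nonnegative functions. -/
def lconv (κ σ : (Fin n → ℝ) → ℝ≥0∞) (y : Fin n → ℝ) : ℝ≥0∞ := ∫⁻ y', κ (y - y') * σ y'

/-- The part of `σ` above level `l`. -/
def above (σ : (Fin n → ℝ) → ℝ≥0∞) (l : ℝ≥0∞) (y : Fin n → ℝ) : ℝ≥0∞ :=
  if l < σ y then σ y else 0

/-- Normalised mass of `σ` above level `l`. -/
def mass (σ : (Fin n → ℝ) → ℝ≥0∞) (l : ℝ≥0∞) : ℝ≥0∞ := l⁻¹ * ∫⁻ y, above σ l y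

lemma measurable_above {σ : (Fin n → ℝ) → ℝ≥0∞} (hσ : Measurable σ) (l : ℝ≥0∞) :
    Measurable (above σ l) :=
  Measurable.ite (measurableSet_lt measurable_const hσ) hσ measurable_const

lemma mass_antitone (σ : (Fin n → ℝ) → ℝ≥0∞) : Antitone (mass σ) := by
  intro l l' hl
  refine mul_le_mul' (ENNReal.inv_le_inv.2 hl) (lintegral_mono fun y => ?_)
  unfold above
  by_cases h : l' < σ y
  · simp [h, hl.trans_lt h]
  · simp [h]

lemma measurable_lconv {κ σ : (Fin n → ℝ) → ℝ≥0∞} (hκ : Measurable κ) (hσ : Measurable σ) :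
    Measurable (lconv κ σ) := by
  have : Measurable fun x : (Fin n → ℝ) × (Fin n → ℝ) => κ (x.1 - x.2) * σ x.2 := by fun_prop
  exact this.lintegral_prod_right'

lemma lintegral_lconv {κ σ : (Fin n → ℝ) → ℝ≥0∞} (hκ : Measurable κ) (hσ : Measurable σ) :
    ∫⁻ y, lconv κ σ y = (∫⁻ y, κ y) * ∫⁻ y, σ y := by
  have hm : Measurable fun x : (Fin n → ℝ) × (Fin n → ℝ) => κ (x.1 - x.2) * σ x.2 := by fun_prop
  unfold lconv
  rw [lintegral_lintegral_swap hm.aemeasurable, ← lintegral_const_mul _ hσ]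
  refine lintegral_congr fun y => ?_
  rw [lintegral_mul_const _ (by fun_prop), lintegral_sub_right_eq_self]

lemma measure_lconv_lt_le {κ σ : (Fin n → ℝ) → ℝ≥0∞} (hκ : Measurable κ) (hσ : Measurable σ)
    {a b T l : ℝ≥0∞} (ha0 : a ≠ 0) (ha : a ≠ ⊤) (hl0 : l ≠ 0) (hl : l ≠ ⊤) (hT0 : T ≠ 0)
    (hT : T ≠ ⊤) (h1 : ∫⁻ y, κ y ≤ a) (h2 : ∀ y, κ y * T ≤ b) :
    volume {y | 2 * a * l < lconv κ σ y} ≤ if a * T < b * mass σ l then mass σ l else 0 := by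
  have hal0 : a * l ≠ 0 := mul_ne_zero ha0 hl0
  have hal : a * l ≠ ⊤ := ENNReal.mul_ne_top ha hl
  have hsub : {y | 2 * a * l < lconv κ σ y} ⊆ {y | a * l < lconv κ (above σ l) y} := by
    intro y hy
    have hle : lconv κ σ y ≤ a * l + lconv κ (above σ l) y := by
      calc lconv κ σ y ≤ ∫⁻ y', (κ (y - y') * l + κ (y - y') * above σ l y') := by
            refine lintegral_mono fun y' => ?_
            rw [← mul_add]
            refine mul_le_mul_right ?_ _
            unfold above
            split_ifs with h
            · exact le_add_self
            · simpa using h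
        _ = (∫⁻ y', κ (y - y')) * l + lconv κ (above σ l) y := by
            rw [lintegral_add_left (by fun_prop), lintegral_mul_const _ (by fun_prop), lconv]
        _ ≤ _ := by
            rw [lintegral_sub_left_eq_self]
            gcongr
    have h3 : a * l + a * l < a * l + lconv κ (above σ l) y := by
      refine lt_of_lt_of_le ?_ hle
      rw [← two_mul, ← mul_assoc]
      exact hy
    exact (ENNReal.add_lt_add_iff_left hal).1 h3
  have hmass : mass σ l * l = ∫⁻ y, above σ l y := by
    rw [mass, mul_comm, ← mul_assoc, ENNReal.mul_inv_cancel hl0 hl, one_mul]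
  split_ifs with hc
  · refine (measure_mono hsub).trans ?_
    refine (measure_mono (t := {y | a * l ≤ lconv κ (above σ l) y}) fun y hy =>
      le_of_lt (α := ℝ≥0∞) hy).trans ?_
    refine (meas_ge_le_lintegral_div (measurable_lconv hκ (measurable_above hσ l)).aemeasurable
      hal0 hal).trans ?_
    rw [lintegral_lconv hκ (measurable_above hσ l), ← hmass]
    refine ENNReal.div_le_of_le_mul ?_
    calc _ ≤ a * (mass σ l * l) := by gcongr
      _ = _ := by ring
  · refine le_of_eq (measure_mono_null hsub ?_)
    convert measure_empty (μ := (volume : Measure (Fin n → ℝ)))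
    refine eq_empty_of_forall_notMem fun y hy => hc ?_
    have hy : a * l < lconv κ (above σ l) y := hy
    have h4 : a * l * T < b * (mass σ l * l) := by
      refine lt_of_lt_of_le ((ENNReal.mul_lt_mul_iff_left hT0 hT).2 hy) ?_
      rw [hmass, ← lintegral_const_mul _ (measurable_above hσ l), lconv,
        ← lintegral_mul_const' _ _ hT]
      refine lintegral_mono fun y' => ?_
      calc _ = κ (y - y') * T * above σ l y' := by ring
        _ ≤ _ := by gcongr; exact h2 _
    rw [show a * l * T = a * T * l by ring, ← mul_assoc] at h4
    exact lt_of_mul_lt_mul_right' h4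

lemma lintegral_mass_le {p : ℝ} (hp0 : 0 < p) (hp1 : p < 1) {a : ℝ≥0∞} (ha0 : a ≠ 0) (ha : a ≠ ⊤)
    {σ : (Fin n → ℝ) → ℝ≥0∞} (hσ : Measurable σ) :
    ∫⁻ s in Ioi (0 : ℝ), mass σ (ENNReal.ofReal s ^ p / (2 * a)) ≤
      ENNReal.ofReal (1 / (1 - p)) * (2 * a) ^ (1 / p) * ∫⁻ y, σ y ^ (1 / p) := by
  have h2a0 : 2 * a ≠ 0 := mul_ne_zero two_ne_zero ha0
  have h2a : 2 * a ≠ ⊤ := ENNReal.mul_ne_top (by simp) ha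
  have hm : Measurable fun x : ℝ × (Fin n → ℝ) => if ENNReal.ofReal x.1 < (2 * a * σ x.2) ^ (1 / p)
      then ENNReal.ofReal (x.1 ^ ((1 - p) - 1)) * (2 * a * σ x.2) else 0 := by
    refine Measurable.ite (measurableSet_lt ?_ ?_) ?_ measurable_const <;> fun_prop
  calc _ ≤ ∫⁻ s in Ioi (0 : ℝ), ∫⁻ y, if ENNReal.ofReal s < (2 * a * σ y) ^ (1 / p)
        then ENNReal.ofReal (s ^ ((1 - p) - 1)) * (2 * a * σ y) else 0 := by
        refine setLIntegral_mono_ae (Measurable.aemeasurable hm.lintegral_prod_right')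
          (Eventually.of_forall fun s hs => ?_)
        have hs : 0 < s := hs
        rw [mass, ← lintegral_const_mul _ (measurable_above hσ _)]
        refine lintegral_mono fun y => ?_
        have hsp0 : ENNReal.ofReal s ^ p ≠ 0 := by simp [ENNReal.rpow_eq_zero_iff, hs]
        have hsp : ENNReal.ofReal s ^ p ≠ ⊤ := ENNReal.rpow_ne_top_of_nonneg hp0.le (by simp)
        unfold above
        by_cases h : ENNReal.ofReal s ^ p / (2 * a) < σ y
        · have h' : ENNReal.ofReal s < (2 * a * σ y) ^ (1 / p) := by
            rw [one_div, ENNReal.lt_rpow_inv_iff hp0]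
            rwa [ENNReal.div_lt_iff (Or.inl h2a0) (Or.inl h2a), mul_comm] at h
          simp only [h, h', if_true]
          rw [ENNReal.inv_div (Or.inl h2a) (Or.inl h2a0), sub_sub_cancel_left,
            ← ENNReal.ofReal_rpow_of_pos hs, ENNReal.rpow_neg, div_eq_mul_inv]
          exact le_of_eq (by ring)
        · simp [h]
    _ = ∫⁻ y, ∫⁻ s in Ioi (0 : ℝ), if ENNReal.ofReal s < (2 * a * σ y) ^ (1 / p)
        then ENNReal.ofReal (s ^ ((1 - p) - 1)) * (2 * a * σ y) else 0 :=
        lintegral_lintegral_swap hm.aemeasurable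
    _ ≤ ∫⁻ y, ENNReal.ofReal (1 / (1 - p)) * (2 * a) ^ (1 / p) * σ y ^ (1 / p) := by
        refine lintegral_mono fun y => ?_
        have e1 : ∀ s : ℝ, (if ENNReal.ofReal s < (2 * a * σ y) ^ (1 / p)
            then ENNReal.ofReal (s ^ ((1 - p) - 1)) * (2 * a * σ y) else 0) =
            (if ENNReal.ofReal s < (2 * a * σ y) ^ (1 / p)
            then ENNReal.ofReal (s ^ ((1 - p) - 1)) else 0) * (2 * a * σ y) := by
          intro s
          split_ifs <;> simp
        simp only [e1]
        rw [lintegral_mul_const]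
        · refine (mul_le_mul_left (lintegral_rpow_lt_le (sub_pos.2 hp1) _) _).trans (le_of_eq ?_)
          have e2 : ((2 * a * σ y) ^ (1 / p)) ^ (1 - p) * (2 * a * σ y) =
              (2 * a) ^ (1 / p) * σ y ^ (1 / p) := by
            rw [← ENNReal.mul_rpow_of_nonneg _ _ (by positivity : 0 ≤ 1 / p), ← ENNReal.rpow_mul]
            generalize 2 * a * σ y = w
            nth_rewrite 2 [← ENNReal.rpow_one w]
            rw [← ENNReal.rpow_add_of_nonneg _ _
              (mul_nonneg (by positivity) (by linarith)) zero_le_one]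
            congr 1
            field_simp
            ring
          rw [mul_assoc (ENNReal.ofReal _), e2, ← mul_assoc]
        · exact Measurable.ite (measurableSet_lt (by fun_prop) measurable_const) (by fun_prop)
            measurable_const
    _ = _ := lintegral_const_mul' _ _ (ENNReal.mul_ne_top ENNReal.ofReal_ne_top
        (ENNReal.rpow_ne_top_of_nonneg (by positivity) h2a))

theorem lintegral_lam_lconv_le (hn : 1 ≤ n) {p θ c : ℝ} (hp0 : 0 < p) (hp1 : p < 1) (hθ : 0 < θ)
    (hc : 0 < c) (hθc : θ + c / n = 1) {a b : ℝ≥0∞} (ha0 : a ≠ 0) (ha : a ≠ ⊤) (hb : b ≠ ⊤)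
    {κ : ℝ → (Fin n → ℝ) → ℝ≥0∞} (hκ : ∀ t > 0, Measurable (κ t))
    (hκ1 : ∀ t > 0, ∫⁻ y, κ t y ≤ a)
    (hκ2 : ∀ t > 0, ∀ y, κ t y * ENNReal.ofReal t ^ (n : ℝ) ≤ b)
    {σ : (Fin n → ℝ) → ℝ≥0∞} (hσ : Measurable σ) :
    ∫⁻ t in Ioi (0 : ℝ), ENNReal.ofReal (t ^ (c - 1)) *
        lam volume θ (fun y => lconv (κ t) σ y ^ (1 / p)) ≤
      ENNReal.ofReal (1 / c) * (b / a) ^ (c / n) *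
        (ENNReal.ofReal (1 / (1 - p)) * (2 * a) ^ (1 / p) * ∫⁻ y, σ y ^ (1 / p)) := by
  have hn0 : (0 : ℝ) < n := by exact_mod_cast hn
  have h2a0 : 2 * a ≠ 0 := mul_ne_zero two_ne_zero ha0
  have h2a : 2 * a ≠ ⊤ := ENNReal.mul_ne_top (by simp) ha
  set m : ℝ → ℝ≥0∞ := fun s => mass σ (ENNReal.ofReal s ^ p / (2 * a)) with hm
  have hmm : Measurable m := Antitone.measurable fun s s' hs => mass_antitone σ
    (ENNReal.div_le_div_right (ENNReal.rpow_le_rpow (ENNReal.ofReal_le_ofReal hs) hp0.le) _)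
  have hmeas : Measurable fun x : ℝ × ℝ => if ENNReal.ofReal x.1 < (b / a * m x.2) ^ (1 / (n : ℝ))
      then ENNReal.ofReal (x.1 ^ (c - 1)) * m x.2 ^ θ else 0 := by
    refine Measurable.ite (measurableSet_lt ?_ ?_) ?_ measurable_const <;> fun_prop
  have hba : b / a ≠ ⊤ := ENNReal.div_ne_top hb ha0
  calc _ ≤ ∫⁻ t in Ioi (0 : ℝ), ∫⁻ s in Ioi (0 : ℝ),
        if ENNReal.ofReal t < (b / a * m s) ^ (1 / (n : ℝ))
        then ENNReal.ofReal (t ^ (c - 1)) * m s ^ θ else 0 := by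
        refine setLIntegral_mono_ae (Measurable.aemeasurable
          (hmeas.lintegral_prod_right' (ν := volume.restrict (Ioi 0))))
          (Eventually.of_forall fun t ht => ?_)
        have ht : 0 < t := ht
        rw [lam, ← lintegral_const_mul' _ _ ENNReal.ofReal_ne_top]
        refine setLIntegral_mono_ae ((hmeas.comp (measurable_const.prodMk
          measurable_id)).aemeasurable) (Eventually.of_forall fun s hs => ?_)
        have hs : 0 < s := hs
        have hset : {y | ENNReal.ofReal s < lconv (κ t) σ y ^ (1 / p)} =
            {y | 2 * a * (ENNReal.ofReal s ^ p / (2 * a)) < lconv (κ t) σ y} := by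
          ext y
          rw [mem_ofPred_eq, mem_ofPred_eq, one_div, ENNReal.lt_rpow_inv_iff hp0,
            ENNReal.mul_div_cancel h2a0 h2a]
        have hsp0 : ENNReal.ofReal s ^ p ≠ 0 := by simp [ENNReal.rpow_eq_zero_iff, hs]
        have hsp : ENNReal.ofReal s ^ p ≠ ⊤ := ENNReal.rpow_ne_top_of_nonneg hp0.le (by simp)
        have key := measure_lconv_lt_le (hκ t ht) hσ (l := ENNReal.ofReal s ^ p / (2 * a)) ha0 ha
          (ENNReal.div_ne_zero.2 ⟨hsp0, h2a⟩) (ENNReal.div_ne_top hsp h2a0)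
          (T := ENNReal.ofReal t ^ (n : ℝ)) (by simp [ht])
          (ENNReal.rpow_ne_top_of_nonneg hn0.le (by simp)) (hκ1 t ht) (hκ2 t ht)
        rw [hset]
        change _ ≤ if _ < b * m s then m s else 0 at key
        by_cases hlt : a * ENNReal.ofReal t ^ (n : ℝ) < b * m s
        · have h' : ENNReal.ofReal t < (b / a * m s) ^ (1 / (n : ℝ)) := by
            rw [one_div, ENNReal.lt_rpow_inv_iff hn0, ← ENNReal.mul_div_right_comm,
              ENNReal.lt_div_iff_mul_lt (Or.inl ha0) (Or.inl ha), mul_comm]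
            exact hlt
          rw [if_pos hlt] at key
          rw [if_pos h']
          gcongr
        · rw [if_neg hlt, nonpos_iff_eq_zero] at key
          rw [key, ENNReal.zero_rpow_of_pos hθ, mul_zero]
          exact zero_le
    _ = ∫⁻ s in Ioi (0 : ℝ), ∫⁻ t in Ioi (0 : ℝ),
        if ENNReal.ofReal t < (b / a * m s) ^ (1 / (n : ℝ))
        then ENNReal.ofReal (t ^ (c - 1)) * m s ^ θ else 0 :=
        lintegral_lintegral_swap hmeas.aemeasurable
    _ ≤ ∫⁻ s in Ioi (0 : ℝ), ENNReal.ofReal (1 / c) * (b / a) ^ (c / n) * m s := by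
        refine lintegral_mono fun s => ?_
        have e1 : ∀ t : ℝ, (if ENNReal.ofReal t < (b / a * m s) ^ (1 / (n : ℝ))
            then ENNReal.ofReal (t ^ (c - 1)) * m s ^ θ else 0) =
            (if ENNReal.ofReal t < (b / a * m s) ^ (1 / (n : ℝ))
            then ENNReal.ofReal (t ^ (c - 1)) else 0) * m s ^ θ := by
          intro t
          split_ifs <;> simp
        simp only [e1]
        rw [lintegral_mul_const]
        · refine (mul_le_mul_left (lintegral_rpow_lt_le hc _) _).trans (le_of_eq ?_)
          rw [← ENNReal.rpow_mul, one_div_mul_eq_div, ENNReal.mul_rpow_of_nonneg _ _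
            (by positivity : 0 ≤ c / n), mul_assoc, mul_assoc, mul_assoc,
            ← ENNReal.rpow_add_of_nonneg _ _ (by positivity) hθ.le, add_comm (c / n), hθc,
            ENNReal.rpow_one]
        · exact Measurable.ite (measurableSet_lt (by fun_prop) measurable_const) (by fun_prop)
            measurable_const
    _ ≤ _ := by
        rw [lintegral_const_mul' _ _ (ENNReal.mul_ne_top ENNReal.ofReal_ne_top
          (ENNReal.rpow_ne_top_of_nonneg (by positivity) hba))]
        exact mul_le_mul_right (lintegral_mass_le hp0 hp1 ha0 ha hσ) _

end LorentzConvolution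

/-! ### Minkowski's integral inequality -/

section Minkowski

variable {α β : Type*} [MeasurableSpace α] [MeasurableSpace β] {μ : Measure α} {ν : Measure β}

lemma lintegral_rpow_le_of_le [SFinite μ] [SFinite ν] {ω : ℝ} (hω : 1 < ω) {F : α → β → ℝ≥0∞}
    (hF : Measurable (Function.uncurry F)) {G : β → ℝ≥0∞} (hG : Measurable G)
    (hGF : ∀ s, G s ≤ ∫⁻ a, F a s ∂μ) (hfin : ∫⁻ s, G s ^ ω ∂ν ≠ ⊤) :
    ∫⁻ s, G s ^ ω ∂ν ≤ (∫⁻ a, (∫⁻ s, F a s ^ ω ∂ν) ^ (1 / ω) ∂μ) ^ ω := by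
  have hω0 : 0 < ω := by linarith
  set X := ∫⁻ s, G s ^ ω ∂ν with hX
  set I := ∫⁻ a, (∫⁻ s, F a s ^ ω ∂ν) ^ (1 / ω) ∂μ with hI
  have hconj := (Real.HolderConjugate.conjExponent hω).symm
  set ω' := ω.conjExponent with hω'
  have hexp : (ω - 1) * ω' = ω := hconj.symm.sub_one_mul_conj
  have hinv : 1 / ω' = 1 - 1 / ω := by
    have := hconj.inv_add_inv_eq_one
    rw [one_div, one_div]
    linarith
  have hswap : Measurable fun x : β × α => F x.2 x.1 := hF.comp measurable_swap
  have hFa : ∀ a, Measurable (F a) := fun a => hF.comp (measurable_const.prodMk measurable_id)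
  have key : X ≤ X ^ (1 / ω') * I := by
    calc X = ∫⁻ s, G s ^ (ω - 1) * G s ∂ν := by
          refine lintegral_congr fun s => ?_
          nth_rewrite 3 [← ENNReal.rpow_one (G s)]
          rw [← ENNReal.rpow_add_of_nonneg _ _ (by linarith) zero_le_one, sub_add_cancel]
      _ ≤ ∫⁻ s, ∫⁻ a, G s ^ (ω - 1) * F a s ∂μ ∂ν := by
          refine lintegral_mono fun s => ?_
          rw [lintegral_const_mul (f := fun a => F a s) _
            (hF.comp (measurable_id.prodMk measurable_const))]
          exact mul_le_mul_right (hGF s) _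
      _ = ∫⁻ a, ∫⁻ s, G s ^ (ω - 1) * F a s ∂ν ∂μ := by
          refine lintegral_lintegral_swap (Measurable.aemeasurable ?_)
          exact ((hG.comp measurable_fst).pow_const _).mul hswap
      _ ≤ ∫⁻ a, X ^ (1 / ω') * (∫⁻ s, F a s ^ ω ∂ν) ^ (1 / ω) ∂μ := by
          refine lintegral_mono fun a => ?_
          refine (ENNReal.lintegral_mul_le_Lp_mul_Lq ν hconj
            (hG.pow_const _).aemeasurable (hFa a).aemeasurable).trans (le_of_eq ?_)
          congr 2
          refine lintegral_congr fun s => ?_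
          rw [← ENNReal.rpow_mul, hexp]
      _ = _ := by
          rw [lintegral_const_mul]
          refine Measurable.pow_const ?_ _
          exact (hF.pow_const ω).lintegral_prod_right'
  rcases eq_or_ne X 0 with h0 | h0
  · rw [h0]
    exact zero_le
  have h1 : X ^ (1 / ω) ≤ I := by
    have h2 : X = X ^ (1 / ω') * X ^ (1 / ω) := by
      rw [← ENNReal.rpow_add _ _ h0 hfin, hinv, sub_add_cancel, ENNReal.rpow_one]
    have hp : 0 ≤ 1 / ω' := hconj.one_div_nonneg
    have h3 : X ^ (1 / ω') ≠ 0 := by simp [ENNReal.rpow_eq_zero_iff, h0, hfin]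
    have h4 : X ^ (1 / ω') ≠ ⊤ := ENNReal.rpow_ne_top_of_nonneg hp hfin
    have h5 : X ^ (1 / ω') * X ^ (1 / ω) ≤ X ^ (1 / ω') * I := h2 ▸ key
    exact (ENNReal.mul_le_mul_iff_right h3 h4).1 h5
  rwa [one_div, ENNReal.rpow_inv_le_iff hω0] at h1

theorem lintegral_rpow_lintegral_le [SFinite μ] [SigmaFinite ν] {ω : ℝ} (hω : 1 < ω)
    {F : α → β → ℝ≥0∞} (hF : Measurable (Function.uncurry F)) :
    ∫⁻ s, (∫⁻ a, F a s ∂μ) ^ ω ∂ν ≤ (∫⁻ a, (∫⁻ s, F a s ^ ω ∂ν) ^ (1 / ω) ∂μ) ^ ω := by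
  have hω0 : 0 < ω := by linarith
  set K : β → ℝ≥0∞ := fun s => ∫⁻ a, F a s ∂μ with hK
  have hKm : Measurable K := (hF.comp measurable_swap).lintegral_prod_right'
  set G : ℕ → β → ℝ≥0∞ := fun m => (spanningSets ν m).indicator fun s => min (K s) m with hG
  have hGm : ∀ m, Measurable (G m) := fun m =>
    (hKm.min measurable_const).indicator (measurableSet_spanningSets ν m)
  have hGmono : Monotone G := by
    intro m m' hm s
    refine (indicator_le_indicator_of_subset (monotone_spanningSets ν hm) (fun _ => zero_le) s).trans
      (indicator_le_indicator ?_)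
    exact min_le_min_left _ (by exact_mod_cast hm)
  have hGK : ∀ s, ⨆ m, G m s ^ ω = K s ^ ω := by
    intro s
    refine le_antisymm (iSup_le fun m => ENNReal.rpow_le_rpow ?_ hω0.le) ?_
    · exact (indicator_le_self _ _ s).trans (min_le_left _ _)
    · have ht : Tendsto (fun m => G m s ^ ω) atTop (𝓝 (K s ^ ω)) := by
        have h1 : Tendsto (fun m : ℕ => (min (K s) m) ^ ω) atTop (𝓝 ((min (K s) ⊤) ^ ω)) :=
          (ENNReal.continuous_rpow_const.tendsto _).comp
            (tendsto_const_nhds.min ENNReal.tendsto_nat_nhds_top)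
        rw [min_top_right] at h1
        refine h1.congr' ?_
        filter_upwards [eventually_ge_atTop (spanningSetsIndex ν s)] with m hm
        simp only [hG]
        rw [indicator_of_mem]
        exact monotone_spanningSets ν hm (mem_spanningSetsIndex ν s)
      exact le_of_tendsto' ht fun m => le_iSup (fun m => G m s ^ ω) m
  calc _ = ∫⁻ s, ⨆ m, G m s ^ ω ∂ν := lintegral_congr fun s => (hGK s).symm
    _ = ⨆ m, ∫⁻ s, G m s ^ ω ∂ν := lintegral_iSup (fun m => (hGm m).pow_const _)
        fun m m' hm s => ENNReal.rpow_le_rpow (hGmono hm s) hω0.le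
    _ ≤ _ := by
        refine iSup_le fun m => lintegral_rpow_le_of_le hω hF (hGm m)
          (fun s => (indicator_le_self _ _ s).trans (min_le_left _ _)) ?_
        refine ne_top_of_le_ne_top ?_ (lintegral_mono (g := (spanningSets ν m).indicator
          fun _ => (m : ℝ≥0∞) ^ ω) fun s => ?_)
        · rw [lintegral_indicator (measurableSet_spanningSets ν m), setLIntegral_const]
          exact ENNReal.mul_ne_top (ENNReal.rpow_ne_top_of_nonneg hω0.le (by simp))
            (measure_spanningSets_lt_top ν m).ne
        · simp only [hG]
          by_cases hs : s ∈ spanningSets ν m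
          · simp only [indicator_of_mem hs]
            exact ENNReal.rpow_le_rpow (min_le_right _ _) hω0.le
          · simp [indicator_of_notMem hs, hω0]

end Minkowski

/-! ### Slices of the Poisson kernel -/

section Slice

variable {n : ℕ}

lemma normSq_insertNth (k : Fin (n + 1)) (s : ℝ) (y : Fin n → ℝ) :
    normSq (k.insertNth s y : Fin (n + 1) → ℝ) = s ^ 2 + normSq y := by
  simp [normSq, Fin.sum_univ_succAbove _ k]

lemma insertNth_sub_insertNth (k : Fin (n + 1)) (s s' : ℝ) (y y' : Fin n → ℝ) :
    (k.insertNth s y : Fin (n + 1) → ℝ) - k.insertNth s' y' = k.insertNth (s - s') (y - y') := by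
  ext i
  refine Fin.succAboveCases k ?_ (fun j => ?_) i <;> simp

lemma measurable_insertNth (k : Fin (n + 1)) :
    Measurable fun x : (Fin n → ℝ) × ℝ => (k.insertNth x.2 x.1 : Fin (n + 1) → ℝ) := by
  refine measurable_pi_iff.2 fun i => ?_
  refine Fin.succAboveCases k ?_ (fun j => ?_) i
  · simpa using measurable_snd
  · simp only [Fin.insertNth_apply_succAbove]
    fun_prop

lemma lintegral_insertNth (k : Fin (n + 1)) {F : (Fin (n + 1) → ℝ) → ℝ≥0∞} (hF : Measurable F) :
    ∫⁻ y : Fin n → ℝ, ∫⁻ s : ℝ, F (k.insertNth s y) = ∫⁻ x, F x := by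
  have hmp := (volume_preserving_piFinSuccAbove (fun _ : Fin (n + 1) => ℝ) k).symm
  rw [← hmp.lintegral_comp hF, Measure.volume_eq_prod,
    lintegral_prod_symm' (fun a => F ((MeasurableEquiv.piFinSuccAbove (fun _ => ℝ) k).symm a))
      (hF.comp (MeasurableEquiv.measurable _))]
  rfl

/-- The Poisson kernel (unnormalised) in split variables. -/
def pois (t : ℝ) (y : Fin n → ℝ) (s : ℝ) : ℝ≥0∞ :=
  ENNReal.ofReal (t * (t ^ 2 + (s ^ 2 + normSq y)) ^ (-(((n + 2 : ℕ) : ℝ) / 2)))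

/-- The Poisson kernel integrated along one variable. -/
def sliceKer (t : ℝ) (y : Fin n → ℝ) : ℝ≥0∞ := ∫⁻ s, pois t y s

lemma measurable_pois (t : ℝ) : Measurable fun x : (Fin n → ℝ) × ℝ => pois t x.1 x.2 := by
  have := (continuous_normSq (m := n)).measurable
  unfold pois
  fun_prop

lemma measurable_sliceKer (t : ℝ) : Measurable (sliceKer t : (Fin n → ℝ) → ℝ≥0∞) :=
  (measurable_pois t).lintegral_prod_right'

lemma ofReal_kerField_insertNth (k : Fin (n + 1)) (t s : ℝ) (y : Fin n → ℝ) :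
    ENNReal.ofReal (kerField 0 (lift t (k.insertNth s y : Fin (n + 1) → ℝ))) = pois t y s := by
  rw [kerField_zero_lift, normSq_lift, normSq_insertNth, pois]

lemma lintegral_sliceKer {t : ℝ} (ht : 0 < t) :
    ∫⁻ y : Fin n → ℝ, sliceKer t y = ENNReal.ofReal (poisA (n + 1)) := by
  have hm : Measurable fun x : Fin (n + 1) → ℝ => ENNReal.ofReal (kerField 0 (lift t x)) :=
    (continuous_kerField_lift 0 ht).measurable.ennreal_ofReal
  have h := lintegral_insertNth 0 hm
  simp only [ofReal_kerField_insertNth] at h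
  unfold sliceKer
  rw [h, ← ofReal_integral_le_lintegral (integrable_kerField_zero ht)
    fun x => kerField_zero_nonneg (by simpa using ht.le)]
  congr 1
  have h2 := integral_kerField_zero (N := n + 1) (z := lift t 0) (by simpa using ht)
  rw [← h2]
  simp only [lift_sub_lift, sub_zero, zero_sub]
  exact (integral_neg_eq_self (fun x => kerField 0 (lift t x)) volume).symm

lemma sliceKer_mul_le {t : ℝ} (ht : 0 < t) (y : Fin n → ℝ) :
    sliceKer t y * ENNReal.ofReal t ^ (n : ℝ) ≤ ENNReal.ofReal Real.pi := by
  have hpi : ∫⁻ s : ℝ, ENNReal.ofReal (t⁻¹ * (1 + (t⁻¹ * s) ^ 2)⁻¹) =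
      ENNReal.ofReal Real.pi := by
    have hi : Integrable fun s : ℝ => t⁻¹ * (1 + (t⁻¹ * s) ^ 2)⁻¹ :=
      (integrable_inv_one_add_sq.comp_mul_left' (inv_pos.2 ht).ne').const_mul _
    rw [← ofReal_integral_le_lintegral hi (fun s => by positivity), integral_const_mul,
      Measure.integral_comp_mul_left (fun s : ℝ => (1 + s ^ 2)⁻¹), integral_univ_inv_one_add_sq,
      inv_inv, abs_of_pos ht, smul_eq_mul, ← mul_assoc, inv_mul_cancel₀ ht.ne', one_mul]
  rw [sliceKer, ← lintegral_mul_const' _ _ (ENNReal.rpow_ne_top_of_nonneg (by positivity) (by simp)),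
    ← hpi]
  refine lintegral_mono fun s => ?_
  rw [pois, ENNReal.ofReal_rpow_of_pos ht, ← ENNReal.ofReal_mul (by
    have := normSq_nonneg y; positivity)]
  refine ENNReal.ofReal_le_ofReal ?_
  have hy := normSq_nonneg y
  have h1 : (t ^ 2 + (s ^ 2 + normSq y)) ^ (-(((n + 2 : ℕ) : ℝ) / 2)) ≤
      (t ^ (n : ℝ))⁻¹ * (t ^ 2 + s ^ 2)⁻¹ := by
    calc _ ≤ (t ^ 2 + s ^ 2) ^ (-(((n + 2 : ℕ) : ℝ) / 2)) :=
          Real.rpow_le_rpow_of_nonpos (by positivity) (by linarith)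
            (by simp only [Left.neg_nonpos_iff]; positivity)
      _ = (t ^ 2 + s ^ 2) ^ (-((n : ℝ) / 2)) * (t ^ 2 + s ^ 2)⁻¹ := by
          rw [← Real.rpow_neg_one (t ^ 2 + s ^ 2), ← Real.rpow_add (by positivity)]
          congr 1
          push_cast
          ring
      _ ≤ _ := by
          gcongr
          calc _ ≤ (t ^ 2) ^ (-((n : ℝ) / 2)) :=
                Real.rpow_le_rpow_of_nonpos (by positivity) (by nlinarith)
                  (by simp only [Left.neg_nonpos_iff]; positivity)
            _ = _ := by
                rw [← Real.rpow_natCast t 2, ← Real.rpow_mul ht.le, ← Real.rpow_neg ht.le]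
                congr 1
                push_cast
                ring
  calc t * (t ^ 2 + (s ^ 2 + normSq y)) ^ (-(((n + 2 : ℕ) : ℝ) / 2)) * t ^ (n : ℝ)
      ≤ t * ((t ^ (n : ℝ))⁻¹ * (t ^ 2 + s ^ 2)⁻¹) * t ^ (n : ℝ) := by gcongr
    _ = _ := by
        have : t ^ (n : ℝ) ≠ 0 := (Real.rpow_pos_of_pos ht _).ne'
        field_simp

lemma sliceKer_le_of_le {t T : ℝ} (hT : 0 < T) (h1 : T / 2 ≤ t) (h2 : t ≤ T) (y : Fin n → ℝ) :
    sliceKer t y ≤ 2 ^ (n + 2) * sliceKer T y := by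
  rw [sliceKer, sliceKer, ← lintegral_const_mul' _ _ (by simp)]
  refine lintegral_mono fun s => ?_
  have hy := normSq_nonneg y
  rw [pois, pois, show (2 : ℝ≥0∞) ^ (n + 2) = ENNReal.ofReal (2 ^ (n + 2)) by
    rw [ENNReal.ofReal_pow (by norm_num)]; simp, ← ENNReal.ofReal_mul (by positivity)]
  refine ENNReal.ofReal_le_ofReal ?_
  have h3 : (t ^ 2 + (s ^ 2 + normSq y)) ^ (-(((n + 2 : ℕ) : ℝ) / 2)) ≤
      2 ^ (n + 2) * (T ^ 2 + (s ^ 2 + normSq y)) ^ (-(((n + 2 : ℕ) : ℝ) / 2)) := by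
    calc _ ≤ ((1 / 4) * (T ^ 2 + (s ^ 2 + normSq y))) ^ (-(((n + 2 : ℕ) : ℝ) / 2)) :=
          Real.rpow_le_rpow_of_nonpos (by positivity) (by nlinarith [sq_nonneg s])
            (by simp only [Left.neg_nonpos_iff]; positivity)
      _ = _ := by
          rw [Real.mul_rpow (by norm_num) (by positivity)]
          congr 1
          rw [show (1 / 4 : ℝ) = 2 ^ (-2 : ℝ) by
            rw [Real.rpow_neg (by norm_num)]; norm_num, ← Real.rpow_mul (by norm_num),
            ← Real.rpow_natCast]
          congr 1
          ring
  calc _ ≤ T * (2 ^ (n + 2) * (T ^ 2 + (s ^ 2 + normSq y)) ^ (-(((n + 2 : ℕ) : ℝ) / 2))) := by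
        gcongr
    _ = _ := by ring

/-- The `L^p`-mean density of the slices of `b`. -/
def sliceMean (p : ℝ) (k : Fin (n + 1)) (b : (Fin (n + 1) → ℝ) → ℝ≥0∞) (y : Fin n → ℝ) : ℝ≥0∞ :=
  (∫⁻ s, b (k.insertNth s y)) ^ p

lemma measurable_sliceMean (p : ℝ) (k : Fin (n + 1)) {b : (Fin (n + 1) → ℝ) → ℝ≥0∞}
    (hb : Measurable b) : Measurable (sliceMean p k b) :=
  ((hb.comp (measurable_insertNth k)).lintegral_prod_right').pow_const p

lemma lintegral_sliceMean {p : ℝ} (hp : 0 < p) (k : Fin (n + 1))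
    {b : (Fin (n + 1) → ℝ) → ℝ≥0∞} (hb : Measurable b) :
    ∫⁻ y, sliceMean p k b y ^ (1 / p) = ∫⁻ x, b x := by
  rw [← lintegral_insertNth k hb]
  refine lintegral_congr fun y => ?_
  rw [sliceMean, ← ENNReal.rpow_mul, mul_one_div_cancel hp.ne', ENNReal.rpow_one]

lemma lintegral_slice_le {p t : ℝ} (hp0 : 0 < p) (hp1 : p < 1) {a : ℝ≥0∞}
    (ha0 : a ≠ 0) (ha : a ≠ ⊤) (k : Fin (n + 1)) {b g : (Fin (n + 1) → ℝ) → ℝ≥0∞}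
    (hb : Measurable b)
    (hg : ∀ x, a * g x ^ p ≤ ∫⁻ x', ENNReal.ofReal (kerField 0 (lift t (x - x'))) * b x' ^ p)
    (y : Fin n → ℝ) :
    ∫⁻ s, g (k.insertNth s y) ≤ (a⁻¹ * lconv (sliceKer t) (sliceMean p k b) y) ^ (1 / p) := by
  have hω : 1 < 1 / p := by rw [lt_div_iff₀ hp0]; linarith
  have hB := hb.comp (measurable_insertNth k)
  set F : (Fin n → ℝ) × ℝ → ℝ → ℝ≥0∞ := fun x s =>
    pois t (y - x.1) x.2 * b (k.insertNth (s - x.2) x.1) ^ p with hF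
  have hFm : Measurable (Function.uncurry F) := by
    refine Measurable.mul ?_ (Measurable.pow_const ?_ _)
    · exact (measurable_pois t).comp (g := fun x : (Fin n → ℝ) × ℝ => pois t x.1 x.2)
        (f := fun x : ((Fin n → ℝ) × ℝ) × ℝ => (y - x.1.1, x.1.2)) (by fun_prop)
    · exact hB.comp (f := fun x : ((Fin n → ℝ) × ℝ) × ℝ => (x.1.1, x.2 - x.1.2)) (by fun_prop)
  have hkm : Measurable fun x : Fin (n + 1) → ℝ => ENNReal.ofReal (kerField 0 (lift t x)) := by
    have := (continuous_normSq (m := n + 1)).measurable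
    simp only [kerField_zero_lift, normSq_lift]
    fun_prop
  have h1 : ∀ s, g (k.insertNth s y) ≤ (a⁻¹ * ∫⁻ x, F x s) ^ (1 / p) := by
    intro s
    rw [one_div, ENNReal.le_rpow_inv_iff hp0, ← ENNReal.div_eq_inv_mul,
      ENNReal.le_div_iff_mul_le (Or.inl ha0) (Or.inl ha), mul_comm]
    refine (hg _).trans (le_of_eq ?_)
    have hm : Measurable fun x' => ENNReal.ofReal (kerField 0
        (lift t ((k.insertNth s y : Fin (n + 1) → ℝ) - x'))) * b x' ^ p :=
      (hkm.comp (measurable_const.sub measurable_id)).mul (hb.pow_const p)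
    rw [← lintegral_insertNth k hm, Measure.volume_eq_prod, lintegral_prod]
    · refine lintegral_congr fun y' => ?_
      rw [← lintegral_sub_left_eq_self _ s]
      refine lintegral_congr fun r => ?_
      rw [insertNth_sub_insertNth, ofReal_kerField_insertNth, _root_.sub_sub_cancel]
    · exact (hFm.comp (measurable_id.prodMk measurable_const)).aemeasurable
  calc _ ≤ ∫⁻ s, (a⁻¹ * ∫⁻ x, F x s) ^ (1 / p) := lintegral_mono h1
    _ = a⁻¹ ^ (1 / p) * ∫⁻ s, (∫⁻ x, F x s) ^ (1 / p) := by
        rw [← lintegral_const_mul' _ _ (ENNReal.rpow_ne_top_of_nonneg (by positivity)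
          (ENNReal.inv_ne_top.2 ha0))]
        exact lintegral_congr fun s => ENNReal.mul_rpow_of_nonneg _ _ (by positivity)
    _ ≤ a⁻¹ ^ (1 / p) *
        (∫⁻ x, (∫⁻ s, F x s ^ (1 / p)) ^ (1 / (1 / p))) ^ (1 / p) := by
        gcongr
        exact lintegral_rpow_lintegral_le hω hFm
    _ = _ := by
        rw [← ENNReal.mul_rpow_of_nonneg _ _ (by positivity : 0 ≤ 1 / p)]
        congr 2
        have e : ∀ x : (Fin n → ℝ) × ℝ, (∫⁻ s, F x s ^ (1 / p)) ^ (1 / (1 / p)) =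
            pois t (y - x.1) x.2 * sliceMean p k b x.1 := by
          intro x
          have e1 : ∀ s, F x s ^ (1 / p) =
              pois t (y - x.1) x.2 ^ (1 / p) * b (k.insertNth (s - x.2) x.1) := by
            intro s
            rw [hF, ENNReal.mul_rpow_of_nonneg _ _ (by positivity : 0 ≤ 1 / p), ← ENNReal.rpow_mul,
              mul_one_div_cancel hp0.ne', ENNReal.rpow_one]
          simp only [e1]
          rw [lintegral_const_mul' _ _ (ENNReal.rpow_ne_top_of_nonneg (by positivity)
            (by simp [pois])), one_div_one_div, ENNReal.mul_rpow_of_nonneg _ _ hp0.le,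
            ← ENNReal.rpow_mul, one_div_mul_cancel hp0.ne', ENNReal.rpow_one,
            lintegral_sub_right_eq_self (fun s => b (k.insertNth s x.1)), sliceMean]
        simp only [e]
        rw [Measure.volume_eq_prod, lintegral_prod, lconv]
        · refine lintegral_congr fun y' => ?_
          rw [sliceKer, ← lintegral_mul_const]
          exact (measurable_pois t).comp (f := fun s => (y - y', s)) (by fun_prop)
        · refine Measurable.aemeasurable (Measurable.mul ?_ ?_)
          · exact (measurable_pois t).comp
              (f := fun x : (Fin n → ℝ) × ℝ => (y - x.1, x.2)) (by fun_prop)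
          · exact (measurable_sliceMean p k hb).comp measurable_fst

end Slice

/-! ### Differences and the extended gradient -/

section Difference

variable {N : ℕ} {f : (Fin N → ℝ) → ℝ} {D R : Fin N → (Fin N → ℝ) → ℝ}

/-- The length of the gradient of the Poisson extension. -/
def fldNorm (f : (Fin N → ℝ) → ℝ) (z : Fin (N + 1) → ℝ) : ℝ≥0∞ := ENNReal.ofReal √(fldSq f z)

lemma measurable_kerGrad {m : ℕ} (i j : Fin m) : Measurable (kerGrad i j) := by
  have := (continuous_normSq (m := m)).measurable
  unfold kerGrad
  fun_prop

lemma measurable_fld (hf : Integrable f) (i : Fin (N + 1)) : Measurable (fld f i) := by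
  obtain ⟨g, hg, hfg⟩ := hf.aestronglyMeasurable
  have h1 : fld f i = fun z => ∫ y, kerGrad 0 i (z - lift 0 y) * g y := by
    funext z
    refine integral_congr_ae ?_
    filter_upwards [hfg] with y hy
    rw [hy]
  rw [h1]
  have h2 : StronglyMeasurable fun x : (Fin (N + 1) → ℝ) × (Fin N → ℝ) =>
      kerGrad 0 i (x.1 - lift 0 x.2) * g x.2 := by
    refine Measurable.stronglyMeasurable (Measurable.mul ?_ ?_)
    · exact (measurable_kerGrad 0 i).comp (Continuous.measurable (by fun_prop))
    · exact hg.measurable.comp measurable_snd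
  exact h2.integral_prod_right.measurable

lemma measurable_fldNorm (hf : Integrable f) : Measurable (fldNorm f) := by
  unfold fldNorm fldSq
  exact (Finset.measurable_sum _ fun i _ => (measurable_fld hf i).pow_const 2).sqrt.ennreal_ofReal

lemma enorm_fld_le (i : Fin (N + 1)) (z : Fin (N + 1) → ℝ) : ‖fld f i z‖ₑ ≤ fldNorm f z := by
  rw [Real.enorm_eq_ofReal_abs, fldNorm]
  refine ENNReal.ofReal_le_ofReal (Real.abs_le_sqrt ?_)
  exact Finset.single_le_sum (f := fun i => fld f i z ^ 2) (fun _ _ => sq_nonneg _)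
    (Finset.mem_univ i)

lemma enorm_sub_le_lintegral {g g' : ℝ → ℝ} {a b : ℝ} (hab : a ≤ b)
    (hg : ∀ s ∈ Icc a b, HasDerivAt g (g' s) s) (hg' : ContinuousOn g' (Icc a b)) :
    ‖g b - g a‖ₑ ≤ ∫⁻ s in Ioc a b, ‖g' s‖ₑ := by
  rw [← intervalIntegral.integral_eq_sub_of_hasDerivAt (by rwa [uIcc_of_le hab])
    (ContinuousOn.intervalIntegrable (by rwa [uIcc_of_le hab])),
    intervalIntegral.integral_of_le hab]
  exact enorm_integral_le_lintegral_enorm _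

lemma enorm_conv_line_sub_le (hN : 1 ≤ N) (hf : Integrable f) (k : Fin (N + 1))
    {z : Fin (N + 1) → ℝ} {a b : ℝ} (hab : a ≤ b)
    (hz : ∀ s ∈ Icc a b, 0 < (z + s • basisVec k) 0) :
    ‖conv (kerField 0) f (z + b • basisVec k) - conv (kerField 0) f (z + a • basisVec k)‖ₑ ≤
      ∫⁻ s in Ioc a b, fldNorm f (z + s • basisVec k) := by
  refine (enorm_sub_le_lintegral (g := fun s => conv (kerField 0) f (z + s • basisVec k))
    (g' := fun s => fld f k (z + s • basisVec k)) hab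
    (fun s hs => hasDerivAt_line ((hasLap_conv hN hf 0).fst k _ (hz s hs))) ?_).trans
    (lintegral_mono fun s => enorm_fld_le k _)
  intro s hs
  refine ContinuousAt.continuousWithinAt ?_
  exact (continuousAt_fld hf k (hz s hs)).comp (f := fun s : ℝ => z + s • basisVec k)
    (by fun_prop)

lemma lift_add_smul_zero (t s : ℝ) (x : Fin N → ℝ) :
    lift t x + s • basisVec 0 = lift (t + s) x := by
  ext i
  refine Fin.cases ?_ (fun j => ?_) i <;> simp [basisVec]

lemma lift_add_smul_succ (t s : ℝ) (x : Fin N → ℝ) (k : Fin N) :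
    lift t x + s • basisVec k.succ = lift t (x + s • basisVec k) := by
  ext i
  refine Fin.cases ?_ (fun j => ?_) i
  · simp [basisVec]
  · simp [basisVec, Pi.single_apply]

lemma enorm_conv_vert_sub_le (hN : 1 ≤ N) (hf : Integrable f) {ε h : ℝ} (hε : 0 < ε) (hh : ε ≤ h)
    (x : Fin N → ℝ) :
    ‖conv (kerField 0) f (lift h x) - conv (kerField 0) f (lift ε x)‖ₑ ≤
      ∫⁻ t in Ioc 0 h, fldNorm f (lift t x) := by
  have := enorm_conv_line_sub_le hN hf 0 (z := lift 0 x) hh (fun s hs => by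
    simpa [basisVec] using hε.trans_le hs.1)
  simp only [lift_add_smul_zero, zero_add] at this
  exact this.trans (lintegral_mono_set (Ioc_subset_Ioc_left hε.le))

lemma enorm_conv_horiz_sub_le (hN : 1 ≤ N) (hf : Integrable f) (k : Fin N) {h : ℝ} (hh : 0 < h)
    (x : Fin N → ℝ) :
    ‖conv (kerField 0) f (lift h (x + h • basisVec k)) - conv (kerField 0) f (lift h x)‖ₑ ≤
      ∫⁻ s in Ioc 0 h, fldNorm f (lift h (x + s • basisVec k)) := by
  have := enorm_conv_line_sub_le hN hf k.succ (z := lift h x) hh.le (fun s hs => by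
    simpa [basisVec] using hh)
  simp only [lift_add_smul_succ, zero_smul, add_zero] at this
  exact this

theorem IsSobolev.enorm_sub_le (hN : 1 ≤ N) (h : IsSobolev f D)
    (hr : ∀ j, IsRieszTransform j (D j) (R j)) (k : Fin N) {τ : ℝ} (hτ : 0 < τ) :
    ∀ᵐ x : Fin N → ℝ, ENNReal.ofReal (poisA N) * ‖f (x + τ • basisVec k) - f x‖ₑ ≤
      (∫⁻ t in Ioc 0 τ, fldNorm f (lift t (x + τ • basisVec k))) +
        (∫⁻ s in Ioc 0 τ, fldNorm f (lift τ (x + s • basisVec k))) +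
        ∫⁻ t in Ioc 0 τ, fldNorm f (lift t x) := by
  obtain ⟨ε, hε, hε0, hlim⟩ := h.exists_seq hN hr
  have hlim2 := (measurePreserving_add_right volume
    (τ • basisVec k : Fin N → ℝ)).quasiMeasurePreserving.ae hlim
  filter_upwards [hlim, hlim2] with x hx hx'
  have hA := poisA_pos (N := N)
  have e1 : ENNReal.ofReal (poisA N) * ‖f (x + τ • basisVec k) - f x‖ₑ =
      ‖poisA N * f (x + τ • basisVec k) - poisA N * f x‖ₑ := by
    rw [← mul_sub, enorm_mul, Real.enorm_of_nonneg hA.le]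
  rw [e1]
  refine le_of_tendsto (hx'.1.sub hx.1).enorm ?_
  filter_upwards [hε0.eventually (gt_mem_nhds hτ)] with m hm
  have hm := le_of_lt hm
  have h1 := enorm_conv_vert_sub_le hN h.int (hε m) hm (x + τ • basisVec k)
  have h2 := enorm_conv_horiz_sub_le hN h.int k hτ x
  have h3 := enorm_conv_vert_sub_le hN h.int (hε m) hm x
  rw [enorm_sub_rev] at h1
  refine le_trans ?_ (add_le_add (add_le_add h1 h2) h3)
  refine le_trans (le_of_eq ?_) ((enorm_add_le _ _).trans (add_le_add_left (enorm_add_le _ _) _))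
  congr 1
  ring

end Difference

section SliceDifference

variable {n : ℕ} {f : (Fin (n + 1) → ℝ) → ℝ} {D R : Fin (n + 1) → (Fin (n + 1) → ℝ) → ℝ}

/-- The integral of the gradient length along a line parallel to a coordinate axis. -/
def sliceFld (k : Fin (n + 1)) (f : (Fin (n + 1) → ℝ) → ℝ) (t : ℝ) (y : Fin n → ℝ) : ℝ≥0∞ :=
  ∫⁻ s, fldNorm f (lift t (k.insertNth s y))

lemma insertNth_add_smul (k : Fin (n + 1)) (s r : ℝ) (y : Fin n → ℝ) :
    (k.insertNth s y : Fin (n + 1) → ℝ) + r • basisVec k = k.insertNth (s + r) y := by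
  ext i
  refine Fin.succAboveCases k ?_ (fun j => ?_) i <;> simp [basisVec]

lemma Delta_eq (k : Fin (n + 1)) (τ : ℝ) (x : Fin (n + 1) → ℝ) :
    Delta k τ f x = f (x + τ • basisVec k) - f x := by
  unfold Delta
  congr 2
  ext i
  rcases eq_or_ne i k with rfl | hi
  · simp [basisVec]
  · simp [basisVec, hi]

lemma ae_insertNth (k : Fin (n + 1)) {P : (Fin (n + 1) → ℝ) → Prop} (hP : ∀ᵐ x, P x) :
    ∀ᵐ y : Fin n → ℝ, ∀ᵐ s : ℝ, P (k.insertNth s y) := by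
  have hmp := (volume_preserving_piFinSuccAbove (fun _ : Fin (n + 1) => ℝ) k).symm
  have h1 := hmp.quasiMeasurePreserving.ae hP
  have h2 : ∀ᵐ x : (Fin n → ℝ) × ℝ, P (k.insertNth x.2 x.1) :=
    (Measure.measurePreserving_swap (μ := (volume : Measure (Fin n → ℝ)))
      (ν := (volume : Measure ℝ))).quasiMeasurePreserving.ae h1
  exact Measure.ae_ae_of_ae_prod h2

lemma lintegral_three_paths {G : ℝ → ℝ → ℝ≥0∞} (hG : Measurable (Function.uncurry G)) (τ : ℝ) :
    ∫⁻ s, ((∫⁻ t in Ioc 0 τ, G t (s + τ)) + (∫⁻ r in Ioc 0 τ, G τ (s + r)) +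
        ∫⁻ t in Ioc 0 τ, G t s) =
      2 * (∫⁻ t in Ioc 0 τ, ∫⁻ s, G t s) + ENNReal.ofReal τ * ∫⁻ s, G τ s := by
  have hm1 : Measurable fun x : ℝ × ℝ => G x.2 (x.1 + τ) :=
    hG.comp (f := fun x : ℝ × ℝ => (x.2, x.1 + τ)) (by fun_prop)
  have hm2 : Measurable fun x : ℝ × ℝ => G τ (x.1 + x.2) :=
    hG.comp (f := fun x : ℝ × ℝ => (τ, x.1 + x.2)) (by fun_prop)
  have hm3 : Measurable fun x : ℝ × ℝ => G x.2 x.1 := hG.comp measurable_swap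
  rw [lintegral_add_right _ hm3.lintegral_prod_right',
    lintegral_add_right _ hm2.lintegral_prod_right',
    lintegral_lintegral_swap (f := fun s t => G t (s + τ)) hm1.aemeasurable,
    lintegral_lintegral_swap (f := fun s r => G τ (s + r)) hm2.aemeasurable,
    lintegral_lintegral_swap (f := fun s t => G t s) hm3.aemeasurable]
  have e1 : ∀ t r : ℝ, ∫⁻ s, G t (s + r) = ∫⁻ s, G t s :=
    fun t r => lintegral_add_right_eq_self (G t) r
  simp only [e1, setLIntegral_const, Real.volume_Ioc, sub_zero]
  ring

theorem IsSobolev.slice_Delta_le (h : IsSobolev f D)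
    (hr : ∀ j, IsRieszTransform j (D j) (R j)) (k : Fin (n + 1)) {τ : ℝ} (hτ : 0 < τ) :
    ∀ᵐ y : Fin n → ℝ, ENNReal.ofReal (poisA (n + 1)) * ∫⁻ s, ‖Delta k τ f (k.insertNth s y)‖ₑ ≤
      2 * (∫⁻ t in Ioc 0 τ, sliceFld k f t y) + ENNReal.ofReal τ * sliceFld k f τ y := by
  filter_upwards [ae_insertNth k (h.enorm_sub_le (by omega) hr k hτ)] with y hy
  set G : ℝ → ℝ → ℝ≥0∞ := fun t s => fldNorm f (lift t (k.insertNth s y : Fin (n + 1) → ℝ))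
  have hm : Measurable (Function.uncurry G) := by
    refine (measurable_fldNorm h.int).comp (continuous_lift.measurable.comp
      (measurable_fst.prodMk ?_))
    exact (measurable_insertNth k).comp (f := fun x : ℝ × ℝ => (y, x.2)) (by fun_prop)
  simp only [insertNth_add_smul] at hy
  rw [← lintegral_const_mul' _ _ ENNReal.ofReal_ne_top]
  refine le_trans ?_ (lintegral_three_paths hm τ).le
  refine lintegral_mono_ae (hy.mono fun s hs => ?_)
  rw [Delta_eq, insertNth_add_smul]
  exact hs

end SliceDifference

/-! ### Dyadic summation -/

lemma two_mul_lintegral_Ioc_le {φ : ℝ → ℝ≥0∞} {Ψ : ℕ → ℝ≥0∞} {τ : ℝ} (hτ : 0 < τ)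
    (h : ∀ j : ℕ, ∀ t ∈ Ioc (τ * (1 / 2) ^ (j + 1)) (τ * (1 / 2) ^ j), φ t ≤ Ψ j) :
    2 * ∫⁻ t in Ioc 0 τ, φ t ≤
      ENNReal.ofReal τ * ∑' j : ℕ, ENNReal.ofReal ((1 / 2) ^ j) * Ψ j := by
  have hsub : Ioc 0 τ ⊆ ⋃ j : ℕ, Ioc (τ * (1 / 2) ^ (j + 1)) (τ * (1 / 2) ^ j) := by
    intro t ht
    obtain ⟨j, h1, h2⟩ := exists_nat_pow_near_of_lt_one (div_pos ht.1 hτ)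
      ((div_le_one hτ).2 ht.2) (by norm_num : (0 : ℝ) < 1 / 2) (by norm_num)
    refine mem_iUnion.2 ⟨j, ?_, ?_⟩
    · rwa [lt_div_iff₀ hτ, mul_comm] at h1
    · rwa [div_le_iff₀ hτ, mul_comm] at h2
  calc _ ≤ 2 * ∑' j : ℕ, ∫⁻ t in Ioc (τ * (1 / 2) ^ (j + 1)) (τ * (1 / 2) ^ j), φ t := by
        gcongr
        exact (lintegral_mono_set hsub).trans (lintegral_iUnion_le _ _)
    _ ≤ 2 * ∑' j : ℕ, Ψ j * ENNReal.ofReal (τ * (1 / 2) ^ j / 2) := by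
        gcongr with j
        refine (setLIntegral_mono_ae measurable_const.aemeasurable
          (Eventually.of_forall (h j))).trans ?_
        rw [setLIntegral_const, Real.volume_Ioc]
        refine le_of_eq ?_
        congr 2
        ring
    _ = _ := by
        rw [← ENNReal.tsum_mul_left, ← ENNReal.tsum_mul_left]
        refine tsum_congr fun j => ?_
        rw [show (2 : ℝ≥0∞) = ENNReal.ofReal 2 by simp, mul_left_comm,
          ← ENNReal.ofReal_mul (by norm_num), ← mul_assoc, ← ENNReal.ofReal_mul hτ.le, mul_comm]
        congr 2
        ring

lemma tsum_ofReal_pow {ρ : ℝ} (h0 : 0 ≤ ρ) (h1 : ρ < 1) :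
    ∑' j : ℕ, ENNReal.ofReal (ρ ^ j) = ENNReal.ofReal (1 - ρ)⁻¹ := by
  rw [← ENNReal.ofReal_tsum_of_nonneg (fun j => pow_nonneg h0 j)
    (summable_geometric_of_lt_one h0 h1), tsum_geometric_of_lt_one h0 h1]

lemma tsum_half_pow_mul_le {ρ : ℝ} (h0 : 0 < ρ) (h1 : ρ < 1) (Ψ : ℕ → ℝ≥0∞) :
    ∑' j : ℕ, ENNReal.ofReal ((1 / 2) ^ j) * Ψ j ≤
      ENNReal.ofReal (1 - ρ)⁻¹ * ⨆ j : ℕ, ENNReal.ofReal ((1 / (2 * ρ)) ^ j) * Ψ j := by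
  rw [← tsum_ofReal_pow h0.le h1, ← ENNReal.tsum_mul_right]
  refine ENNReal.tsum_le_tsum fun j => ?_
  have e : ENNReal.ofReal ((1 / 2) ^ j) * Ψ j =
      ENNReal.ofReal (ρ ^ j) * (ENNReal.ofReal ((1 / (2 * ρ)) ^ j) * Ψ j) := by
    rw [← mul_assoc, ← ENNReal.ofReal_mul (by positivity), ← mul_pow]
    congr 3
    field_simp
  rw [e]
  gcongr
  exact le_iSup (fun j : ℕ => ENNReal.ofReal ((1 / (2 * ρ)) ^ j) * Ψ j) j

lemma measurable_lam_param {X Y : Type*} [MeasurableSpace X] [MeasurableSpace Y] {μ : Measure Y}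
    [SFinite μ] (θ : ℝ) {g : X → Y → ℝ≥0∞} (hg : Measurable (Function.uncurry g)) :
    Measurable fun x => lam μ θ (g x) := by
  have hset : MeasurableSet {w : (X × ℝ) × Y | ENNReal.ofReal w.1.2 < g w.1.1 w.2} :=
    measurableSet_lt (by fun_prop)
      (hg.comp (f := fun w : (X × ℝ) × Y => (w.1.1, w.2)) (by fun_prop))
  have h1 : Measurable fun x : X × ℝ => μ {y | ENNReal.ofReal x.2 < g x.1 y} ^ θ :=
    (measurable_measure_prodMk_left hset).pow_const θ
  exact h1.lintegral_prod_right'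

section Dyadic

variable {n : ℕ}

lemma measurable_lconv_sliceKer {σ : (Fin n → ℝ) → ℝ≥0∞} (hσ : Measurable σ) :
    Measurable (Function.uncurry fun t => lconv (sliceKer t) σ) := by
  have h1 : Measurable fun w : ((ℝ × (Fin n → ℝ)) × (Fin n → ℝ)) × ℝ =>
      pois w.1.1.1 (w.1.1.2 - w.1.2) w.2 := by
    have := (continuous_normSq (m := n)).measurable
    unfold pois
    fun_prop
  have h2 : Measurable fun w : (ℝ × (Fin n → ℝ)) × (Fin n → ℝ) =>
      sliceKer w.1.1 (w.1.2 - w.2) * σ w.2 :=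
    h1.lintegral_prod_right'.mul (hσ.comp measurable_snd)
  exact h2.lintegral_prod_right'

lemma lconv_sliceKer_le {t T : ℝ} (hT : 0 < T) (h1 : T / 2 ≤ t) (h2 : t ≤ T)
    (σ : (Fin n → ℝ) → ℝ≥0∞) (y : Fin n → ℝ) :
    lconv (sliceKer t) σ y ≤ 2 ^ (n + 2) * lconv (sliceKer T) σ y := by
  unfold lconv
  rw [← lintegral_const_mul' _ _ (by simp)]
  refine lintegral_mono fun y' => ?_
  rw [← mul_assoc]
  gcongr
  exact sliceKer_le_of_le hT h1 h2 _

variable {f : (Fin (n + 1) → ℝ) → ℝ} {D R : Fin (n + 1) → (Fin (n + 1) → ℝ) → ℝ}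
  {b : (Fin (n + 1) → ℝ) → ℝ≥0∞}

/-- The function bounding the slices of the gradient at height `t`. -/
def psi (k : Fin (n + 1)) (b : (Fin (n + 1) → ℝ) → ℝ≥0∞) (t : ℝ) (y : Fin n → ℝ) : ℝ≥0∞ :=
  lconv (sliceKer t) (sliceMean (expP (n + 1)) k b) y ^ (1 / expP (n + 1))

/-- The constant in the comparison of gradients at comparable heights. -/
def dyadicC (n : ℕ) : ℝ := ((poisA (n + 1))⁻¹ * 2 ^ (n + 2)) ^ (1 / expP (n + 1))

lemma dyadicC_pos : 0 < dyadicC n := by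
  have := poisA_pos (N := n + 1)
  unfold dyadicC
  positivity

lemma IsSobolev.fldNorm_rpow_le (h : IsSobolev f D) (hr : ∀ j, IsRieszTransform j (D j) (R j))
    (hbe : b =ᵐ[volume] fun x => ENNReal.ofReal √(bdrySq D R x)) {t : ℝ} (ht : 0 < t)
    (x : Fin (n + 1) → ℝ) :
    ENNReal.ofReal (poisA (n + 1)) * fldNorm f (lift t x) ^ expP (n + 1) ≤
      ∫⁻ x', ENNReal.ofReal (kerField 0 (lift t (x - x'))) * b x' ^ expP (n + 1) := by
  have hp := expP_pos (N := n + 1)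
  have hs : ∀ {G : ℝ}, 0 ≤ G → ENNReal.ofReal √G ^ expP (n + 1) =
      ENNReal.ofReal (G ^ (expP (n + 1) / 2)) := by
    intro G hG
    rw [ENNReal.ofReal_rpow_of_nonneg (Real.sqrt_nonneg _) hp.le, Real.sqrt_eq_rpow,
      ← Real.rpow_mul hG]
    congr 2
    ring
  have := h.fldSq_rpow_le_bdry (by omega) hr (z := lift t x) (by simpa using ht)
  rw [fldNorm, hs (fldSq_nonneg _), ← ENNReal.ofReal_mul poisA_pos.le]
  refine this.trans (le_of_eq (lintegral_congr_ae ?_))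
  filter_upwards [hbe] with x' hx'
  rw [hx', hs (bdrySq_nonneg _), lift_sub_lift, sub_zero, ENNReal.ofReal_mul]
  exact kerField_zero_nonneg (by simpa using ht.le)

lemma IsSobolev.sliceFld_le (h : IsSobolev f D) (hr : ∀ j, IsRieszTransform j (D j) (R j))
    (hb : Measurable b) (hbe : b =ᵐ[volume] fun x => ENNReal.ofReal √(bdrySq D R x))
    (k : Fin (n + 1)) {t T : ℝ} (hT : 0 < T) (h1 : T / 2 ≤ t) (h2 : t ≤ T) (y : Fin n → ℝ) :
    sliceFld k f t y ≤ ENNReal.ofReal (dyadicC n) * psi k b T y := by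
  have hA := poisA_pos (N := n + 1)
  have hp : 0 ≤ 1 / expP (n + 1) := (one_div_pos.2 expP_pos).le
  refine (lintegral_slice_le expP_pos expP_lt_one (a := ENNReal.ofReal (poisA (n + 1)))
    (by simpa using hA) ENNReal.ofReal_ne_top k hb
    (h.fldNorm_rpow_le hr hbe (by linarith)) y).trans ?_
  rw [dyadicC, psi, ← ENNReal.ofReal_rpow_of_nonneg (by positivity) hp,
    ← ENNReal.mul_rpow_of_nonneg _ _ hp, ENNReal.ofReal_mul (by positivity),
    ENNReal.ofReal_inv_of_pos hA, ENNReal.ofReal_pow (by norm_num), ENNReal.ofReal_ofNat, mul_assoc]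
  gcongr
  exact lconv_sliceKer_le hT h1 h2 _ y

lemma IsSobolev.slice_Delta_le_iSup (h : IsSobolev f D)
    (hr : ∀ j, IsRieszTransform j (D j) (R j)) (hb : Measurable b)
    (hbe : b =ᵐ[volume] fun x => ENNReal.ofReal √(bdrySq D R x)) (k : Fin (n + 1)) {ρ : ℝ}
    (h0 : 0 < ρ) (h1 : ρ < 1) {τ : ℝ} (hτ : 0 < τ) :
    ∀ᵐ y : Fin n → ℝ, ∫⁻ s, ‖Delta k τ f (k.insertNth s y)‖ₑ ≤
      ENNReal.ofReal ((poisA (n + 1))⁻¹ * (2 * dyadicC n * (1 - ρ)⁻¹) * τ) *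
        ⨆ j : ℕ, ENNReal.ofReal ((1 / (2 * ρ)) ^ j) * psi k b (τ * (1 / 2) ^ j) y := by
  have hA := poisA_pos (N := n + 1)
  have hC := dyadicC_pos (n := n)
  filter_upwards [h.slice_Delta_le hr k hτ] with y hy
  set S := ∑' j : ℕ, ENNReal.ofReal ((1 / 2) ^ j) * psi k b (τ * (1 / 2) ^ j) y with hS
  have hfirst : 2 * ∫⁻ t in Ioc 0 τ, sliceFld k f t y ≤
      ENNReal.ofReal τ * (ENNReal.ofReal (dyadicC n) * S) := by
    refine (two_mul_lintegral_Ioc_le hτ (Ψ := fun j => ENNReal.ofReal (dyadicC n) *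
      psi k b (τ * (1 / 2) ^ j) y) fun j t ht => ?_).trans (le_of_eq ?_)
    · refine h.sliceFld_le hr hb hbe k (by positivity) ?_ ht.2 y
      have := ht.1
      rw [pow_succ] at this
      linarith
    · simp_rw [hS, ← ENNReal.tsum_mul_left]
      refine tsum_congr fun j => ?_
      ring
  have hsecond : sliceFld k f τ y ≤ ENNReal.ofReal (dyadicC n) * S := by
    refine (h.sliceFld_le hr hb hbe k hτ (by linarith) le_rfl y).trans ?_
    gcongr
    refine le_trans (le_of_eq ?_) (ENNReal.le_tsum 0)
    simp
  have htot := hy.trans (add_le_add hfirst (mul_le_mul_right hsecond (ENNReal.ofReal τ)))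
  have hS2 := tsum_half_pow_mul_le h0 h1 fun j => psi k b (τ * (1 / 2) ^ j) y
  have hinv : 0 < (1 - ρ)⁻¹ := inv_pos.2 (by linarith)
  rw [ENNReal.ofReal_mul (by positivity), ENNReal.ofReal_mul (by positivity),
    ENNReal.ofReal_mul (by positivity), ENNReal.ofReal_mul (by norm_num),
    ENNReal.ofReal_inv_of_pos hA, mul_assoc, mul_assoc, ← ENNReal.div_eq_inv_mul,
    ENNReal.le_div_iff_mul_le (Or.inl (by simpa using hA)) (Or.inl ENNReal.ofReal_ne_top), mul_comm]
  refine htot.trans ?_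
  rw [← two_mul]
  refine (mul_le_mul_right (mul_le_mul_right (mul_le_mul_right hS2 _) _) _).trans (le_of_eq ?_)
  generalize (⨆ j : ℕ, ENNReal.ofReal ((1 / (2 * ρ)) ^ j) * psi k b (τ * (1 / 2) ^ j) y) = M
  rw [ENNReal.ofReal_ofNat]
  ring

lemma IsSobolev.mixedV_Delta_le (h : IsSobolev f D)
    (hr : ∀ j, IsRieszTransform j (D j) (R j)) (hb : Measurable b)
    (hbe : b =ᵐ[volume] fun x => ENNReal.ofReal √(bdrySq D R x)) (k : Fin (n + 1)) {ρ q : ℝ}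
    (h0 : 0 < ρ) (h1 : ρ < 1) (hq : 1 < q) {τ : ℝ} (hτ : 0 < τ) :
    mixedV q k (Delta k τ f) ≤
      ENNReal.ofReal (q * ((poisA (n + 1))⁻¹ * (2 * dyadicC n * (1 - ρ)⁻¹)) * τ) *
        ∑' j : ℕ, ENNReal.ofReal ((1 / (2 * ρ)) ^ j) *
          lam volume (1 / q) (psi k b (τ * (1 / 2) ^ j)) := by
  have hA := poisA_pos (N := n + 1)
  have hC := dyadicC_pos (n := n)
  have hinv : 0 < (1 - ρ)⁻¹ := inv_pos.2 (by linarith)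
  have hq0 : 0 < q := by linarith
  have hθ : 0 < 1 / q := by positivity
  refine (lorentz_le_lam volume _ hq0).trans ?_
  rw [mul_assoc, ENNReal.ofReal_mul hq0.le, mul_assoc]
  gcongr
  refine (lam_mono_ae hθ.le (h.slice_Delta_le_iSup hr hb hbe k h0 h1 hτ)).trans ?_
  rw [lam_const_mul (by positivity)]
  gcongr
  refine (lam_iSup_le hθ ((div_le_one hq0).2 hq.le) _).trans (le_of_eq ?_)
  refine tsum_congr fun j => ?_
  rw [lam_const_mul (by positivity)]

/-- The dilation-weighted sum over dyadic scales of a function on the half line. -/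
lemma lintegral_tsum_dyadic {L : ℝ → ℝ≥0∞} (hL : Measurable L) {α : ℝ} (hα : 0 < α) :
    ∫⁻ τ in Ioi (0 : ℝ), ENNReal.ofReal (τ ^ (-α)) *
        ∑' j : ℕ, ENNReal.ofReal ((1 / (2 * (1 / 2) ^ (α / 2))) ^ j) * L (τ * (1 / 2) ^ j) =
      ENNReal.ofReal (1 - (1 / 2) ^ (α / 2))⁻¹ *
        ∫⁻ τ in Ioi (0 : ℝ), ENNReal.ofReal (τ ^ (-α)) * L τ := by
  set ρ : ℝ := (1 / 2) ^ (α / 2) with hρ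
  have h0 : 0 < ρ := by positivity
  have h1 : ρ < 1 := Real.rpow_lt_one (by norm_num) (by norm_num) (by positivity)
  simp only [← ENNReal.tsum_mul_left]
  rw [lintegral_tsum fun j => by fun_prop, ← tsum_ofReal_pow h0.le h1, ← ENNReal.tsum_mul_right]
  refine tsum_congr fun j => ?_
  set d : ℝ := (1 / 2) ^ j with hd
  have hd0 : 0 < d := by positivity
  have e1 : ∫⁻ τ in Ioi (0 : ℝ), ENNReal.ofReal (τ ^ (-α)) *
      (ENNReal.ofReal ((1 / (2 * ρ)) ^ j) * L (τ * d)) =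
      ∫⁻ τ in Ioi (0 : ℝ), ENNReal.ofReal ((1 / (2 * ρ)) ^ j * d ^ α) *
        (ENNReal.ofReal ((d * τ) ^ (-α)) * L (d * τ)) := by
    refine setLIntegral_congr_fun measurableSet_Ioi fun τ hτ => ?_
    have hτ : 0 < τ := hτ
    rw [← mul_assoc, ← mul_assoc, ← ENNReal.ofReal_mul (by positivity),
      ← ENNReal.ofReal_mul (by positivity), mul_comm d τ, Real.mul_rpow hτ.le hd0.le]
    congr 2
    rw [Real.rpow_neg hd0.le]
    have : d ^ α ≠ 0 := (Real.rpow_pos_of_pos hd0 _).ne'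
    field_simp
  rw [e1, lintegral_const_mul' _ _ ENNReal.ofReal_ne_top,
    lintegral_Ioi_comp_mul hd0 fun u => ENNReal.ofReal (u ^ (-α)) * L u, ← mul_assoc,
    ← ENNReal.ofReal_mul (by positivity)]
  congr 2
  have e2 : d ^ α = (ρ ^ 2) ^ j := by
    rw [hd, hρ, ← Real.rpow_natCast (_ ^ (α / 2)) 2, ← Real.rpow_mul (by norm_num),
      ← Real.rpow_natCast, ← Real.rpow_mul (by norm_num), ← Real.rpow_natCast,
      ← Real.rpow_mul (by norm_num)]
    congr 1
    push_cast
    ring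
  rw [e2, hd, ← inv_pow, ← mul_pow, ← mul_pow]
  congr 1
  field_simp

theorem exists_lintegral_mixedV_le (hn : 1 ≤ n) {q : ℝ} (hq1 : 1 < q)
    (hq2 : q * ((n : ℝ) - 1) < n) :
    ∃ K : ℝ≥0∞, K ≠ ⊤ ∧ ∀ (f : (Fin (n + 1) → ℝ) → ℝ) (D R : Fin (n + 1) → (Fin (n + 1) → ℝ) → ℝ)
      (b : (Fin (n + 1) → ℝ) → ℝ≥0∞) (k : Fin (n + 1)), IsSobolev f D →
      (∀ j, IsRieszTransform j (D j) (R j)) → Measurable b →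
      b =ᵐ[volume] (fun x => ENNReal.ofReal √(bdrySq D R x)) →
      ∫⁻ τ in Ioi (0 : ℝ), ENNReal.ofReal (τ ^ (-(1 - n * (1 - 1 / q)))) *
        mixedV q k (Delta k τ f) / ENNReal.ofReal τ ≤ K * ∫⁻ x, b x := by
  have hn0 : (0 : ℝ) < n := by exact_mod_cast hn
  have hq0 : 0 < q := by linarith
  set c : ℝ := n * (1 - 1 / q) with hc
  have hc0 : 0 < c := mul_pos hn0 (sub_pos.2 ((div_lt_one hq0).2 hq1))
  set α : ℝ := 1 - c with hα
  have hα0 : 0 < α := by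
    have : q * α = q - (q * n - n) := by
      rw [hα, hc]
      field_simp
    exact pos_of_mul_pos_right (by rw [this]; linarith) hq0.le
  set ρ : ℝ := (1 / 2) ^ (α / 2) with hρ
  have h0 : 0 < ρ := by positivity
  have h1 : ρ < 1 := Real.rpow_lt_one (by norm_num) (by norm_num) (by positivity)
  have hA := poisA_pos (N := n + 1)
  have hC := dyadicC_pos (n := n)
  have hinv : 0 < (1 - ρ)⁻¹ := inv_pos.2 (by linarith)
  set K1 : ℝ := q * ((poisA (n + 1))⁻¹ * (2 * dyadicC n * (1 - ρ)⁻¹)) with hK1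
  have hK10 : 0 < K1 := by positivity
  set a := ENNReal.ofReal (poisA (n + 1)) with ha
  have ha0 : a ≠ 0 := by simpa [ha] using hA
  have hp := expP_pos (N := n + 1)
  have hat : a ≠ ⊤ := ENNReal.ofReal_ne_top
  set p := expP (n + 1) with hpdef
  set J : ℝ≥0∞ := ENNReal.ofReal (1 / c) * (ENNReal.ofReal Real.pi / a) ^ (c / n) *
    (ENNReal.ofReal (1 / (1 - p)) * (2 * a) ^ (1 / p)) with hJ
  refine ⟨ENNReal.ofReal K1 * (ENNReal.ofReal (1 - ρ)⁻¹ * J), ?_, ?_⟩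
  · refine ENNReal.mul_ne_top ENNReal.ofReal_ne_top (ENNReal.mul_ne_top ENNReal.ofReal_ne_top ?_)
    refine ENNReal.mul_ne_top (ENNReal.mul_ne_top ENNReal.ofReal_ne_top ?_)
      (ENNReal.mul_ne_top ENNReal.ofReal_ne_top ?_)
    · exact ENNReal.rpow_ne_top_of_nonneg (by positivity)
        (ENNReal.div_ne_top ENNReal.ofReal_ne_top ha0)
    · exact ENNReal.rpow_ne_top_of_nonneg (by positivity) (ENNReal.mul_ne_top (by simp) hat)
  intro f D R b k h hr hb hbe
  have hσ := measurable_sliceMean p k hb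
  set L : ℝ → ℝ≥0∞ := fun t => lam volume (1 / q) (psi k b t) with hL
  have hLm : Measurable L :=
    measurable_lam_param (1 / q) ((measurable_lconv_sliceKer hσ).pow_const (1 / p))
  have hJL : ∫⁻ τ in Ioi (0 : ℝ), ENNReal.ofReal (τ ^ (-α)) * L τ ≤ J * ∫⁻ x, b x := by
    have := lintegral_lam_lconv_le hn hp expP_lt_one (one_div_pos.2 hq0) hc0
      (by rw [hc]; field_simp; ring) ha0 hat ENNReal.ofReal_ne_top
      (κ := sliceKer) (fun t _ => measurable_sliceKer t) (fun t ht => (lintegral_sliceKer ht).le)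
      (fun t ht y => sliceKer_mul_le ht y) hσ
    rw [lintegral_sliceMean hp k hb, ← mul_assoc] at this
    rwa [hα, neg_sub]
  calc _ ≤ ∫⁻ τ in Ioi (0 : ℝ), ENNReal.ofReal K1 * (ENNReal.ofReal (τ ^ (-α)) *
        ∑' j : ℕ, ENNReal.ofReal ((1 / (2 * ρ)) ^ j) * L (τ * (1 / 2) ^ j)) := by
        refine setLIntegral_mono_ae ?_ (Eventually.of_forall fun τ hτ => ?_)
        · have : Measurable fun τ : ℝ =>
              ∑' j : ℕ, ENNReal.ofReal ((1 / (2 * ρ)) ^ j) * L (τ * (1 / 2) ^ j) :=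
            Measurable.tsum fun j => by fun_prop
          fun_prop
        have hτ : 0 < τ := hτ
        refine ENNReal.div_le_of_le_mul ?_
        refine (mul_le_mul_right (h.mixedV_Delta_le hr hb hbe k h0 h1 hq1 hτ) _).trans
          (le_of_eq ?_)
        rw [ENNReal.ofReal_mul hK10.le]
        ring
    _ = ENNReal.ofReal K1 * (ENNReal.ofReal (1 - ρ)⁻¹ *
        ∫⁻ τ in Ioi (0 : ℝ), ENNReal.ofReal (τ ^ (-α)) * L τ) := by
        rw [lintegral_const_mul' _ _ ENNReal.ofReal_ne_top, lintegral_tsum_dyadic hLm hα0]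
    _ ≤ _ := by
        rw [mul_assoc, mul_assoc]
        gcongr

end Dyadic

section BoundaryNorm

variable {N : ℕ} {D R : Fin N → (Fin N → ℝ) → ℝ}

lemma aemeasurable_bdrySq (hD : ∀ j, Integrable (D j)) (hR : ∀ j, Integrable (R j)) :
    AEMeasurable (bdrySq D R) := by
  have hD' := fun j => (hD j).aemeasurable
  have hR' := fun j => (hR j).aemeasurable
  unfold bdrySq
  fun_prop

lemma sqrt_bdrySq_le (x : Fin N → ℝ) :
    √(bdrySq D R x) ≤ (rieszC N)⁻¹ * ∑ j, |R j x| + poisA N * ∑ j, |D j x| := by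
  have hr : 0 ≤ (rieszC N)⁻¹ := (inv_pos.2 rieszC_pos).le
  have hA := (poisA_pos (N := N)).le
  have h1 : ((rieszC N)⁻¹ * ∑ j, R j x) ^ 2 ≤ ((rieszC N)⁻¹ * ∑ j, |R j x|) ^ 2 := by
    rw [mul_pow, mul_pow, ← sq_abs (∑ j, R j x)]
    gcongr
    exact Finset.abs_sum_le_sum_abs _ _
  have h2 : ∑ j, (poisA N * D j x) ^ 2 ≤ (poisA N * ∑ j, |D j x|) ^ 2 := by
    simp_rw [mul_pow, ← Finset.mul_sum]
    gcongr
    simp_rw [← sq_abs (D _ x)]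
    exact Finset.sum_sq_le_sq_sum_of_nonneg fun j _ => abs_nonneg _
  refine Real.sqrt_le_iff.2 ⟨by positivity, ?_⟩
  have h3 : 0 ≤ ((rieszC N)⁻¹ * ∑ j, |R j x|) * (poisA N * ∑ j, |D j x|) := by positivity
  unfold bdrySq
  nlinarith

lemma lintegral_sqrt_bdrySq_le (hD : ∀ j, Integrable (D j)) (hR : ∀ j, Integrable (R j)) :
    ∫⁻ x, ENNReal.ofReal √(bdrySq D R x) ≤ ENNReal.ofReal ((rieszC N)⁻¹ + poisA N) *
      ∑ j, (eLpNorm (D j) 1 volume + eLpNorm (R j) 1 volume) := by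
  have hr : 0 ≤ (rieszC N)⁻¹ := (inv_pos.2 rieszC_pos).le
  have hA := (poisA_pos (N := N)).le
  have hpt : ∀ x, ENNReal.ofReal √(bdrySq D R x) ≤
      ENNReal.ofReal ((rieszC N)⁻¹ + poisA N) * ∑ j, (‖D j x‖ₑ + ‖R j x‖ₑ) := fun x => by
    have : ∑ j, (‖D j x‖ₑ + ‖R j x‖ₑ) = ENNReal.ofReal (∑ j, (|D j x| + |R j x|)) := by
      rw [ENNReal.ofReal_sum_of_nonneg fun j _ => by positivity]
      refine Finset.sum_congr rfl fun j _ => ?_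
      rw [ENNReal.ofReal_add (abs_nonneg _) (abs_nonneg _), Real.enorm_eq_ofReal_abs,
        Real.enorm_eq_ofReal_abs]
    rw [this, ← ENNReal.ofReal_mul (by positivity)]
    refine ENNReal.ofReal_le_ofReal ((sqrt_bdrySq_le x).trans ?_)
    rw [Finset.sum_add_distrib]
    have h1 : 0 ≤ (rieszC N)⁻¹ * ∑ j, |D j x| := by positivity
    have h2 : 0 ≤ poisA N * ∑ j, |R j x| := by positivity
    linarith
  refine (lintegral_mono hpt).trans (le_of_eq ?_)
  rw [lintegral_const_mul' _ _ ENNReal.ofReal_ne_top,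
    lintegral_finsetSum' (f := fun j x => ‖D j x‖ₑ + ‖R j x‖ₑ) _
    fun j _ => (hD j).aemeasurable.enorm.add (hR j).aemeasurable.enorm]
  simp_rw [eLpNorm_one_eq_lintegral_enorm]
  congr 1
  exact Finset.sum_congr rfl fun j _ => lintegral_add_left' (hD j).aemeasurable.enorm _

end BoundaryNorm

end HardySobolev

/-- Theorem 1.4 / 5.3 (dimension n+1 ≥ 2 here): if f ∈ W¹₁ and all D_j f ∈ H¹, then for
1 < q < (n−1)/(n−2) (i.e. q(n−1) < n in dimension n+1) and α = 1 − (n−1)/q',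
Σ_k ∫₀^∞ h^{-α} ‖Δ_k(h)f‖_{V_{q,k}} dh/h ≤ c Σ_k ‖D_k f‖_{H¹}. -/
theorem hardy_sobolev_mixed_embedding (n : ℕ) (hn : 1 ≤ n) (q : ℝ)
    (hq1 : 1 < q) (hq2 : q * ((n:ℝ) - 1) < n) :
    ∃ c > 0, ∀ (f : (Fin (n+1) → ℝ) → ℝ)
      (D : Fin (n+1) → (Fin (n+1) → ℝ) → ℝ)
      (R : Fin (n+1) → Fin (n+1) → (Fin (n+1) → ℝ) → ℝ),
      Integrable f volume → (∀ j, Integrable (D j) volume) →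
      (∀ j, IsWeakDeriv j f (D j)) →
      (∀ i j, Integrable (R i j) volume) →
      (∀ i j, IsRieszTransform i (D j) (R i j)) →
      ∑ k : Fin (n+1),
          ∫⁻ h in Set.Ioi (0:ℝ),
            ENNReal.ofReal (h ^ (-(1 - n * (1 - 1/q)))) * mixedV q k (Delta k h f)
              / ENNReal.ofReal h
        ≤ ENNReal.ofReal c *
          ∑ k : Fin (n+1),
            (eLpNorm (D k) 1 volume + ∑ i : Fin (n+1), eLpNorm (R i k) 1 volume) := by
  obtain ⟨K, hK, hmain⟩ := HardySobolev.exists_lintegral_mixedV_le hn hq1 hq2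
  have hB : ENNReal.ofReal ((HardySobolev.rieszC (n + 1))⁻¹ + HardySobolev.poisA (n + 1)) ≠ ⊤ :=
    ENNReal.ofReal_ne_top
  set B := ENNReal.ofReal ((HardySobolev.rieszC (n + 1))⁻¹ + HardySobolev.poisA (n + 1))
  have hC : ((n + 1 : ℕ) : ℝ≥0∞) * (K * B) ≠ ⊤ :=
    ENNReal.mul_ne_top (ENNReal.natCast_ne_top _) (ENNReal.mul_ne_top hK hB)
  refine ⟨(((n + 1 : ℕ) : ℝ≥0∞) * (K * B)).toReal + 1, by positivity,
    fun f D R hf hD hw hR hr => ?_⟩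
  have hae : AEMeasurable fun x =>
      ENNReal.ofReal √(HardySobolev.bdrySq D (fun j => R j j) x) :=
    (HardySobolev.aemeasurable_bdrySq hD fun j => hR j j).sqrt.ennreal_ofReal
  have hk : ∀ k : Fin (n + 1), ∫⁻ h in Set.Ioi (0:ℝ),
      ENNReal.ofReal (h ^ (-(1 - n * (1 - 1/q)))) * mixedV q k (Delta k h f)
        / ENNReal.ofReal h ≤ K * (B * ∑ k : Fin (n+1),
          (eLpNorm (D k) 1 volume + ∑ i : Fin (n+1), eLpNorm (R i k) 1 volume)) := fun k => by
    refine (hmain f D (fun j => R j j) _ k ⟨hf, hD, hw⟩ (fun j => hr j j) hae.measurable_mk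
      hae.ae_eq_mk.symm).trans ?_
    rw [← lintegral_congr_ae hae.ae_eq_mk]
    gcongr
    refine (HardySobolev.lintegral_sqrt_bdrySq_le hD fun j => hR j j).trans ?_
    refine mul_le_mul_right (Finset.sum_le_sum fun j _ => ?_) _
    gcongr
    exact Finset.single_le_sum (f := fun i => eLpNorm (R i j) 1 volume)
      (fun _ _ => zero_le) (Finset.mem_univ j)
  refine (Finset.sum_le_sum fun k _ => hk k).trans ?_
  rw [Finset.sum_const, Finset.card_univ, Fintype.card_fin, nsmul_eq_mul, ← mul_assoc K,
    ← mul_assoc]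
  gcongr
  rw [← ENNReal.ofReal_toReal hC]
  exact ENNReal.ofReal_le_ofReal (by simp)
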